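/- (Bonnesen-type inequality) Let Ω ∈ 𝒜ₖ with 𝓗¹(∂Ω) < ∞. Then |Ω| ≤ [2𝓗¹(∂Ω) − P(Ω) + π(k−1)ρ(Ω)] ρ(Ω). -/

import Mathlib

open MeasureTheory Metric Set Filter Topology Bornology ENNReal

noncomputable section

abbrev E2 := EuclideanSpace ℝ (Fin 2)

/-- divergence of a vector field on ℝ² -/
def divg (φ : E2 → E2) (x : E2) : ℝ := ∑ i, fderiv ℝ φ x (EuclideanSpace.single i 1) i

/-- the set of admissible values in De Giorgi's definition of perimeter -/
def perimSet (Ω : Set E2) : Set ℝ :=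
  {r | ∃ φ : E2 → E2, ContDiff ℝ 1 φ ∧ HasCompactSupport φ ∧ (∀ x, ‖φ x‖ ≤ 1) ∧
        r = ∫ x in Ω, divg φ x}

/-- De Giorgi perimeter -/
def perimeter (Ω : Set E2) : ℝ := sSup (perimSet Ω)

def HasFinitePerimeter (Ω : Set E2) : Prop := BddAbove (perimSet Ω)

/-- torsional rigidity via the variational formula -/
def torsion (Ω : Set E2) : ℝ :=
  sSup ({0} ∪ {r | ∃ u : E2 → ℝ, ContDiff ℝ 1 u ∧ HasCompactSupport u ∧ tsupport u ⊆ Ω ∧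
      (∫ x in Ω, ‖fderiv ℝ u x‖ ^ 2) ≠ 0 ∧
      r = (∫ x in Ω, u x) ^ 2 / ∫ x in Ω, ‖fderiv ℝ u x‖ ^ 2})

def inradius (Ω : Set E2) : ℝ := sSup ((fun x => infDist x (frontier Ω)) '' Ω)

def innerParallel (Ω : Set E2) (t : ℝ) : Set E2 := {x ∈ Ω | t < infDist x (frontier Ω)}

def boundedComponents (s : Set E2) : Set (Set E2) :=
  {C | ∃ x ∈ s, C = connectedComponentIn s x ∧ IsBounded C}

/-- `s` has at most `k` bounded connected components -/
def nBddCompLe (s : Set E2) (k : ℕ) : Prop :=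
  (boundedComponents s).Finite ∧ (boundedComponents s).ncard ≤ k

/-- the class 𝒜ₖ -/
def memA (k : ℕ) (Ω : Set E2) : Prop :=
  Ω.Nonempty ∧ IsOpen Ω ∧ IsBounded Ω ∧ nBddCompLe Ωᶜ k

/-- points of density `t` of `s` -/
def densityPts (s : Set E2) (t : ℝ≥0∞) : Set E2 :=
  {x | Tendsto (fun r => volume (s ∩ ball x r) / volume (ball x r)) (𝓝[>] (0:ℝ)) (𝓝 t)}

/-- area of the interior parallel set -/
def Afun (Ω : Set E2) (t : ℝ) : ℝ := (volume (innerParallel Ω t)).toReal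

/-- length of the interior parallel -/
def Lfun (Ω : Set E2) (t : ℝ) : ℝ :=
  (μH[1] ({x ∈ Ω | infDist x (frontier Ω) = t})).toReal

/-- a bounded open set with Lipschitz boundary -/
def IsLipschitzDomain (Ω : Set E2) : Prop :=
  ∀ x ∈ frontier Ω, ∃ (g : E2 ≃ₗᵢ[ℝ] E2) (f : ℝ → ℝ) (K : NNReal) (ε : ℝ),
    0 < ε ∧ LipschitzWith K f ∧
    Ω ∩ ball x ε = {y ∈ ball x ε | f ((g (y - x)) 0) < (g (y - x)) 1}

/-- the scale-free shape functional F_q -/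
def Fq (q : ℝ) (Ω : Set E2) : ℝ :=
  perimeter Ω * torsion Ω ^ q / (volume Ω).toReal ^ (2 * q + 1 / 2)

end

/-! Part one: combinatorial inequality -/

/-- dot product on `ℂ` -/
def cdot (u v : ℂ) : ℝ := u.re * v.re + u.im * v.im

lemma cdot_add_left (a b c : ℂ) : cdot (a + b) c = cdot a c + cdot b c := by
  simp [cdot]; ring
lemma cdot_sub_left (a b c : ℂ) : cdot (a - b) c = cdot a c - cdot b c := by
  simp [cdot]; ring
lemma cdot_add_right (a b c : ℂ) : cdot a (b + c) = cdot a b + cdot a c := by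
  simp [cdot]; ring
lemma cdot_sub_right (a b c : ℂ) : cdot a (b - c) = cdot a b - cdot a c := by
  simp [cdot]; ring
lemma cdot_smul_left (r : ℝ) (a b : ℂ) : cdot ((r : ℂ) * a) b = r * cdot a b := by
  simp [cdot]; ring
lemma cdot_smul_right (r : ℝ) (a b : ℂ) : cdot a ((r : ℂ) * b) = r * cdot a b := by
  simp [cdot]; ring
lemma cdot_comm (a b : ℂ) : cdot a b = cdot b a := by
  simp [cdot]; ring
lemma cdot_self (a : ℂ) : cdot a a = ‖a‖ ^ 2 := by
  rw [← Complex.normSq_eq_norm_sq, Complex.normSq_apply]; rfl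
lemma cdot_le (a b : ℂ) : cdot a b ≤ ‖a‖ * ‖b‖ := by
  have h : cdot a b ^ 2 ≤ (‖a‖ * ‖b‖) ^ 2 := by
    rw [mul_pow, ← cdot_self, ← cdot_self]
    unfold cdot
    nlinarith [sq_nonneg (a.re * b.im - a.im * b.re)]
  exact (le_abs_self _).trans (abs_le_of_sq_le_sq h (by positivity))

/-- sign of the real part of `conj a * b` -/
noncomputable def sgn2 (a b : ℂ) : ℝ := Real.sign (cdot a b)

/-- angle of `a,b` up to sign is less than `π/4` -/
def near2 (a b : ℂ) : Prop := 0 < cdot (a ^ 2) (b ^ 2)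

lemma near2_symm {a b : ℂ} (h : near2 a b) : near2 b a := by
  unfold near2 at *; rwa [cdot_comm]

lemma near2_cdot {a b : ℂ} (h : near2 a b) :
    (a.re * b.im - a.im * b.re) ^ 2 < cdot a b ^ 2 := by
  unfold near2 cdot at *
  simp [pow_two] at h ⊢
  nlinarith

lemma near2_ne {a b : ℂ} (h : near2 a b) : cdot a b ≠ 0 := by
  have := near2_cdot h
  intro h0
  rw [h0] at this
  nlinarith [sq_nonneg (a.re * b.im - a.im * b.re)]

lemma sgn2_sq {a b : ℂ} (h : near2 a b) : sgn2 a b * sgn2 a b = 1 := by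
  unfold sgn2
  rcases Real.sign_apply_eq_of_ne_zero _ (near2_ne h) with h | h <;> rw [h] <;> norm_num

lemma sgn2_comm (a b : ℂ) : sgn2 a b = sgn2 b a := by
  unfold sgn2; rw [cdot_comm]

lemma sgn2_mul {a w b : ℂ} (h1 : near2 a w) (h2 : near2 w b) :
    sgn2 a w * sgn2 w b = sgn2 a b := by
  have e1 := near2_cdot h1
  have e2 := near2_cdot h2
  set p := cdot a w with hp
  set q := cdot w b with hq
  have key : p * q - (a.re * w.im - a.im * w.re) * (w.re * b.im - w.im * b.re)
      = (w.re ^ 2 + w.im ^ 2) * cdot a b := by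
    simp only [hp, hq, cdot]; ring
  have hlt : |(a.re * w.im - a.im * w.re) * (w.re * b.im - w.im * b.re)| < |p * q| := by
    rw [abs_mul, abs_mul]
    exact mul_lt_mul'' (sq_lt_sq.1 e1) (sq_lt_sq.1 e2) (abs_nonneg _) (abs_nonneg _)
  have hw : 0 ≤ w.re ^ 2 + w.im ^ 2 := by positivity
  have hpq : Real.sign (p * q) = Real.sign (cdot a b) := by
    rcases le_or_gt (p * q) 0 with h | h
    · rw [abs_of_nonpos h] at hlt
      have h3 := (abs_lt.1 hlt).1
      have h4 : (w.re ^ 2 + w.im ^ 2) * cdot a b < 0 := by linarith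
      have h5 : cdot a b < 0 := by
        by_contra hh
        push Not at hh
        nlinarith [mul_nonneg hw hh]
      have h6 : p * q < 0 := by linarith [abs_nonneg ((a.re * w.im - a.im * w.re) * (w.re * b.im - w.im * b.re))]
      rw [Real.sign_of_neg h5, Real.sign_of_neg h6]
    · rw [abs_of_pos h] at hlt
      have h3 := (abs_lt.1 hlt).2
      have h4 : 0 < (w.re ^ 2 + w.im ^ 2) * cdot a b := by linarith
      have h5 : 0 < cdot a b := by
        by_contra hh
        push Not at hh
        nlinarith [mul_nonneg hw (neg_nonneg.2 hh)]
      rw [Real.sign_of_pos h5, Real.sign_of_pos h]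
  unfold sgn2
  rw [← hpq, ← hp, ← hq]
  rcases lt_trichotomy p 0 with h | h | h <;> rcases lt_trichotomy q 0 with h' | h' | h' <;>
  simp [Real.sign_of_pos, Real.sign_of_neg, h, h', mul_pos_of_neg_of_neg, mul_neg_of_neg_of_pos, mul_neg_of_pos_of_neg]

lemma near2_of_ball {p v z : ℂ} {t : ℝ} {a b : ℂ} (ha : a ^ 2 = p - z) (hb : b ^ 2 = v - z)
    (hp : t < ‖p - z‖) (hv : ‖v - p‖ ≤ t) : near2 a b := by
  unfold near2
  rw [ha, hb]
  have h1 : cdot (p - z) (v - z) = ‖p - z‖ ^ 2 - cdot (p - z) (p - v) := by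
    rw [← cdot_self, ← cdot_sub_right]; congr 1; ring
  have h2 := cdot_le (p - z) (p - v)
  rw [norm_sub_rev] at hv
  rw [h1]
  have : 0 ≤ ‖p - v‖ := norm_nonneg _
  nlinarith

lemma exists_sq_root (w : ℂ) : ∃ a : ℂ, a ^ 2 = w := IsAlgClosed.exists_pow_nat_eq w (by norm_num)


/-- intersection points of two circles of radius `t` -/
noncomputable def vtx (t : ℝ) (a b : ℂ) (ε : ℝ) : ℂ :=
  (a + b) / 2 + ((ε * √(t ^ 2 - ‖b - a‖ ^ 2 / 4) / ‖b - a‖ : ℝ) : ℂ) * (Complex.I * (b - a))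

lemma cdot_I_self (d : ℂ) : cdot d (Complex.I * d) = 0 := by simp [cdot]; ring
lemma cdot_I_I (c d : ℂ) : cdot (Complex.I * c) (Complex.I * d) = cdot c d := by
  simp [cdot]; ring

lemma vtx_sub_left (t : ℝ) (a b : ℂ) (ε : ℝ) : vtx t a b ε - a =
    ((1 / 2 : ℝ) : ℂ) * (b - a) +
      ((ε * √(t ^ 2 - ‖b - a‖ ^ 2 / 4) / ‖b - a‖ : ℝ) : ℂ) * (Complex.I * (b - a)) := by
  unfold vtx; push_cast; ring

lemma vtx_sub_right (t : ℝ) (a b : ℂ) (ε : ℝ) : vtx t a b ε - b =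
    ((-1 / 2 : ℝ) : ℂ) * (b - a) +
      ((ε * √(t ^ 2 - ‖b - a‖ ^ 2 / 4) / ‖b - a‖ : ℝ) : ℂ) * (Complex.I * (b - a)) := by
  unfold vtx; push_cast; ring

lemma norm_comb_sq (d : ℂ) (p q : ℝ) : ‖(p : ℂ) * d + (q : ℂ) * (Complex.I * d)‖ ^ 2
    = (p ^ 2 + q ^ 2) * ‖d‖ ^ 2 := by
  rw [← cdot_self, ← cdot_self]; simp [cdot]; ring

lemma vtx_norm_left {t : ℝ} {a b : ℂ} {ε : ℝ} (hε : ε ^ 2 = 1) (ht : 0 < t) (hab : a ≠ b)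
    (h2 : ‖b - a‖ < 2 * t) : ‖vtx t a b ε - a‖ = t := by
  have hd : 0 < ‖b - a‖ := norm_pos_iff.2 (sub_ne_zero.2 hab.symm)
  have hs : 0 ≤ t ^ 2 - ‖b - a‖ ^ 2 / 4 := by nlinarith
  have : ‖vtx t a b ε - a‖ ^ 2 = t ^ 2 := by
    rw [vtx_sub_left, norm_comb_sq, div_pow, div_pow, mul_pow, Real.sq_sqrt hs, hε]
    field_simp; ring
  exact (pow_left_inj₀ (norm_nonneg _) ht.le two_ne_zero).1 this

lemma vtx_norm_right {t : ℝ} {a b : ℂ} {ε : ℝ} (hε : ε ^ 2 = 1) (ht : 0 < t) (hab : a ≠ b)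
    (h2 : ‖b - a‖ < 2 * t) : ‖vtx t a b ε - b‖ = t := by
  have hd : 0 < ‖b - a‖ := norm_pos_iff.2 (sub_ne_zero.2 hab.symm)
  have hs : 0 ≤ t ^ 2 - ‖b - a‖ ^ 2 / 4 := by nlinarith
  have : ‖vtx t a b ε - b‖ ^ 2 = t ^ 2 := by
    rw [vtx_sub_right, norm_comb_sq, div_pow, div_pow, mul_pow, Real.sq_sqrt hs, hε]
    field_simp; ring
  exact (pow_left_inj₀ (norm_nonneg _) ht.le two_ne_zero).1 this

/-- The vertex on the side of `u` is the highest point of the lens. -/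
lemma vtx_highest {t : ℝ} {a b u : ℂ} {ε : ℝ} (hε : ε ^ 2 = 1) (ht : 0 < t) (hab : a ≠ b)
    (h2 : ‖b - a‖ < 2 * t) (hu : ‖u‖ = 1) (hs : 0 < ε * cdot u (Complex.I * (b - a)))
    (hc : |cdot u (b - a)| < ‖b - a‖ ^ 2 / (2 * t)) {y : ℂ} (hya : ‖y - a‖ ≤ t)
    (hyb : ‖y - b‖ ≤ t) : cdot y u ≤ cdot (vtx t a b ε) u := by
  have hd : 0 < ‖b - a‖ := norm_pos_iff.2 (sub_ne_zero.2 hab.symm)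
  have hs0 : 0 < t ^ 2 - ‖b - a‖ ^ 2 / 4 := by nlinarith
  set v := vtx t a b ε with hv
  have hva : ‖v - a‖ = t := vtx_norm_left hε ht hab h2
  have hvb : ‖v - b‖ = t := vtx_norm_right hε ht hab h2
  have ea : cdot (y - v) (v - a) ≤ 0 := by
    have h1 := cdot_le (y - a) (v - a)
    have h3 : cdot (y - v) (v - a) = cdot (y - a) (v - a) - ‖v - a‖ ^ 2 := by
      rw [← cdot_self, ← cdot_sub_left]; congr 1; ring
    rw [h3]; rw [hva] at *; nlinarith
  have eb : cdot (y - v) (v - b) ≤ 0 := by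
    have h1 := cdot_le (y - b) (v - b)
    have h3 : cdot (y - v) (v - b) = cdot (y - b) (v - b) - ‖v - b‖ ^ 2 := by
      rw [← cdot_self, ← cdot_sub_left]; congr 1; ring
    rw [h3]; rw [hvb] at *; nlinarith
  set d := b - a with hdd
  set s := √(t ^ 2 - ‖d‖ ^ 2 / 4) with hsd
  have hspos : 0 < s := Real.sqrt_pos.2 hs0
  have hssq : s ^ 2 = t ^ 2 - ‖d‖ ^ 2 / 4 := Real.sq_sqrt hs0.le
  set α := cdot u d / ‖d‖ ^ 2 with hα
  set β := cdot u (Complex.I * d) * ε / ‖d‖ with hβ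
  have hβpos : 0 < β := by rw [hβ]; apply div_pos _ hd; linarith
  have hpyth : cdot u d ^ 2 + cdot u (Complex.I * d) ^ 2 = ‖d‖ ^ 2 := by
    have : cdot u d ^ 2 + cdot u (Complex.I * d) ^ 2 = ‖u‖ ^ 2 * ‖d‖ ^ 2 := by
      rw [← cdot_self, ← cdot_self]; simp [cdot]; ring
    rw [this, hu]; ring
  have hαβ : α ^ 2 * ‖d‖ ^ 2 + β ^ 2 = 1 := by
    rw [hα, hβ, div_pow, div_pow, mul_pow, hε]
    field_simp
    linarith
  have hαt : |α| < 1 / (2 * t) := by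
    rw [hα, abs_div, abs_of_pos (by positivity : 0 < ‖d‖ ^ 2), div_lt_iff₀ (by positivity)]
    calc _ < _ := hc
      _ = _ := by ring
  have hα2 : α ^ 2 * (4 * t ^ 2) ≤ 1 := by
    have := abs_lt.1 hαt
    have h4 : |α| * (2 * t) < 1 := by rwa [lt_div_iff₀ (by positivity)] at hαt
    have h5 : (|α| * (2 * t)) ^ 2 ≤ 1 := by
      apply pow_le_one₀ (by positivity) h4.le
    rw [mul_pow, sq_abs] at h5; linarith
  -- s / t ≤ β
  have hβs : s ≤ β * t := by
    have : s ^ 2 ≤ (β * t) ^ 2 := by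
      rw [mul_pow, hssq]
      nlinarith [sq_nonneg ‖d‖]
    exact (le_abs_self _).trans (abs_le_of_sq_le_sq this (by positivity))
  have hαs : |α| ≤ β / (2 * s) := by
    refine hαt.le.trans ?_
    rw [div_le_div_iff₀ (by positivity) (by positivity)]; linarith
  -- decomposition of u
  have hu' : ∀ w, cdot w u = (β / (2 * s) + α) * cdot w (v - a) + (β / (2 * s) - α) * cdot w (v - b) := by
    intro w
    have e1 : v - a = ((1 / 2 : ℝ) : ℂ) * d + ((ε * s / ‖d‖ : ℝ) : ℂ) * (Complex.I * d) :=
      vtx_sub_left t a b ε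
    have e2 : v - b = ((-1 / 2 : ℝ) : ℂ) * d + ((ε * s / ‖d‖ : ℝ) : ℂ) * (Complex.I * d) :=
      vtx_sub_right t a b ε
    have e3 : ‖d‖ ^ 2 * cdot w u = cdot u d * cdot w d + cdot u (Complex.I * d) * cdot w (Complex.I * d) := by
      rw [← cdot_self]; simp [cdot]; ring
    rw [e1, e2]
    simp only [cdot_add_right, cdot_smul_right]
    have e4 : β / (2 * s) * (ε * s / ‖d‖) * 2 = cdot u (Complex.I * d) / ‖d‖ ^ 2 := by
      rw [hβ]; field_simp; rw [hε]; ring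
    have e5 : cdot w u = α * cdot w d + cdot u (Complex.I * d) / ‖d‖ ^ 2 * cdot w (Complex.I * d) := by
      rw [hα]; field_simp; linarith
    rw [e5, ← e4]; ring
  have := hu' (y - v)
  rw [cdot_sub_left] at this
  obtain ⟨h3, h4⟩ := abs_le.1 hαs
  nlinarith [mul_nonneg (by linarith : 0 ≤ β / (2 * s) + α) (neg_nonneg.2 ea),
    mul_nonneg (by linarith : 0 ≤ β / (2 * s) - α) (neg_nonneg.2 eb)]


/-- the point of the circle around `x i` in direction `u` is not covered -/
def isExp {n : ℕ} (x : Fin n → ℂ) (t : ℝ) (u : ℂ) (i : Fin n) : Prop :=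
  ∀ r, t ≤ ‖x i + (t : ℂ) * u - x r‖

/-- sign attached to a Boolean -/
def bsgn (b : Bool) : ℝ := if b then 1 else -1

lemma bsgn_sq (b : Bool) : bsgn b ^ 2 = 1 := by cases b <;> simp [bsgn]

/-- the intersection point of two circles is present and uncovered -/
def vActive {n : ℕ} (x : Fin n → ℂ) (t : ℝ) (i j : Fin n) (b : Bool) : Prop :=
  ‖x j - x i‖ < 2 * t ∧ ∀ r, t ≤ ‖vtx t (x i) (x j) (bsgn b) - x r‖

/-- vertices of the union of balls which are locally highest in direction `u` -/
def isVtx {n : ℕ} (x : Fin n → ℂ) (t : ℝ) (u : ℂ) (q : Fin n × Fin n × Bool) : Prop :=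
  q.1 < q.2.1 ∧ vActive x t q.1 q.2.1 q.2.2 ∧
  0 < bsgn q.2.2 * cdot u (Complex.I * (x q.2.1 - x q.1)) ∧
  |cdot u (x q.2.1 - x q.1)| < ‖x q.2.1 - x q.1‖ ^ 2 / (2 * t)

/-- generic direction -/
def genDir {n : ℕ} (x : Fin n → ℂ) (t : ℝ) (u : ℂ) : Prop :=
  ∀ i j, i ≠ j → ‖x i + (t : ℂ) * u - x j‖ ≠ t ∧ cdot u (Complex.I * (x j - x i)) ≠ 0

/-- compatibility of the values of a twisted function on two balls -/
def cpt {n : ℕ} (w : Fin n → ℂ) (g : Fin n → ℝ) (i j : Fin n) : Prop :=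
  g j = sgn2 (w i) (w j) * g i

section
variable {n : ℕ} {x w : Fin n → ℂ} {z : ℂ} {t : ℝ} {g : Fin n → ℝ}

lemma cpt_iff (hw : ∀ i, w i ^ 2 = x i - z) (hz : ∀ i, t < ‖x i - z‖) {i j : Fin n} {v a : ℂ}
    (ha : a ^ 2 = v - z) (hi : ‖v - x i‖ ≤ t) (hj : ‖v - x j‖ ≤ t) :
    cpt w g i j ↔ g i * sgn2 (w i) a = g j * sgn2 (w j) a := by
  have hni := near2_of_ball (hw i) ha (hz i) hi
  have hnj := near2_of_ball (hw j) ha (hz j) hj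
  have h1 := sgn2_mul hni (near2_symm hnj)
  have h2 := sgn2_sq hni
  have h3 := sgn2_sq hnj
  rw [sgn2_comm a (w j)] at h1
  unfold cpt
  rw [← h1]
  set p := sgn2 (w i) a
  set q := sgn2 (w j) a
  constructor
  · intro h; rw [h]; linear_combination (- g i * p) * h3
  · intro h; linear_combination (- g j) * h3 - q * h

lemma cpt_symm (hw : ∀ i, w i ^ 2 = x i - z) (hz : ∀ i, t < ‖x i - z‖) {i j : Fin n} {v : ℂ}
    (hi : ‖v - x i‖ ≤ t) (hj : ‖v - x j‖ ≤ t) (h : cpt w g i j) : cpt w g j i := by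
  obtain ⟨a, ha⟩ := exists_sq_root (v - z)
  rw [cpt_iff hw hz ha hi hj] at h
  rw [cpt_iff hw hz ha hj hi, h]

lemma cpt_trans (hw : ∀ i, w i ^ 2 = x i - z) (hz : ∀ i, t < ‖x i - z‖) {i j r : Fin n} {v : ℂ}
    (hi : ‖v - x i‖ ≤ t) (hj : ‖v - x j‖ ≤ t) (hr : ‖v - x r‖ ≤ t)
    (h : cpt w g i r) (h' : cpt w g r j) : cpt w g i j := by
  obtain ⟨a, ha⟩ := exists_sq_root (v - z)
  rw [cpt_iff hw hz ha hi hr] at h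
  rw [cpt_iff hw hz ha hr hj] at h'
  rw [cpt_iff hw hz ha hi hj, h, h']

/-- height of the lens -/
noncomputable def lensH (x : Fin n → ℂ) (t : ℝ) (u : ℂ) (i j : Fin n) : ℝ :=
  sSup ((fun y => cdot y u) '' (closedBall (x i) t ∩ closedBall (x j) t))

lemma lensH_comm (x : Fin n → ℂ) (t : ℝ) (u : ℂ) (i j : Fin n) :
    lensH x t u i j = lensH x t u j i := by
  unfold lensH; rw [inter_comm]

lemma le_lensH {u : ℂ} {i j : Fin n} {y : ℂ} (hi : ‖y - x i‖ ≤ t) (hj : ‖y - x j‖ ≤ t) :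
    cdot y u ≤ lensH x t u i j := by
  apply le_csSup
  · have : IsCompact (closedBall (x i) t ∩ closedBall (x j) t) :=
      (isCompact_closedBall _ _).inter_right isClosed_closedBall
    refine (this.image ?_).bddAbove
    unfold cdot; fun_prop
  · exact ⟨y, ⟨by simpa [dist_eq_norm] using hi, by simpa [dist_eq_norm] using hj⟩, rfl⟩

lemma lensH_le {u : ℂ} {i j : Fin n} {c : ℝ} {y : ℂ} (hi : ‖y - x i‖ ≤ t) (hj : ‖y - x j‖ ≤ t)
    (h : ∀ y, ‖y - x i‖ ≤ t → ‖y - x j‖ ≤ t → cdot y u ≤ c) : lensH x t u i j ≤ c := by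
  apply csSup_le
  · exact ⟨_, y, ⟨by simpa [dist_eq_norm] using hi, by simpa [dist_eq_norm] using hj⟩, rfl⟩
  · rintro _ ⟨y, ⟨h1, h2⟩, rfl⟩
    exact h y (by simpa [dist_eq_norm] using h1) (by simpa [dist_eq_norm] using h2)

/-- moving inside a closed ball towards its top increases height -/
lemma lt_lensH {u : ℂ} (ht : 0 < t) (hu : ‖u‖ = 1) {i r : Fin n} {v : ℂ} (hi : ‖v - x i‖ ≤ t)
    (hr : ‖v - x r‖ < t) (hne : cdot v u < cdot (x i + (t : ℂ) * u) u) :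
    cdot v u < lensH x t u i r := by
  set T := x i + (t : ℂ) * u with hT
  have hTi : ‖T - x i‖ = t := by rw [hT]; simp [hu, abs_of_pos ht]
  obtain ⟨l, hl0, hl1, hl⟩ : ∃ l : ℝ, 0 < l ∧ l ≤ 1 ∧ l * ‖T - v‖ ≤ t - ‖v - x r‖ := by
    refine ⟨min 1 ((t - ‖v - x r‖) / (‖T - v‖ + 1)), ?_, min_le_left _ _, ?_⟩
    · apply lt_min one_pos; apply div_pos (by linarith); positivity
    · calc _ ≤ (t - ‖v - x r‖) / (‖T - v‖ + 1) * (‖T - v‖ + 1) := by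
            apply mul_le_mul (min_le_right _ _) (by linarith) (norm_nonneg _)
            exact div_nonneg (by linarith) (by positivity)
        _ = _ := by field_simp
  have h1 : ‖(v + (l : ℂ) * (T - v)) - x i‖ ≤ t := by
    have : (v + (l : ℂ) * (T - v)) - x i = ((1 - l : ℝ) : ℂ) * (v - x i) + (l : ℂ) * (T - x i) := by
      push_cast; ring
    rw [this]
    calc _ ≤ ‖((1 - l : ℝ) : ℂ) * (v - x i)‖ + ‖(l : ℂ) * (T - x i)‖ := norm_add_le _ _
      _ = (1 - l) * ‖v - x i‖ + l * t := by
        rw [norm_mul, norm_mul, hTi, Complex.norm_real, Complex.norm_real,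
          Real.norm_of_nonneg (by linarith), Real.norm_of_nonneg hl0.le]
      _ ≤ (1 - l) * t + l * t := by gcongr
      _ = t := by ring
  have h2 : ‖(v + (l : ℂ) * (T - v)) - x r‖ ≤ t := by
    have : (v + (l : ℂ) * (T - v)) - x r = (v - x r) + (l : ℂ) * (T - v) := by ring
    rw [this]
    calc _ ≤ ‖v - x r‖ + ‖(l : ℂ) * (T - v)‖ := norm_add_le _ _
      _ = ‖v - x r‖ + l * ‖T - v‖ := by
        rw [norm_mul, Complex.norm_real, Real.norm_of_nonneg hl0.le]
      _ ≤ t := by linarith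
  refine lt_of_lt_of_le ?_ (le_lensH h1 h2)
  rw [cdot_add_left, cdot_smul_left, cdot_sub_left]
  nlinarith

/-- overlapping pair -/
def ovl (x : Fin n → ℂ) (t : ℝ) (i j : Fin n) : Prop := ‖x j - x i‖ < 2 * t

lemma ovl_of {i j : Fin n} {v : ℂ} (hi : ‖v - x i‖ ≤ t) (hj : ‖v - x j‖ < t) : ovl x t i j := by
  unfold ovl
  calc ‖x j - x i‖ = ‖(v - x i) - (v - x j)‖ := by congr 1; ring
    _ ≤ ‖v - x i‖ + ‖v - x j‖ := norm_sub_le _ _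
    _ < 2 * t := by linarith

lemma ovl_symm {i j : Fin n} (h : ovl x t i j) : ovl x t j i := by
  unfold ovl at *; rwa [norm_sub_rev]

lemma cpt_of_top (ht : 0 < t) (hw : ∀ i, w i ^ 2 = x i - z) (hz : ∀ i, t < ‖x i - z‖) {u : ℂ} (hu : ‖u‖ = 1)
    (hexp : ∀ i, ¬ isExp x t u i → ∃ q, ‖x i + (t : ℂ) * u - x q‖ < t ∧ cpt w g i q)
    {i j : Fin n}
    (IH : ∀ i' j', ovl x t i' j' → lensH x t u i j < lensH x t u i' j' → cpt w g i' j')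
    (hT : ‖x i + (t : ℂ) * u - x j‖ < t) : cpt w g i j := by
  set T := x i + (t : ℂ) * u with hTd
  have hTi : ‖T - x i‖ = t := by rw [hTd]; simp [hu, abs_of_pos ht]
  obtain ⟨q, hq, hc⟩ := hexp i (by intro h; exact absurd (h j) (not_le.2 hT))
  have hTu : cdot T u = cdot (x i) u + t := by
    rw [hTd, cdot_add_left, cdot_smul_left, cdot_self, hu]; ring
  refine cpt_trans hw hz hTi.le hT.le hq.le hc (IH q j (ovl_of hq.le hT) ?_)
  refine lt_of_le_of_lt (lensH_le (c := cdot T u) hTi.le hT.le ?_) ?_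
  · intro y hy _
    have := cdot_le (y - x i) u
    rw [hu, cdot_sub_left] at this
    rw [hTu]; linarith
  · rw [lensH_comm]
    refine lt_lensH ht hu hT.le hq ?_
    have := cdot_le (T - x j) u
    rw [hu, cdot_sub_left] at this
    rw [cdot_add_left (x j), cdot_smul_left, cdot_self, hu]
    linarith

lemma cpt_step (hx : Function.Injective x) (ht : 0 < t) (hw : ∀ i, w i ^ 2 = x i - z)
    (hz : ∀ i, t < ‖x i - z‖) {u : ℂ} (hu : ‖u‖ = 1) (hg : genDir x t u)
    (hexp : ∀ i, ¬ isExp x t u i → ∃ q, ‖x i + (t : ℂ) * u - x q‖ < t ∧ cpt w g i q)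
    (hvt : ∀ i j b, isVtx x t u (i, j, b) → cpt w g i j)
    {i j : Fin n} (hij : i < j) (ho : ovl x t i j)
    (IH : ∀ i' j', ovl x t i' j' → lensH x t u i j < lensH x t u i' j' → cpt w g i' j') :
    cpt w g i j := by
  by_cases h1 : ‖x i + (t : ℂ) * u - x j‖ ≤ t
  · exact cpt_of_top ht hw hz hu hexp IH (lt_of_le_of_ne h1 (hg i j hij.ne).1)
  by_cases h2 : ‖x j + (t : ℂ) * u - x i‖ ≤ t
  · have h2' := lt_of_le_of_ne h2 (hg j i hij.ne').1
    have hTj : ‖x j + (t : ℂ) * u - x j‖ = t := by simp [hu, abs_of_pos ht]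
    refine cpt_symm hw hz hTj.le h2'.le (cpt_of_top ht hw hz hu hexp ?_ h2')
    intro i' j' h3 h4
    rw [lensH_comm] at h4
    exact IH i' j' h3 h4
  push Not at h1 h2
  have hne : x i ≠ x j := fun h => hij.ne (hx h)
  have sq1 : ‖x i + (t : ℂ) * u - x j‖ ^ 2 = t ^ 2 - 2 * t * cdot u (x j - x i) + ‖x j - x i‖ ^ 2 := by
    have : t ^ 2 = t ^ 2 * ‖u‖ ^ 2 := by rw [hu]; ring
    rw [this, ← cdot_self, ← cdot_self, ← cdot_self]
    simp [cdot]; ring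
  have sq2 : ‖x j + (t : ℂ) * u - x i‖ ^ 2 = t ^ 2 + 2 * t * cdot u (x j - x i) + ‖x j - x i‖ ^ 2 := by
    have : t ^ 2 = t ^ 2 * ‖u‖ ^ 2 := by rw [hu]; ring
    rw [this, ← cdot_self, ← cdot_self, ← cdot_self]
    simp [cdot]; ring
  have hc : |cdot u (x j - x i)| < ‖x j - x i‖ ^ 2 / (2 * t) := by
    rw [lt_div_iff₀ (by positivity), ← abs_of_pos (by positivity : 0 < 2 * t), ← abs_mul, abs_lt]
    constructor <;> nlinarith
  obtain ⟨b, hb⟩ : ∃ b : Bool, 0 < bsgn b * cdot u (Complex.I * (x j - x i)) := by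
    rcases lt_or_gt_of_ne (hg i j hij.ne).2 with h | h
    · exact ⟨false, by simp [bsgn]; linarith⟩
    · exact ⟨true, by simp [bsgn]; linarith⟩
  set v := vtx t (x i) (x j) (bsgn b) with hv
  have hvi : ‖v - x i‖ = t := vtx_norm_left (bsgn_sq b) ht hne ho
  have hvj : ‖v - x j‖ = t := vtx_norm_right (bsgn_sq b) ht hne ho
  by_cases hcov : ∀ r, t ≤ ‖v - x r‖
  · exact hvt i j b ⟨hij, ⟨ho, hcov⟩, hb, hc⟩
  push Not at hcov
  obtain ⟨r, hr⟩ := hcov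
  have hle : lensH x t u i j ≤ cdot v u := lensH_le hvi.le hvj.le
    (fun y hyi hyj => vtx_highest (bsgn_sq b) ht hne ho hu hb hc hyi hyj)
  have aux : ∀ p o, ‖v - x p‖ = t → ‖v - x o‖ = t → t < ‖x p + (t : ℂ) * u - x o‖ →
      cdot v u < cdot (x p + (t : ℂ) * u) u := by
    intro p o hp hoo hlt
    have hneq : 0 < ‖v - x p - (t : ℂ) * u‖ := by
      rw [norm_pos_iff]
      intro h0
      have : v = x p + (t : ℂ) * u := by linear_combination h0
      rw [← this, hoo] at hlt
      exact lt_irrefl _ hlt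
    have h5 : ‖v - x p - (t : ℂ) * u‖ ^ 2 = ‖v - x p‖ ^ 2 - 2 * t * (cdot v u - cdot (x p) u) + t ^ 2 * ‖u‖ ^ 2 := by
      rw [← cdot_self, ← cdot_self, ← cdot_self]
      simp [cdot]; ring
    rw [cdot_add_left, cdot_smul_left, cdot_self, hu]
    rw [hp, hu] at h5
    have : 0 < ‖v - x p - (t : ℂ) * u‖ ^ 2 := by positivity
    nlinarith
  have c1 : cpt w g i r := IH i r (ovl_of hvi.le hr)
    (lt_of_le_of_lt hle (lt_lensH ht hu hvi.le hr (aux i j hvi hvj h1)))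
  have c2 : cpt w g j r := IH j r (ovl_of hvj.le hr)
    (lt_of_le_of_lt hle (lt_lensH ht hu hvj.le hr (aux j i hvj hvi h2)))
  exact cpt_trans hw hz hvi.le hvj.le hr.le c1 (cpt_symm hw hz hvj.le hr.le c2)

lemma mid_in {i j : Fin n} (ho : ovl x t i j) :
    ‖(x i + x j) / 2 - x i‖ < t ∧ ‖(x i + x j) / 2 - x j‖ < t := by
  unfold ovl at ho
  constructor
  · have : (x i + x j) / 2 - x i = (x j - x i) / 2 := by ring
    rw [this, norm_div]; simp; linarith
  · have : (x i + x j) / 2 - x j = -((x j - x i) / 2) := by ring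
    rw [this, norm_neg, norm_div]; simp; linarith

lemma cpt_self (hw : ∀ i, w i ^ 2 = x i - z) (hz : ∀ i, t < ‖x i - z‖) (ht : 0 < t) (i : Fin n) :
    cpt w g i i := by
  have h := near2_of_ball (hw i) (hw i) (hz i) (by simp [ht.le])
  have h2 := sgn2_mul h h
  have h3 := sgn2_sq h
  unfold cpt
  rw [← h2, h3, one_mul]

lemma cpt_all (hx : Function.Injective x) (ht : 0 < t) (hw : ∀ i, w i ^ 2 = x i - z)
    (hz : ∀ i, t < ‖x i - z‖) {u : ℂ} (hu : ‖u‖ = 1) (hg : genDir x t u)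
    (hexp : ∀ i, ¬ isExp x t u i → ∃ q, ‖x i + (t : ℂ) * u - x q‖ < t ∧ cpt w g i q)
    (hvt : ∀ i j b, isVtx x t u (i, j, b) → cpt w g i j) :
    ∀ i j, ovl x t i j → cpt w g i j := by
  classical
  by_contra hcon
  push Not at hcon
  obtain ⟨i0, j0, ho0, hb0⟩ := hcon
  let S : Finset (Fin n × Fin n) := Finset.univ.filter (fun p => ovl x t p.1 p.2 ∧ ¬ cpt w g p.1 p.2)
  obtain ⟨⟨i, j⟩, hm, hmax⟩ := S.exists_max_image (fun p => lensH x t u p.1 p.2)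
    ⟨(i0, j0), by simp [S, ho0, hb0]⟩
  simp only [S, Finset.mem_filter, Finset.mem_univ, true_and] at hm hmax
  have IH : ∀ i' j', ovl x t i' j' → lensH x t u i j < lensH x t u i' j' → cpt w g i' j' := by
    intro i' j' h1 h2
    by_contra h3
    exact absurd (hmax (i', j') ⟨h1, h3⟩) (not_le.2 h2)
  rcases lt_trichotomy i j with h | h | h
  · exact hm.2 (cpt_step hx ht hw hz hu hg hexp hvt h hm.1 IH)
  · subst h
    exact hm.2 (cpt_self hw hz ht _)
  · have hmid := mid_in hm.1
    refine hm.2 (cpt_symm hw hz hmid.2.le hmid.1.le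
      (cpt_step hx ht hw hz hu hg hexp hvt h (ovl_symm hm.1) ?_))
    rw [lensH_comm]; exact IH

/-- propagation of vanishing over a preconnected set -/
lemma prop_zero (hc : ∀ i j, ovl x t i j → cpt w g i j) (ht : 0 < t) {K : Set ℂ}
    (hK : IsPreconnected K) (hcov : K ⊆ ⋃ i, ball (x i) t) {y : ℂ} (hy : y ∈ K)
    {i0 : Fin n} (hi0 : y ∈ ball (x i0) t) (h0 : g i0 = 0) {i : Fin n} (hi : x i ∈ K) : g i = 0 := by
  by_contra hgi
  have := hK (⋃ i ∈ {i | g i = 0}, ball (x i) t) (⋃ i ∈ {i | g i ≠ 0}, ball (x i) t)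
    (isOpen_biUnion fun _ _ => isOpen_ball) (isOpen_biUnion fun _ _ => isOpen_ball)
    (by
      intro p hp
      obtain ⟨i, hpi⟩ := mem_iUnion.1 (hcov hp)
      by_cases h : g i = 0
      · left; exact mem_biUnion (show i ∈ {i | g i = 0} from h) hpi
      · right; exact mem_biUnion (show i ∈ {i | g i ≠ 0} from h) hpi)
    ⟨y, hy, mem_biUnion (show i0 ∈ {i | g i = 0} from h0) hi0⟩
    ⟨x i, hi, mem_biUnion (show i ∈ {i | g i ≠ 0} from hgi) (mem_ball_self ht)⟩
  obtain ⟨p, _, hp1, hp2⟩ := this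
  simp only [mem_iUnion, exists_prop, mem_ofPred_eq] at hp1 hp2
  obtain ⟨a, ha, hpa⟩ := hp1
  obtain ⟨b, hb, hpb⟩ := hp2
  rw [mem_ball, dist_eq_norm] at hpa hpb
  have := hc a b (ovl_of hpa.le hpb)
  unfold cpt at this
  rw [ha, mul_zero] at this
  exact hb this

/-- the twisted function vanishes on balls meeting a large circle -/
lemma circle_zero (hw : ∀ i, w i ^ 2 = x i - z) (hz : ∀ i, t < ‖x i - z‖)
    (hc : ∀ i j, ovl x t i j → cpt w g i j) {R : ℝ} (hR : 0 < R)
    (hcov : sphere z R ⊆ ⋃ i, ball (x i) t) :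
    ∃ y ∈ sphere z R, ∃ i, y ∈ ball (x i) t ∧ g i = 0 := by
  let a : ℝ → ℂ := fun φ => (√R : ℂ) * Complex.exp ((φ / 2 : ℝ) * Complex.I)
  let y : ℝ → ℂ := fun φ => z + a φ ^ 2
  have hacont : Continuous a := by fun_prop
  have hycont : Continuous y := by fun_prop
  have hy : ∀ φ, y φ ∈ sphere z R := by
    intro φ
    have : (√R) ^ 2 = R := Real.sq_sqrt hR.le
    simp [y, a, norm_pow, Complex.norm_exp, abs_of_nonneg (Real.sqrt_nonneg R), this]
  choose p hp using fun φ => mem_iUnion.1 (hcov (hy φ))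
  have haz : ∀ φ, a φ ^ 2 = y φ - z := by intro φ; simp [y]
  let Ψ : ℝ → ℝ := fun φ => g (p φ) * sgn2 (w (p φ)) (a φ)
  have hind : ∀ φ i, y φ ∈ ball (x i) t → Ψ φ = g i * sgn2 (w i) (a φ) := by
    intro φ i hi
    have h1 := hp φ
    rw [mem_ball, dist_eq_norm] at h1 hi
    exact (cpt_iff hw hz (haz φ) h1.le hi.le).1 (hc _ _ (ovl_of h1.le hi))
  have hloc : IsLocallyConstant Ψ := by
    rw [IsLocallyConstant.iff_eventually_eq]
    intro φ
    have h1 := hp φ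
    have hnear : near2 (w (p φ)) (a φ) := by
      rw [mem_ball, dist_eq_norm] at h1
      exact near2_of_ball (hw _) (haz φ) (hz _) h1.le
    have hcd : Continuous fun φ' => cdot (w (p φ)) (a φ') := by
      unfold cdot; fun_prop
    have e1 : ∀ᶠ φ' in 𝓝 φ, y φ' ∈ ball (x (p φ)) t :=
      hycont.continuousAt.eventually (isOpen_ball.mem_nhds h1)
    have e2 : ∀ᶠ φ' in 𝓝 φ, sgn2 (w (p φ)) (a φ') = sgn2 (w (p φ)) (a φ) := by
      unfold sgn2
      rcases lt_or_gt_of_ne (near2_ne hnear) with h | h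
      · filter_upwards [hcd.continuousAt.eventually (gt_mem_nhds h)] with φ' h'
        rw [Real.sign_of_neg h, Real.sign_of_neg h']
      · filter_upwards [hcd.continuousAt.eventually (lt_mem_nhds h)] with φ' h'
        rw [Real.sign_of_pos h, Real.sign_of_pos h']
    filter_upwards [e1, e2] with φ' h2 h3
    rw [hind φ' _ h2, h3]
  have hneg : a (2 * Real.pi) = - a 0 := by
    simp [a]
  have hyy : y (2 * Real.pi) = y 0 := by simp [y, hneg]
  have hcst : Ψ (2 * Real.pi) = Ψ 0 := hloc.apply_eq_of_preconnectedSpace _ _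
  have h4 : Ψ (2 * Real.pi) = g (p 0) * sgn2 (w (p 0)) (a (2 * Real.pi)) :=
    hind _ _ (by rw [hyy]; exact hp 0)
  have h5 : sgn2 (w (p 0)) (a (2 * Real.pi)) = - sgn2 (w (p 0)) (a 0) := by
    rw [hneg]; unfold sgn2
    rw [← Real.sign_neg]; congr 1; simp [cdot]; ring
  refine ⟨y 0, hy 0, p 0, hp 0, ?_⟩
  have hnear : near2 (w (p 0)) (a 0) := by
    have h1 := hp 0
    rw [mem_ball, dist_eq_norm] at h1
    exact near2_of_ball (hw _) (haz 0) (hz _) h1.le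
  have h6 := sgn2_sq hnear
  have h7 : Ψ 0 = g (p 0) * sgn2 (w (p 0)) (a 0) := rfl
  rw [hcst, h7, h5] at h4
  linear_combination (-(g (p 0))) * h6 + h4 * sgn2 (w (p 0)) (a 0) / 2

open Classical in
/-- the combinatorial inequality -/
lemma comb_ineq (hx : Function.Injective x) (ht : 0 < t) (hz : ∀ i, t < ‖x i - z‖)
    {u : ℂ} (hu : ‖u‖ = 1) (hg : genDir x t u) {k : ℕ} {R : ℝ} (hR : 0 < R) {K0 : Set ℂ}
    {K : Fin k → Set ℂ} (hK0 : IsPreconnected K0) (hK : ∀ l, IsPreconnected (K l))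
    (hsph : sphere z R ⊆ K0) (hxK : ∀ i, x i ∈ K0 ∨ ∃ l, x i ∈ K l)
    (hcov0 : K0 ⊆ ⋃ i, ball (x i) t) (hcov : ∀ l, K l ⊆ ⋃ i, ball (x i) t) :
    (Finset.univ.filter (fun i => isExp x t u i)).card ≤
      (Finset.univ.filter (fun q => isVtx x t u q)).card + k := by
  choose w hw using fun i => exists_sq_root (x i - z)
  have hnx : ∀ i : {i // ¬ isExp x t u i}, ∃ q, ‖x i + (t : ℂ) * u - x q‖ < t := by
    rintro ⟨i, hi⟩
    unfold isExp at hi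
    push Not at hi
    exact hi
  choose nx hnx using hnx
  let base : Fin k → (Fin n → ℝ) →ₗ[ℝ] ℝ := fun l =>
    if h : ∃ i, x i ∈ K l then LinearMap.proj h.choose else 0
  let F1 : (Fin n → ℝ) →ₗ[ℝ] ({i // ¬ isExp x t u i} → ℝ) := LinearMap.pi fun i =>
    LinearMap.proj (nx i) - sgn2 (w i) (w (nx i)) • LinearMap.proj (i : Fin n)
  let F2 : (Fin n → ℝ) →ₗ[ℝ] ({q // isVtx x t u q} → ℝ) := LinearMap.pi fun q =>
    LinearMap.proj q.1.2.1 - sgn2 (w q.1.1) (w q.1.2.1) • LinearMap.proj q.1.1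
  let F : (Fin n → ℝ) →ₗ[ℝ] ({i // ¬ isExp x t u i} → ℝ) × ({q // isVtx x t u q} → ℝ) × (Fin k → ℝ) :=
    F1.prod (F2.prod (LinearMap.pi base))
  have hinj : Function.Injective F := by
    rw [← LinearMap.ker_eq_bot, LinearMap.ker_eq_bot']
    intro g hFg
    have hF1 : F1 g = 0 := congrArg Prod.fst hFg
    have hF2 : F2 g = 0 := congrArg (fun p => p.2.1) hFg
    have hF3 : LinearMap.pi base g = 0 := congrArg (fun p => p.2.2) hFg
    have hc : ∀ i j, ovl x t i j → cpt w g i j := by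
      apply cpt_all hx ht hw hz hu hg
      · intro i hi
        refine ⟨nx ⟨i, hi⟩, hnx ⟨i, hi⟩, ?_⟩
        have := congrFun hF1 ⟨i, hi⟩
        simp only [F1, LinearMap.pi_apply, LinearMap.sub_apply, LinearMap.smul_apply,
          LinearMap.proj_apply, Pi.zero_apply, smul_eq_mul] at this
        unfold cpt; linarith
      · intro i j b hb
        have := congrFun hF2 ⟨(i, j, b), hb⟩
        simp only [F2, LinearMap.pi_apply, LinearMap.sub_apply, LinearMap.smul_apply,
          LinearMap.proj_apply, Pi.zero_apply, smul_eq_mul] at this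
        unfold cpt; linarith
    funext i
    rcases hxK i with h | ⟨l, h⟩
    · obtain ⟨y, hy, i0, hi0, h0⟩ := circle_zero hw hz hc hR (hsph.trans hcov0)
      exact prop_zero hc ht hK0 hcov0 (hsph hy) hi0 h0 h
    · have hex : ∃ i, x i ∈ K l := ⟨i, h⟩
      have h3 := congrFun hF3 l
      simp only [base, LinearMap.pi_apply, dif_pos hex, LinearMap.proj_apply, Pi.zero_apply] at h3
      exact prop_zero hc ht (hK l) (hcov l) hex.choose_spec (mem_ball_self ht) h3 h
  have := LinearMap.finrank_le_finrank_of_injective hinj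
  simp only [Module.finrank_prod, Module.finrank_fintype_fun_eq_card, Fintype.card_fin] at this
  rw [Fintype.card_subtype_compl, Fintype.card_fin] at this
  rw [← Fintype.card_subtype, ← Fintype.card_subtype]
  have h2 : Fintype.card {i // isExp x t u i} ≤ n := by
    simpa using Fintype.card_subtype_le (fun i => isExp x t u i)
  omega

end


/-! Part two: angular measure -/

/-- unit vector of angle `θ` -/
noncomputable def ue (θ : ℝ) : ℂ := Complex.exp ((θ : ℂ) * Complex.I)

lemma ue_norm (θ : ℝ) : ‖ue θ‖ = 1 := Complex.norm_exp_ofReal_mul_I θ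

lemma ue_re (θ : ℝ) : (ue θ).re = Real.cos θ := Complex.exp_ofReal_mul_I_re θ
lemma ue_im (θ : ℝ) : (ue θ).im = Real.sin θ := Complex.exp_ofReal_mul_I_im θ

lemma ue_cont : Continuous ue := by unfold ue; fun_prop

lemma ue_add_int (θ : ℝ) (m : ℤ) : ue (θ + m * (2 * Real.pi)) = ue θ := by
  apply Complex.ext
  · rw [ue_re, ue_re, Real.cos_add_int_mul_two_pi]
  · rw [ue_im, ue_im, Real.sin_add_int_mul_two_pi]

lemma polar_eq (d : ℂ) : d = (‖d‖ : ℂ) * ue (Complex.arg d) :=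
  (Complex.norm_mul_exp_arg_mul_I d).symm

lemma cdot_ue (θ : ℝ) (d : ℂ) : cdot (ue θ) d = ‖d‖ * Real.cos (θ - Complex.arg d) := by
  conv_lhs => rw [polar_eq d]
  rw [cdot_smul_right]
  unfold cdot
  rw [ue_re, ue_im, ue_re, ue_im, Real.cos_sub]

lemma cdot_ue_I (θ : ℝ) (d : ℂ) : cdot (ue θ) (Complex.I * d) = ‖d‖ * Real.sin (θ - Complex.arg d) := by
  conv_lhs => rw [polar_eq d]
  have : Complex.I * ((‖d‖ : ℂ) * ue (Complex.arg d)) = (‖d‖ : ℂ) * (Complex.I * ue (Complex.arg d)) := by ring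
  rw [this, cdot_smul_right]
  unfold cdot
  simp [ue_re, ue_im, Real.sin_sub]
  ring_nf; simp

/-- angular measure -/
noncomputable def mang : Measure ℝ := volume.restrict (Ioc (-Real.pi) Real.pi)

instance : IsFiniteMeasure mang := by unfold mang; infer_instance

lemma mang_univ : mang univ = ENNReal.ofReal (2 * Real.pi) := by
  unfold mang; rw [Measure.restrict_apply_univ, Real.volume_Ioc]; congr 1; ring

lemma mang_window {S : Set ℝ} (hS : ∀ θ, ∀ m : ℤ, θ + m * (2 * Real.pi) ∈ S ↔ θ ∈ S) (hm : MeasurableSet S) (a : ℝ) :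
    mang S = volume (S ∩ Ioc (a - Real.pi) (a + Real.pi)) := by
  unfold mang
  rw [Measure.restrict_apply hm]
  have h1 := isAddFundamentalDomain_Ioc (T := 2 * Real.pi) (by positivity) (-Real.pi)
  have h2 := isAddFundamentalDomain_Ioc (T := 2 * Real.pi) (by positivity) (a - Real.pi)
  have e1 : -Real.pi + 2 * Real.pi = Real.pi := by ring
  have e2 : a - Real.pi + 2 * Real.pi = a + Real.pi := by ring
  rw [e1] at h1; rw [e2] at h2
  refine h1.measure_set_eq h2 hm ?_
  rintro ⟨g, hg⟩
  obtain ⟨m, rfl⟩ := AddSubgroup.mem_zmultiples_iff.1 hg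
  ext θ
  have := hS θ m
  simp only [mem_preimage]
  rw [← this]
  simp [AddSubgroup.vadd_def, add_comm]

lemma mang_null_cdot {d : ℂ} (hd : d ≠ 0) (c : ℝ) : mang {θ | cdot (ue θ) d = c} = 0 := by
  have hd' : 0 < ‖d‖ := norm_pos_iff.2 hd
  have : ({θ | cdot (ue θ) d = c}).Countable := by
    by_cases hne : ∃ θ0, cdot (ue θ0) d = c
    · obtain ⟨θ0, h0⟩ := hne
      refine Set.Countable.mono (s₂ := (range fun m : ℤ => 2 * m * Real.pi + (θ0 - Complex.arg d) + Complex.arg d) ∪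
        (range fun m : ℤ => 2 * m * Real.pi - (θ0 - Complex.arg d) + Complex.arg d)) ?_
        ((countable_range _).union (countable_range _))
      intro θ hθ
      have hθ' : cdot (ue θ) d = c := hθ
      rw [← h0, cdot_ue, cdot_ue] at hθ'
      have h3 := mul_left_cancel₀ hd'.ne' hθ'
      obtain ⟨m, h | h⟩ := Real.cos_eq_cos_iff.1 h3.symm
      · left; exact ⟨m, by simp only; linarith⟩
      · right; exact ⟨m, by simp only; linarith⟩
    · push Not at hne
      convert countable_empty
      ext θ; simp [hne θ]
  refine le_antisymm ((Measure.restrict_apply_le _ _).trans ?_) bot_le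
  rw [this.measure_zero]

lemma mang_arc {d : ℂ} (hd : d ≠ 0) (b : Bool) {c : ℝ} (hc : 0 < c) (hc1 : c < 1) :
    mang {θ | 0 < bsgn b * cdot (ue θ) (Complex.I * d) ∧ |cdot (ue θ) d| < ‖d‖ * c}
      ≤ ENNReal.ofReal (2 * Real.arcsin c) := by
  have hd' : 0 < ‖d‖ := norm_pos_iff.2 hd
  have hcd : Continuous fun θ => cdot (ue θ) d := by
    have := ue_cont; unfold cdot; fun_prop
  have hcI : Continuous fun θ => cdot (ue θ) (Complex.I * d) := by
    have := ue_cont; unfold cdot; fun_prop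
  have hms : MeasurableSet {θ | 0 < bsgn b * cdot (ue θ) (Complex.I * d) ∧ |cdot (ue θ) d| < ‖d‖ * c} :=
    (measurableSet_lt measurable_const (hcI.measurable.const_mul _)).inter
      (measurableSet_lt hcd.abs.measurable measurable_const)
  rw [mang_window (by intro θ m; simp [ue_add_int]) hms (Complex.arg d)]
  set ψ := Complex.arg d
  have hpi := Real.pi_pos
  have h0 : 0 < Real.arcsin c := Real.arcsin_pos.2 hc
  have h1 : Real.arcsin c ≤ Real.pi / 2 := Real.arcsin_le_pi_div_two c
  have hsin : Real.sin (Real.arcsin c) = c := Real.sin_arcsin (by linarith) hc1.le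
  have key : ∀ w, |w| ≤ Real.pi / 2 → |Real.sin w| < c → |w| < Real.arcsin c := by
    intro w hw hs
    rw [abs_le] at hw
    rw [abs_lt] at hs ⊢
    constructor
    · by_contra hh
      push Not at hh
      have := Real.strictMonoOn_sin.monotoneOn ⟨hw.1, hw.2⟩ ⟨by linarith, by linarith⟩ hh
      rw [Real.sin_neg, hsin] at this
      linarith
    · by_contra hh
      push Not at hh
      have := Real.strictMonoOn_sin.monotoneOn ⟨by linarith, by linarith⟩ ⟨hw.1, hw.2⟩ hh
      rw [hsin] at this
      linarith
  have hsub : {θ | 0 < bsgn b * cdot (ue θ) (Complex.I * d) ∧ |cdot (ue θ) d| < ‖d‖ * c} ∩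
      Ioc (ψ - Real.pi) (ψ + Real.pi) ⊆
      Icc (ψ + bsgn b * (Real.pi / 2) - Real.arcsin c) (ψ + bsgn b * (Real.pi / 2) + Real.arcsin c) := by
    rintro θ ⟨⟨h2, h3⟩, h4, h5⟩
    rw [cdot_ue_I] at h2
    rw [cdot_ue, abs_mul, abs_of_pos hd'] at h3
    have h3 := lt_of_mul_lt_mul_left h3 hd'.le
    cases b
    · simp only [bsgn] at h2 ⊢
      have h6 : Real.sin (θ - ψ) < 0 := by
        by_contra hh
        push Not at hh
        have := mul_nonneg hd'.le hh
        simp at h2; linarith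
      have h7 : θ - ψ < 0 := by
        by_contra hh
        push Not at hh
        have := Real.sin_nonneg_of_nonneg_of_le_pi hh (by linarith)
        linarith
      have := key (θ - ψ + Real.pi / 2) (abs_le.2 ⟨by linarith, by linarith⟩)
        (by rw [Real.sin_add_pi_div_two]; exact h3)
      rw [abs_lt] at this
      simp
      constructor <;> linarith
    · simp only [bsgn] at h2 ⊢
      have h6 : 0 < Real.sin (θ - ψ) := by
        by_contra hh
        push Not at hh
        have := mul_nonneg hd'.le (neg_nonneg.2 hh)
        simp at h2; nlinarith
      have h7 : 0 < θ - ψ := by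
        by_contra hh
        push Not at hh
        have := Real.sin_nonpos_of_nonpos_of_neg_pi_le hh (by linarith)
        linarith
      have := key (Real.pi / 2 - (θ - ψ)) (abs_le.2 ⟨by linarith, by linarith⟩)
        (by rw [Real.sin_pi_div_two_sub]; exact h3)
      rw [abs_lt] at this
      simp
      constructor <;> linarith
  refine (measure_mono hsub).trans ?_
  rw [Real.volume_Icc]
  apply ENNReal.ofReal_le_ofReal
  linarith


lemma isExp_iff {n : ℕ} {x : Fin n → ℂ} {t : ℝ} (ht : 0 < t) {u : ℂ} (hu : ‖u‖ = 1) (p : Fin n) :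
    isExp x t u p ↔ ∀ r, 2 * t * cdot u (x r - x p) ≤ ‖x r - x p‖ ^ 2 := by
  unfold isExp
  refine forall_congr' fun r => ?_
  have h1 : ‖x p + (t : ℂ) * u - x r‖ ^ 2 = t ^ 2 * ‖u‖ ^ 2 - 2 * t * cdot u (x r - x p) + ‖x r - x p‖ ^ 2 := by
    rw [← cdot_self, ← cdot_self, ← cdot_self]
    simp [cdot]; ring
  rw [hu] at h1
  rw [← pow_le_pow_iff_left₀ ht.le (norm_nonneg _) two_ne_zero, h1]
  constructor <;> intro h <;> linarith

lemma cont_cdot_ue (d : ℂ) : Continuous fun θ => cdot (ue θ) d := by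
  have := ue_cont; unfold cdot; fun_prop

lemma meas_isExp {n : ℕ} (x : Fin n → ℂ) (t : ℝ) (p : Fin n) :
    MeasurableSet {θ | isExp x t (ue θ) p} := by
  unfold isExp
  have := ue_cont
  refine MeasurableSet.congr (MeasurableSet.iInter (fun r : Fin n => measurableSet_le (f := fun _ : ℝ => t)
    (g := fun θ => ‖x p + (t : ℂ) * ue θ - x r‖) measurable_const (by fun_prop))) ?_
  ext θ; simp

lemma meas_isVtx {n : ℕ} (x : Fin n → ℂ) (t : ℝ) (q : Fin n × Fin n × Bool) :
    MeasurableSet {θ | isVtx x t (ue θ) q} := by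
  unfold isVtx
  have h1 := cont_cdot_ue (Complex.I * (x q.2.1 - x q.1))
  have h2 := cont_cdot_ue (x q.2.1 - x q.1)
  exact (MeasurableSet.const _).inter ((MeasurableSet.const _).inter
    ((measurableSet_lt measurable_const (h1.measurable.const_mul _)).inter
      (measurableSet_lt h2.abs.measurable measurable_const)))

lemma genDir_ae {n : ℕ} {x : Fin n → ℂ} (hx : Function.Injective x) {t : ℝ} (ht : 0 < t) :
    ∀ᵐ θ ∂mang, genDir x t (ue θ) := by
  unfold genDir
  rw [ae_all_iff]; intro i
  rw [ae_all_iff]; intro j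
  by_cases hij : i = j
  · exact Eventually.of_forall fun θ h => absurd hij h
  have hne : x j - x i ≠ 0 := sub_ne_zero.2 fun h => hij (hx h).symm
  have h1 : ∀ᵐ θ ∂mang, ¬ (cdot (ue θ) (x j - x i) = ‖x j - x i‖ ^ 2 / (2 * t)) := by
    rw [ae_iff]; simpa using mang_null_cdot hne _
  have h2 : ∀ᵐ θ ∂mang, ¬ (cdot (ue θ) (Complex.I * (x j - x i)) = 0) := by
    rw [ae_iff]; simpa using mang_null_cdot (mul_ne_zero Complex.I_ne_zero hne) 0
  filter_upwards [h1, h2] with θ h1 h2 _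
  refine ⟨fun h => h1 ?_, h2⟩
  have h3 : ‖x i + (t : ℂ) * ue θ - x j‖ ^ 2 = t ^ 2 * ‖ue θ‖ ^ 2 - 2 * t * cdot (ue θ) (x j - x i) + ‖x j - x i‖ ^ 2 := by
    rw [← cdot_self, ← cdot_self, ← cdot_self]
    simp [cdot]; ring
  rw [h, ue_norm] at h3
  rw [_root_.eq_div_iff (by positivity)]; linarith

open Classical in
/-- the combinatorial inequality as a hypothesis -/
def combH {n : ℕ} (x : Fin n → ℂ) (t : ℝ) (k : ℕ) : Prop :=
  ∀ u : ℂ, ‖u‖ = 1 → genDir x t u →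
    (Finset.univ.filter (fun i => isExp x t u i)).card ≤
      (Finset.univ.filter (fun q => isVtx x t u q)).card + k

/-- total angular measure of the exposed directions -/
noncomputable def dA {n : ℕ} (x : Fin n → ℂ) (t : ℝ) : ℝ≥0∞ :=
  ∑ p, mang {θ | isExp x t (ue θ) p}

lemma dA_le_top {n : ℕ} (x : Fin n → ℂ) (t : ℝ) : dA x t ≤ ENNReal.ofReal (n * (2 * Real.pi)) := by
  unfold dA
  calc _ ≤ ∑ p : Fin n, ENNReal.ofReal (2 * Real.pi) :=
        Finset.sum_le_sum fun p _ => (measure_mono (subset_univ _)).trans mang_univ.le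
    _ = _ := by
      rw [Finset.sum_const, Finset.card_univ, Fintype.card_fin, nsmul_eq_mul, ENNReal.ofReal_mul (by positivity)]
      simp

lemma dA_ne_top {n : ℕ} (x : Fin n → ℂ) (t : ℝ) : dA x t ≠ ⊤ :=
  ((dA_le_top x t).trans_lt ENNReal.ofReal_lt_top).ne

open Classical in
lemma dA_le {n : ℕ} {x : Fin n → ℂ} (hx : Function.Injective x) {t : ℝ} (ht : 0 < t) {k : ℕ}
    (hc : combH x t k) :
    dA x t ≤ ENNReal.ofReal (2 * Real.pi * k) + ∑ q : Fin n × Fin n × Bool,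
      if q.1 < q.2.1 ∧ vActive x t q.1 q.2.1 q.2.2 then
        ENNReal.ofReal (2 * Real.arcsin (‖x q.2.1 - x q.1‖ / (2 * t))) else 0 := by
  have h1 : dA x t = ∫⁻ θ, (∑ p, ({θ | isExp x t (ue θ) p}).indicator 1 θ) ∂mang := by
    rw [lintegral_finsetSum]
    · unfold dA
      refine Finset.sum_congr rfl fun p _ => ?_
      rw [lintegral_indicator_one (meas_isExp x t p)]
    · intro p _; exact measurable_one.indicator (meas_isExp x t p)
  have h2 : ∑ q, mang {θ | isVtx x t (ue θ) q} = ∫⁻ θ, (∑ q, ({θ | isVtx x t (ue θ) q}).indicator 1 θ) ∂mang := by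
    rw [lintegral_finsetSum]
    · refine Finset.sum_congr rfl fun p _ => ?_
      rw [lintegral_indicator_one (meas_isVtx x t p)]
    · intro p _; exact measurable_one.indicator (meas_isVtx x t p)
  have h3 : dA x t ≤ ∑ q, mang {θ | isVtx x t (ue θ) q} + ENNReal.ofReal (2 * Real.pi * k) := by
    have : ENNReal.ofReal (2 * Real.pi * k) = ∫⁻ θ, (k : ℝ≥0∞) ∂mang := by
      rw [lintegral_const, mang_univ, mul_comm, ENNReal.ofReal_mul (by positivity)]; simp
    rw [h1, h2, this, ← lintegral_add_right _ measurable_const]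
    apply lintegral_mono_ae
    filter_upwards [genDir_ae hx ht] with θ hθ
    have := hc (ue θ) (ue_norm θ) hθ
    simp only [indicator_apply, mem_ofPred_eq, Pi.one_apply, Finset.sum_boole]
    exact_mod_cast this
  rw [add_comm]
  refine h3.trans (add_le_add_left (Finset.sum_le_sum fun q _ => ?_) _)
  split_ifs with hq
  · have hne : x q.2.1 - x q.1 ≠ 0 := sub_ne_zero.2 fun h => hq.1.ne' (hx h)
    have hd : 0 < ‖x q.2.1 - x q.1‖ := norm_pos_iff.2 hne
    refine (measure_mono ?_).trans (mang_arc hne q.2.2 (c := ‖x q.2.1 - x q.1‖ / (2 * t)) (by positivity) ?_)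
    · rintro θ ⟨_, _, h4, h5⟩
      refine ⟨h4, h5.trans_eq ?_⟩
      ring
    · rw [div_lt_one (by positivity)]; exact hq.2.1
  · have : {θ | isVtx x t (ue θ) q} = ∅ := by
      ext θ
      simp only [mem_ofPred_eq, mem_empty_iff_false, iff_false]
      rintro ⟨h4, h5, _⟩
      exact hq ⟨h4, h5⟩
    rw [this]; simp

lemma vtx_swap (t : ℝ) (a b : ℂ) (c : Bool) : vtx t a b (bsgn c) = vtx t b a (bsgn (!c)) := by
  unfold vtx
  rw [norm_sub_rev]
  cases c <;> simp [bsgn] <;> ring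

lemma vActive_swap {n : ℕ} (x : Fin n → ℂ) (t : ℝ) (i j : Fin n) (b : Bool) :
    vActive x t i j b ↔ vActive x t j i (!b) := by
  unfold vActive
  rw [vtx_swap, norm_sub_rev]

open Classical in
lemma sum_swap {n : ℕ} (x : Fin n → ℂ) {t : ℝ} (ht : 0 < t) :
    (∑ q : Fin n × Fin n × Bool,
      if q.1 < q.2.1 ∧ vActive x t q.1 q.2.1 q.2.2 then
        ENNReal.ofReal (2 * Real.arcsin (‖x q.2.1 - x q.1‖ / (2 * t))) else 0) =
    ∑ q : Fin n × Fin n × Bool,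
      if q.1 ≠ q.2.1 ∧ vActive x t q.1 q.2.1 q.2.2 then
        ENNReal.ofReal (Real.arcsin (‖x q.2.1 - x q.1‖ / (2 * t))) else 0 := by
  have e1 : (∑ q : Fin n × Fin n × Bool,
      if q.1 ≠ q.2.1 ∧ vActive x t q.1 q.2.1 q.2.2 then
        ENNReal.ofReal (Real.arcsin (‖x q.2.1 - x q.1‖ / (2 * t))) else 0) =
      (∑ q : Fin n × Fin n × Bool,
      if q.1 < q.2.1 ∧ vActive x t q.1 q.2.1 q.2.2 then
        ENNReal.ofReal (Real.arcsin (‖x q.2.1 - x q.1‖ / (2 * t))) else 0) +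
      ∑ q : Fin n × Fin n × Bool,
      if q.2.1 < q.1 ∧ vActive x t q.1 q.2.1 q.2.2 then
        ENNReal.ofReal (Real.arcsin (‖x q.2.1 - x q.1‖ / (2 * t))) else 0 := by
    rw [← Finset.sum_add_distrib]
    refine Finset.sum_congr rfl fun q _ => ?_
    rcases lt_trichotomy q.1 q.2.1 with h | h | h
    · simp [h, h.ne, h.not_gt]
    · simp [h]
    · simp [h, h.ne', h.not_gt]
  let e : (Fin n × Fin n × Bool) ≃ (Fin n × Fin n × Bool) :=
    { toFun := fun q => (q.2.1, q.1, !q.2.2)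
      invFun := fun q => (q.2.1, q.1, !q.2.2)
      left_inv := fun q => by simp
      right_inv := fun q => by simp }
  have e2 : (∑ q : Fin n × Fin n × Bool,
      if q.2.1 < q.1 ∧ vActive x t q.1 q.2.1 q.2.2 then
        ENNReal.ofReal (Real.arcsin (‖x q.2.1 - x q.1‖ / (2 * t))) else 0) =
      ∑ q : Fin n × Fin n × Bool,
      if q.1 < q.2.1 ∧ vActive x t q.1 q.2.1 q.2.2 then
        ENNReal.ofReal (Real.arcsin (‖x q.2.1 - x q.1‖ / (2 * t))) else 0 := by
    rw [← Equiv.sum_comp e]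
    refine Finset.sum_congr rfl fun q _ => ?_
    simp only [e, Equiv.coe_fn_mk]
    rw [vActive_swap, norm_sub_rev, Bool.not_not]
  rw [e1, e2, ← Finset.sum_add_distrib]
  refine Finset.sum_congr rfl fun q _ => ?_
  split_ifs
  · rw [two_mul, ENNReal.ofReal_add] <;>
    exact Real.arcsin_nonneg.2 (by positivity)
  · simp


/-- directions which get covered first by the ball of `q`, at a time in `(t1, t2)` -/
def Ysec {n : ℕ} (x : Fin n → ℂ) (t1 t2 : ℝ) (p q : Fin n) (b : Bool) : Set ℝ :=
  {θ | 0 < cdot (ue θ) (x q - x p) ∧ 0 < bsgn b * cdot (ue θ) (Complex.I * (x q - x p)) ∧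
    2 * t1 * cdot (ue θ) (x q - x p) < ‖x q - x p‖ ^ 2 ∧
    ‖x q - x p‖ ^ 2 < 2 * t2 * cdot (ue θ) (x q - x p) ∧
    ∀ r, ‖x q - x p‖ ^ 2 * cdot (ue θ) (x r - x p) ≤ ‖x r - x p‖ ^ 2 * cdot (ue θ) (x q - x p)}

section
variable {n : ℕ} {x : Fin n → ℂ} {t1 t2 : ℝ}

lemma meas_Ysec (x : Fin n → ℂ) (t1 t2 : ℝ) (p q : Fin n) (b : Bool) : MeasurableSet (Ysec x t1 t2 p q b) := by
  have h1 := (cont_cdot_ue (x q - x p)).measurable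
  have h2 := (cont_cdot_ue (Complex.I * (x q - x p))).measurable
  have h3 : MeasurableSet {θ | ∀ r, ‖x q - x p‖ ^ 2 * cdot (ue θ) (x r - x p) ≤
      ‖x r - x p‖ ^ 2 * cdot (ue θ) (x q - x p)} := by
    refine MeasurableSet.congr (MeasurableSet.iInter (fun r : Fin n =>
      measurableSet_le (f := fun θ => ‖x q - x p‖ ^ 2 * cdot (ue θ) (x r - x p))
      (g := fun θ => ‖x r - x p‖ ^ 2 * cdot (ue θ) (x q - x p))
      ((cont_cdot_ue (x r - x p)).measurable.const_mul _) (h1.const_mul _))) ?_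
    ext θ; simp
  unfold Ysec
  exact (measurableSet_lt measurable_const h1).inter
    ((measurableSet_lt measurable_const (h2.const_mul _)).inter
    ((measurableSet_lt (h1.const_mul _) measurable_const).inter
    ((measurableSet_lt measurable_const (h1.const_mul _)).inter h3)))

lemma Ysec_sub (h1 : 0 < t1) (h2 : 0 < t2) (p q : Fin n) (b : Bool) : Ysec x t1 t2 p q b ⊆
    {θ | isExp x t1 (ue θ) p} \ {θ | isExp x t2 (ue θ) p} := by
  rintro θ ⟨ha, _, hb, hc, hd⟩
  constructor
  · refine (isExp_iff h1 (ue_norm θ) p).2 fun r => ?_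
    rcases le_or_gt (cdot (ue θ) (x r - x p)) 0 with h | h
    · have : 0 ≤ ‖x r - x p‖ ^ 2 := by positivity
      nlinarith
    · have h3 := hd r
      have h4 : 2 * t1 * cdot (ue θ) (x q - x p) * cdot (ue θ) (x r - x p) ≤
        ‖x q - x p‖ ^ 2 * cdot (ue θ) (x r - x p) := by gcongr
      refine le_of_mul_le_mul_right ?_ ha
      linarith
  · intro h
    have := (isExp_iff h2 (ue_norm θ) p).1 h q
    linarith

lemma Ysec_disj (hx : Function.Injective x) {p q q' : Fin n} {b b' : Bool} (hq : q ≠ p) (hq' : q' ≠ p)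
    (hne : (q, b) ≠ (q', b')) : AEDisjoint mang (Ysec x t1 t2 p q b) (Ysec x t1 t2 p q' b') := by
  by_cases h : q = q'
  · subst h
    have hb : b ≠ b' := fun h => hne (by rw [h])
    apply Disjoint.aedisjoint
    rw [Set.disjoint_left]
    rintro θ ⟨_, h1, _⟩ ⟨_, h2, _⟩
    cases b <;> cases b' <;> simp [bsgn] at h1 h2 hb <;> linarith
  · have hd : x q - x p ≠ 0 := sub_ne_zero.2 fun h => hq (hx h)
    have hd' : x q' - x p ≠ 0 := sub_ne_zero.2 fun h => hq' (hx h)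
    set d := x q - x p with hdd
    set d' := x q' - x p with hdd'
    have hdn : 0 < ‖d‖ := norm_pos_iff.2 hd
    have hdn' : 0 < ‖d'‖ := norm_pos_iff.2 hd'
    have hw : ((‖d‖ ^ 2 : ℝ) : ℂ) * d' - ((‖d'‖ ^ 2 : ℝ) : ℂ) * d ≠ 0 := by
      intro h0
      have h1 : ((‖d‖ ^ 2 : ℝ) : ℂ) * d' = ((‖d'‖ ^ 2 : ℝ) : ℂ) * d := sub_eq_zero.1 h0
      have h2 := congrArg norm h1
      rw [norm_mul, norm_mul, Complex.norm_real, Complex.norm_real, Real.norm_of_nonneg (by positivity),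
        Real.norm_of_nonneg (by positivity)] at h2
      have h3 : ‖d‖ = ‖d'‖ := by
        have : ‖d‖ * ‖d'‖ * (‖d‖ - ‖d'‖) = 0 := by linarith
        rcases mul_eq_zero.1 this with h | h
        · exact absurd h (by positivity)
        · linarith
      rw [h3] at h1
      have h4 := mul_left_cancel₀ (by exact_mod_cast (by positivity : ‖d'‖ ^ 2 ≠ 0)) h1
      rw [hdd, hdd'] at h4
      exact h (hx (by linear_combination -h4))
    refine measure_mono_null ?_ (mang_null_cdot hw 0)
    rintro θ ⟨⟨_, _, _, _, h1⟩, ⟨_, _, _, _, h2⟩⟩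
    have h3 := h1 q'
    have h4 := h2 q
    show cdot (ue θ) (((‖d‖ ^ 2 : ℝ) : ℂ) * d' - ((‖d'‖ ^ 2 : ℝ) : ℂ) * d) = 0
    rw [cdot_sub_right, cdot_smul_right, cdot_smul_right]
    linarith

open Classical in
lemma sum_Ysec_le (hx : Function.Injective x) (h1 : 0 < t1) (h2 : 0 < t2) (h12 : t1 ≤ t2) (p : Fin n) :
    (∑ q : Fin n × Bool, if q.1 ≠ p then mang (Ysec x t1 t2 p q.1 q.2) else 0) +
      mang {θ | isExp x t2 (ue θ) p} ≤ mang {θ | isExp x t1 (ue θ) p} := by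
  rw [← Finset.sum_filter, ← measure_biUnion_finset₀]
  · rw [← measure_union]
    · apply measure_mono
      apply union_subset
      · apply iUnion₂_subset
        intro q _
        exact (Ysec_sub h1 h2 p _ _).trans sdiff_subset
      · intro θ hθ
        have hθ' := (isExp_iff h2 (ue_norm θ) p).1 hθ
        refine (isExp_iff h1 (ue_norm θ) p).2 fun r => ?_
        rcases le_or_gt (cdot (ue θ) (x r - x p)) 0 with h | h
        · have : 0 ≤ ‖x r - x p‖ ^ 2 := by positivity
          nlinarith
        · exact le_trans (by gcongr) (hθ' r)
    · rw [Set.disjoint_left]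
      intro θ hθ
      simp only [mem_iUnion] at hθ
      obtain ⟨q, _, hq⟩ := hθ
      exact (Ysec_sub h1 h2 p _ _ hq).2
    · exact meas_isExp x t2 p
  · intro q hq q' hq' hne
    simp at hq hq'
    exact Ysec_disj hx hq hq' hne
  · intro q _
    exact (meas_Ysec _ _ _ _ _ _).nullMeasurableSet

/-- density of the arrival time -/
noncomputable def omg (h τ : ℝ) : ℝ := h / τ ^ 2 / √(1 - (h / τ) ^ 2)

lemma omg_nonneg {h τ : ℝ} (hh : 0 ≤ h) : 0 ≤ omg h τ := by unfold omg; positivity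

lemma arcsin_le_omg {h τ : ℝ} (hh : 0 < h) (hτ : h < τ) : Real.arcsin (h / τ) ≤ τ * omg h τ := by
  have hτ0 : 0 < τ := hh.trans hτ
  have h1 : h / τ < 1 := (div_lt_one hτ0).2 hτ
  have h2 : 0 < Real.arcsin (h / τ) := Real.arcsin_pos.2 (by positivity)
  have h3 : Real.arcsin (h / τ) < Real.pi / 2 := Real.arcsin_lt_pi_div_two.2 h1
  have := Real.lt_tan h2 h3
  rw [Real.tan_arcsin] at this
  refine this.le.trans_eq ?_
  unfold omg
  field_simp

lemma omg_deriv {h τ : ℝ} (hh : 0 < h) (hτ : h < τ) (ψ ε : ℝ) :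
    HasDerivAt (fun τ => ψ + ε * Real.arccos (h / τ)) (ε * omg h τ) τ := by
  have hτ0 : 0 < τ := hh.trans hτ
  have h1 : h / τ < 1 := (div_lt_one hτ0).2 hτ
  have h0 : 0 < h / τ := by positivity
  have e1 : HasDerivAt (fun τ => h / τ) (-h / τ ^ 2) τ := by
    have := (hasDerivAt_inv hτ0.ne').const_mul h
    simpa [div_eq_mul_inv] using this
  have e2 := (Real.hasDerivAt_arccos (by linarith : h / τ ≠ -1) h1.ne).comp τ e1
  have e3 := (e2.const_mul ε).const_add ψ
  have e4 : ε * omg h τ = ε * (-(1 / √(1 - (h / τ) ^ 2)) * (-h / τ ^ 2)) := by unfold omg; ring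
  rw [e4]
  exact e3

lemma vtx_polar {a c : ℂ} {τ : ℝ} (h0 : a ≠ c) (hτ : ‖c - a‖ < 2 * τ) (b : Bool) :
    vtx τ a c (bsgn b) = a + (τ : ℂ) * ue (Complex.arg (c - a) + bsgn b * Real.arccos (‖c - a‖ / 2 / τ)) := by
  have hd : 0 < ‖c - a‖ := norm_pos_iff.2 (sub_ne_zero.2 h0.symm)
  have hτ0 : 0 < τ := by linarith
  set β := Real.arccos (‖c - a‖ / 2 / τ) with hβ
  have hlt : ‖c - a‖ / 2 / τ < 1 := by rw [div_lt_one hτ0]; linarith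
  have hpos : 0 < ‖c - a‖ / 2 / τ := by positivity
  have hcos : Real.cos β = ‖c - a‖ / 2 / τ := Real.cos_arccos (by linarith) hlt.le
  have hsin : Real.sin β = √(τ ^ 2 - ‖c - a‖ ^ 2 / 4) / τ := by
    rw [hβ, Real.sin_arccos, eq_comm, div_eq_iff hτ0.ne', ← Real.sqrt_sq hτ0.le, ← Real.sqrt_mul' _ (by positivity),
      Real.sqrt_sq hτ0.le]
    congr 1; field_simp; ring
  have hue : ue (Complex.arg (c - a) + bsgn b * β) = ue (Complex.arg (c - a)) * (Real.cos β + bsgn b * Real.sin β * Complex.I) := by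
    have : ue (Complex.arg (c - a) + bsgn b * β) = ue (Complex.arg (c - a)) * ue (bsgn b * β) := by
      unfold ue; rw [← Complex.exp_add]; push_cast; ring_nf
    rw [this]; congr 1
    apply Complex.ext
    · rw [ue_re]; cases b <;> simp [bsgn]
      · simp [← Complex.ofReal_cos, ← Complex.ofReal_sin]
      · simp [← Complex.ofReal_cos, ← Complex.ofReal_sin]
    · rw [ue_im]; cases b <;> simp [bsgn]
      · simp [← Complex.ofReal_cos, ← Complex.ofReal_sin]
      · simp [← Complex.ofReal_cos, ← Complex.ofReal_sin]
  have hpol := polar_eq (c - a)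
  have h1 : vtx τ a c (bsgn b) = a + (vtx τ a c (bsgn b) - a) := by ring
  rw [h1, vtx_sub_left, hue, hcos, hsin]
  congr 1
  set e := ue (Complex.arg (c - a))
  set D := ‖c - a‖
  have hDc : (D : ℂ) ≠ 0 := by exact_mod_cast hd.ne'
  have hτc : (τ : ℂ) ≠ 0 := by exact_mod_cast hτ0.ne'
  rw [hpol]
  push_cast
  field_simp

lemma Ysec_ge (hx : Function.Injective x) (h1 : 0 < t1) {p q : Fin n} (hq : q ≠ p) (b : Bool) :
    ∫⁻ τ in {τ | τ ∈ Ioo t1 t2 ∧ vActive x τ p q b}, ENNReal.ofReal (omg (‖x q - x p‖ / 2) τ) ≤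
      mang (Ysec x t1 t2 p q b) := by
  have hne : x p ≠ x q := fun h => hq (hx h).symm
  have hd : 0 < ‖x q - x p‖ := norm_pos_iff.2 (sub_ne_zero.2 hne.symm)
  set ψ := Complex.arg (x q - x p) with hψ
  set h := ‖x q - x p‖ / 2 with hh
  have hh0 : 0 < h := by positivity
  set E := {τ | τ ∈ Ioo t1 t2 ∧ vActive x τ p q b} with hE
  have hEh : ∀ τ ∈ E, h < τ := by
    rintro τ ⟨_, h2, _⟩; rw [hh]; linarith
  have hEm : MeasurableSet E := by
    have hv : Continuous fun τ => vtx τ (x p) (x q) (bsgn b) := by unfold vtx; fun_prop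
    have h3 : MeasurableSet {τ : ℝ | ∀ r, τ ≤ ‖vtx τ (x p) (x q) (bsgn b) - x r‖} := by
      refine MeasurableSet.congr (MeasurableSet.iInter (fun r : Fin n =>
        measurableSet_le (f := fun τ : ℝ => τ) (g := fun τ => ‖vtx τ (x p) (x q) (bsgn b) - x r‖)
        measurable_id (hv.sub continuous_const).norm.measurable)) ?_
      ext θ; simp
    exact measurableSet_Ioo.inter ((measurableSet_lt measurable_const (measurable_const.mul measurable_id)).inter h3)
  let f : ℝ → ℝ := fun τ => ψ + bsgn b * Real.arccos (h / τ)
  have hder : ∀ τ ∈ E, HasDerivWithinAt f (bsgn b * omg h τ) E τ := fun τ hτ =>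
    (omg_deriv hh0 (hEh τ hτ) ψ (bsgn b)).hasDerivWithinAt
  have hbne : bsgn b ≠ 0 := by cases b <;> simp [bsgn]
  have habs : |bsgn b| = 1 := by cases b <;> simp [bsgn]
  have hrange : ∀ τ ∈ E, 0 < h / τ ∧ h / τ < 1 := fun τ hτ => by
    have := hEh τ hτ
    have h0 : 0 < τ := hh0.trans this
    exact ⟨by positivity, (div_lt_one h0).2 this⟩
  have hinj : InjOn f E := by
    intro a ha c hc hac
    have h2 : Real.arccos (h / a) = Real.arccos (h / c) := by
      have : bsgn b * Real.arccos (h / a) = bsgn b * Real.arccos (h / c) := by simpa [f] using hac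
      exact mul_left_cancel₀ hbne this
    have ra := hrange a ha
    have rc := hrange c hc
    have h3 := Real.arccos_injOn ⟨by linarith [ra.1], ra.2.le⟩ ⟨by linarith [rc.1], rc.2.le⟩ h2
    have ha0 : 0 < a := hh0.trans (hEh a ha)
    have hc0 : 0 < c := hh0.trans (hEh c hc)
    rw [div_eq_div_iff ha0.ne' hc0.ne'] at h3
    exact (mul_left_cancel₀ hh0.ne' h3).symm
  have himg := lintegral_image_eq_lintegral_abs_deriv_mul hEm hder hinj (fun _ => 1)
  have e1 : ∫⁻ τ in E, ENNReal.ofReal (omg h τ) = volume (f '' E) := by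
    have : volume (f '' E) = ∫⁻ _ in f '' E, 1 := by simp
    rw [this, himg]
    refine lintegral_congr fun τ => ?_
    rw [mul_one, abs_mul, habs, one_mul, abs_of_nonneg (omg_nonneg hh0.le)]
  rw [e1, mang_window (by intro θ m; simp [Ysec, ue_add_int]) (meas_Ysec _ _ _ _ _ _) ψ]
  apply measure_mono
  rintro _ ⟨τ, hτ, rfl⟩
  obtain ⟨r0, r1⟩ := hrange τ hτ
  have hτ0 : 0 < τ := hh0.trans (hEh τ hτ)
  have hβ0 : 0 < Real.arccos (h / τ) := Real.arccos_pos.2 r1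
  have hβ1 : Real.arccos (h / τ) < Real.pi / 2 := Real.arccos_lt_pi_div_two.2 r0
  have hpi := Real.pi_pos
  have hcos : Real.cos (Real.arccos (h / τ)) = h / τ := Real.cos_arccos (by linarith) r1.le
  have hsin : 0 < Real.sin (Real.arccos (h / τ)) := Real.sin_pos_of_pos_of_lt_pi hβ0 (by linarith)
  have hcd : cdot (ue (f τ)) (x q - x p) = ‖x q - x p‖ ^ 2 / (2 * τ) := by
    rw [cdot_ue, ← hψ]
    have : f τ - ψ = bsgn b * Real.arccos (h / τ) := by simp [f]
    rw [this]
    have : Real.cos (bsgn b * Real.arccos (h / τ)) = h / τ := by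
      cases b <;> simp [bsgn, hcos]
    rw [this, hh]; field_simp
  have hcI : 0 < bsgn b * cdot (ue (f τ)) (Complex.I * (x q - x p)) := by
    rw [cdot_ue_I, ← hψ]
    have : f τ - ψ = bsgn b * Real.arccos (h / τ) := by simp [f]
    rw [this]
    cases b
    · simp [bsgn]; simp at hd hsin; positivity
    · simp [bsgn]; simp at hd hsin; positivity
  have hexp : isExp x τ (ue (f τ)) p := by
    intro r
    have h4 := hτ.2.2 r
    rwa [vtx_polar hne hτ.2.1 b] at h4
  constructor
  · refine ⟨by rw [hcd]; positivity, hcI, ?_, ?_, ?_⟩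
    · have := hτ.1.1
      rw [hcd]
      have e : 2 * t1 * (‖x q - x p‖ ^ 2 / (2 * τ)) = ‖x q - x p‖ ^ 2 * (t1 / τ) := by field_simp
      rw [e]
      have : t1 / τ < 1 := (div_lt_one hτ0).2 this
      have : 0 < ‖x q - x p‖ ^ 2 := by positivity
      nlinarith
    · have := hτ.1.2
      rw [hcd]
      have e : 2 * t2 * (‖x q - x p‖ ^ 2 / (2 * τ)) = ‖x q - x p‖ ^ 2 * (t2 / τ) := by field_simp
      rw [e]
      have : 1 < t2 / τ := (one_lt_div hτ0).2 this
      have : 0 < ‖x q - x p‖ ^ 2 := by positivity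
      nlinarith
    · intro r
      have h5 := (isExp_iff hτ0 (ue_norm _) p).1 hexp r
      rw [hcd]
      have h6 : ‖x r - x p‖ ^ 2 * (‖x q - x p‖ ^ 2 / (2 * τ)) = ‖x q - x p‖ ^ 2 * (‖x r - x p‖ ^ 2 / (2 * τ)) := by ring
      rw [h6]
      gcongr
      rw [le_div_iff₀ (by positivity)]; linarith
  · cases b <;> simp [f, bsgn] <;> constructor <;> linarith

end


section
variable {n : ℕ} {x : Fin n → ℂ} {t1 t2 : ℝ}

lemma meas_vActive (x : Fin n → ℂ) (p q : Fin n) (b : Bool) : MeasurableSet {τ | vActive x τ p q b} := by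
  have hv : Continuous fun τ => vtx τ (x p) (x q) (bsgn b) := by unfold vtx; fun_prop
  have h3 : MeasurableSet {τ : ℝ | ∀ r, τ ≤ ‖vtx τ (x p) (x q) (bsgn b) - x r‖} := by
    refine MeasurableSet.congr (MeasurableSet.iInter (fun r : Fin n =>
      measurableSet_le (f := fun τ : ℝ => τ) (g := fun τ => ‖vtx τ (x p) (x q) (bsgn b) - x r‖)
      measurable_id (hv.sub continuous_const).norm.measurable)) ?_
    ext θ; simp
  exact (measurableSet_lt measurable_const (measurable_const.mul measurable_id)).inter h3

lemma dA_anti (h1 : 0 < t1) (h12 : t1 ≤ t2) : dA x t2 ≤ dA x t1 := by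
  unfold dA
  refine Finset.sum_le_sum fun p _ => measure_mono ?_
  intro θ hθ
  have h2 : 0 < t2 := h1.trans_le h12
  have hθ' := (isExp_iff h2 (ue_norm θ) p).1 hθ
  refine (isExp_iff h1 (ue_norm θ) p).2 fun r => ?_
  rcases le_or_gt (cdot (ue θ) (x r - x p)) 0 with h | h
  · have : 0 ≤ ‖x r - x p‖ ^ 2 := by positivity
    nlinarith
  · exact le_trans (by gcongr) (hθ' r)

/-- real version of `dA` -/
noncomputable def dR (x : Fin n → ℂ) (t : ℝ) : ℝ := (dA x t).toReal

lemma dR_le (x : Fin n → ℂ) (t : ℝ) : dR x t ≤ n * (2 * Real.pi) :=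
  ENNReal.toReal_le_of_le_ofReal (by positivity) (dA_le_top x t)

lemma dR_nonneg (x : Fin n → ℂ) (t : ℝ) : 0 ≤ dR x t := ENNReal.toReal_nonneg

lemma dR_anti (h1 : 0 < t1) (h12 : t1 ≤ t2) : dR x t2 ≤ dR x t1 :=
  ENNReal.toReal_mono (dA_ne_top _ _) (dA_anti h1 h12)

lemma omg_meas (h : ℝ) : Measurable (omg h) := by
  unfold omg; fun_prop

open Classical in
lemma lint_sum_le (hx : Function.Injective x) (h1 : 0 < t1) (h12 : t1 < t2) :
    (∫⁻ τ in Ioo t1 t2, ∑ q : Fin n × Fin n × Bool,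
      if q.1 ≠ q.2.1 ∧ vActive x τ q.1 q.2.1 q.2.2 then
        ENNReal.ofReal (omg (‖x q.2.1 - x q.1‖ / 2) τ) else 0) + dA x t2 ≤ dA x t1 := by
  have h2 : 0 < t2 := h1.trans h12
  rw [lintegral_finsetSum]
  · have e1 : ∀ q : Fin n × Fin n × Bool, (∫⁻ τ in Ioo t1 t2,
      if q.1 ≠ q.2.1 ∧ vActive x τ q.1 q.2.1 q.2.2 then
        ENNReal.ofReal (omg (‖x q.2.1 - x q.1‖ / 2) τ) else 0) ≤
        if q.2.1 ≠ q.1 then mang (Ysec x t1 t2 q.1 q.2.1 q.2.2) else 0 := by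
      intro q
      split_ifs with hq
      · refine le_trans (le_of_eq ?_) (Ysec_ge hx h1 hq q.2.2)
        have : {τ | τ ∈ Ioo t1 t2 ∧ vActive x τ q.1 q.2.1 q.2.2} = {τ | vActive x τ q.1 q.2.1 q.2.2} ∩ Ioo t1 t2 := by
          ext τ; simp [and_comm]
        rw [this, ← Measure.restrict_restrict (meas_vActive _ _ _ _), ← lintegral_indicator (meas_vActive _ _ _ _)]
        refine lintegral_congr fun τ => ?_
        simp [indicator_apply, hq.symm]
      · have : q.1 = q.2.1 := by simpa using (not_not.1 hq).symm
        simp [this]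
    refine (add_le_add_left (Finset.sum_le_sum fun q _ => e1 q) _).trans ?_
    unfold dA
    rw [Fintype.sum_prod_type, ← Finset.sum_add_distrib]
    refine Finset.sum_le_sum fun p _ => ?_
    exact sum_Ysec_le hx h1 h2 h12.le p
  · intro q _
    by_cases hq : q.1 = q.2.1
    · simp [hq]
    · simp only [ne_eq, hq, not_false_eq_true, true_and]
      exact Measurable.ite (meas_vActive _ _ _ _) (omg_meas _).ennreal_ofReal measurable_const

open Classical in
lemma dR_step (hx : Function.Injective x) (h1 : 0 < t1) (h12 : t1 < t2) {k : ℕ}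
    (hc : ∀ τ ∈ Ioo t1 t2, combH x τ k) :
    (dR x t2 - 2 * Real.pi * k) * (2 - t1 / t2) ≤ dR x t1 - 2 * Real.pi * k := by
  have h2 : 0 < t2 := h1.trans h12
  have hanti := dR_anti (x := x) h1 h12.le
  have hr : t1 / t2 < 1 := (div_lt_one h2).2 h12
  set e := dR x t2 - 2 * Real.pi * k with he
  rcases le_or_gt e 0 with h0 | h0
  · nlinarith
  have key : ENNReal.ofReal (e / t2 * (t2 - t1)) + dA x t2 ≤ dA x t1 := by
    refine le_trans (add_le_add_left ?_ _) (lint_sum_le hx h1 h12)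
    have : ENNReal.ofReal (e / t2 * (t2 - t1)) = ∫⁻ τ in Ioo t1 t2, ENNReal.ofReal (e / t2) := by
      rw [setLIntegral_const, Real.volume_Ioo, ENNReal.ofReal_mul (by positivity)]
    rw [this]
    refine setLIntegral_mono' measurableSet_Ioo fun τ hτ => ?_
    have hτ0 : 0 < τ := h1.trans hτ.1
    set S := ∑ q : Fin n × Fin n × Bool,
      if q.1 ≠ q.2.1 ∧ vActive x τ q.1 q.2.1 q.2.2 then
        ENNReal.ofReal (omg (‖x q.2.1 - x q.1‖ / 2) τ) else 0 with hS
    have a1 := dA_le hx hτ0 (hc τ hτ)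
    rw [sum_swap x hτ0] at a1
    have a2 : (∑ q : Fin n × Fin n × Bool,
      if q.1 ≠ q.2.1 ∧ vActive x τ q.1 q.2.1 q.2.2 then
        ENNReal.ofReal (Real.arcsin (‖x q.2.1 - x q.1‖ / (2 * τ))) else 0) ≤ ENNReal.ofReal τ * S := by
      rw [hS, Finset.mul_sum]
      refine Finset.sum_le_sum fun q _ => ?_
      split_ifs with hq
      · rw [← ENNReal.ofReal_mul hτ0.le]
        apply ENNReal.ofReal_le_ofReal
        have hd : 0 < ‖x q.2.1 - x q.1‖ := norm_pos_iff.2 (sub_ne_zero.2 fun h => hq.1 (hx h).symm)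
        have := arcsin_le_omg (h := ‖x q.2.1 - x q.1‖ / 2) (τ := τ) (by positivity) (by have := hq.2.1; linarith)
        rwa [div_div] at this
      · simp
    have a3 : ENNReal.ofReal (dR x t2) ≤ ENNReal.ofReal (2 * Real.pi * k) + ENNReal.ofReal t2 * S := by
      unfold dR
      rw [ENNReal.ofReal_toReal (dA_ne_top _ _)]
      refine (dA_anti hτ0 hτ.2.le).trans (a1.trans (add_le_add_right (a2.trans ?_) _))
      gcongr
      exact hτ.2.le
    have a4 : ENNReal.ofReal (dR x t2) = ENNReal.ofReal (2 * Real.pi * k) + ENNReal.ofReal e := by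
      rw [← ENNReal.ofReal_add (by positivity) h0.le]; congr 1; rw [he]; ring
    rw [a4] at a3
    have a5 := (ENNReal.add_le_add_iff_left ENNReal.ofReal_ne_top).1 a3
    rw [ENNReal.ofReal_div_of_pos h2]
    exact ENNReal.div_le_of_le_mul' a5
  have k2 : e / t2 * (t2 - t1) + dR x t2 ≤ dR x t1 := by
    have := ENNReal.toReal_mono (dA_ne_top x t1) key
    rwa [ENNReal.toReal_add ENNReal.ofReal_ne_top (dA_ne_top _ _), ENNReal.toReal_ofReal] at this
    have : 0 ≤ t2 - t1 := by linarith
    positivity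
  have : e / t2 * (t2 - t1) = e * (1 - t1 / t2) := by field_simp
  rw [this] at k2
  linarith

/-- a function with at most quadratic increase on an interval is antitone -/
lemma anti_of_quad {l : ℝ → ℝ} {a b C : ℝ}
    (h : ∀ s t, a < s → s < t → t < b → l t - C * (t - s) ^ 2 ≤ l s) :
    ∀ s t, a < s → s ≤ t → t < b → l t ≤ l s := by
  have h' : ∀ m : ℕ, ∀ s t, a < s → s < t → t < b → l t - C * (t - s) ^ 2 / 2 ^ m ≤ l s := by
    intro m
    induction m with
    | zero => intro s t h1 h2 h3; simpa using h s t h1 h2 h3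
    | succ m ih =>
      intro s t h1 h2 h3
      have i1 := ih s ((s + t) / 2) h1 (by linarith) (by linarith)
      have i2 := ih ((s + t) / 2) t (by linarith) (by linarith) h3
      have e : C * (t - s) ^ 2 / 2 ^ (m + 1) =
        C * ((s + t) / 2 - s) ^ 2 / 2 ^ m + C * (t - (s + t) / 2) ^ 2 / 2 ^ m := by
        rw [pow_succ]; field_simp; ring
      rw [e]; linarith
  intro s t h1 h2 h3
  rcases h2.eq_or_lt with rfl | h2
  · exact le_rfl
  have hlim : Tendsto (fun m : ℕ => l t - C * (t - s) ^ 2 / 2 ^ m) atTop (𝓝 (l t - 0)) := by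
    refine tendsto_const_nhds.sub ?_
    have := (tendsto_pow_atTop_nhds_zero_of_lt_one (by norm_num : (0:ℝ) ≤ 1 / 2) (by norm_num)).const_mul (C * (t - s) ^ 2)
    rw [mul_zero] at this
    refine this.congr fun m => ?_
    rw [one_div, inv_pow]; rfl
  rw [sub_zero] at hlim
  exact le_of_tendsto hlim (Eventually.of_forall fun m => h' m s t h1 h2 h3)

lemma lR_anti (hx : Function.Injective x) {k : ℕ} {a b : ℝ} (ha : 0 < a)
    (hc : ∀ τ ∈ Ioo a b, combH x τ k) :
    ∀ s t, a < s → s ≤ t → t < b →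
      t * (dR x t - 2 * Real.pi * k) ≤ s * (dR x s - 2 * Real.pi * k) := by
  apply anti_of_quad (l := fun t => t * (dR x t - 2 * Real.pi * k)) (C := n * (2 * Real.pi) / a)
  intro s t h1 h2 h3
  have hs : 0 < s := ha.trans h1
  have ht : 0 < t := hs.trans h2
  have h4 := dR_step hx hs h2 (k := k) (fun τ hτ => hc τ ⟨h1.trans hτ.1, hτ.2.trans h3⟩)
  have h5 := dR_le x t
  set e := dR x t - 2 * Real.pi * k
  have he : e ≤ n * (2 * Real.pi) := by
    have : 0 ≤ 2 * Real.pi * (k : ℝ) := by positivity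
    simp only [e]; linarith
  have h6 : s * (e * (2 - s / t)) = t * e - e * (t - s) ^ 2 / t := by field_simp; ring
  have h7 : e * (t - s) ^ 2 / t ≤ n * (2 * Real.pi) / a * (t - s) ^ 2 := by
    rw [mul_div_right_comm]
    gcongr
    linarith
  show t * e - _ ≤ s * (dR x s - 2 * Real.pi * k)
  nlinarith [mul_le_mul_of_nonneg_left h4 hs.le]

end


section
variable {n : ℕ} {x : Fin n → ℂ}

/-- truncated Voronoi cell -/
def vcell (x : Fin n → ℂ) (t : ℝ) (p : Fin n) : Set ℂ :=
  {y | ‖y - x p‖ < t ∧ ∀ r, ‖y - x p‖ ≤ ‖y - x r‖}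

lemma vcell_meas (x : Fin n → ℂ) (t : ℝ) (p : Fin n) : MeasurableSet (vcell x t p) := by
  have h3 : MeasurableSet {y : ℂ | ∀ r, ‖y - x p‖ ≤ ‖y - x r‖} := by
    refine MeasurableSet.congr (MeasurableSet.iInter (fun r : Fin n =>
      measurableSet_le (f := fun y : ℂ => ‖y - x p‖) (g := fun y => ‖y - x r‖)
      (by fun_prop) (by fun_prop))) ?_
    ext θ; simp
  exact (measurableSet_lt (f := fun y : ℂ => ‖y - x p‖) (by fun_prop) measurable_const).inter h3

lemma vcell_union (x : Fin n → ℂ) (t : ℝ) : ⋃ p, vcell x t p = ⋃ p, ball (x p) t := by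
  ext y
  simp only [mem_iUnion, mem_ball, dist_eq_norm]
  constructor
  · rintro ⟨p, hp, _⟩; exact ⟨p, hp⟩
  · rintro ⟨p, hp⟩
    have : Nonempty (Fin n) := ⟨p⟩
    obtain ⟨q, hq⟩ := Finite.exists_min (fun r => ‖y - x r‖)
    exact ⟨q, (hq p).trans_lt hp, hq⟩

lemma bis_null {a b : ℂ} (hab : a ≠ b) : volume {y : ℂ | ‖y - a‖ = ‖y - b‖} = 0 := by
  have : {y : ℂ | ‖y - a‖ = ‖y - b‖} = (AffineSubspace.perpBisector a b : Set ℂ) := by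
    ext y
    simp [AffineSubspace.mem_perpBisector_iff_dist_eq, dist_eq_norm]
  rw [this]
  exact Measure.addHaar_affineSubspace _ _ (by simpa using hab)

lemma vcell_vol (x : Fin n → ℂ) (t : ℝ) (p : Fin n) :
    volume (vcell x t p) = ∫⁻ τ in Ioo 0 t, ENNReal.ofReal τ * mang {θ | isExp x τ (ue θ) p} := by
  have hm : Measurable (fun w : ℂ => w + x p) := by fun_prop
  have e1 : volume (vcell x t p) = volume ((fun w => w + x p) ⁻¹' vcell x t p) := by
    rw [measure_preimage_add_right]
  rw [e1, ← lintegral_indicator_one (hm (vcell_meas x t p)), ← Complex.lintegral_comp_polarCoord_symm]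
  have hS : MeasurableSet {q : ℝ × ℝ | q.1 < t ∧ isExp x q.1 (ue q.2) p} := by
    refine (measurableSet_lt (f := fun q : ℝ × ℝ => q.1) (by fun_prop) measurable_const).inter ?_
    refine MeasurableSet.congr (MeasurableSet.iInter (fun r : Fin n =>
      measurableSet_le (f := fun q : ℝ × ℝ => q.1) (g := fun q => ‖x p + q.1 * ue q.2 - x r‖)
      (by fun_prop) ?_)) ?_
    · have := ue_cont
      exact Continuous.measurable (by fun_prop)
    · ext q; simp; rfl
  have e2 : ∀ q ∈ polarCoord.target, ENNReal.ofReal q.1 • (((fun w => w + x p) ⁻¹' vcell x t p).indicator 1 (Complex.polarCoord.symm q) : ℝ≥0∞)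
      = ENNReal.ofReal q.1 * ({q : ℝ × ℝ | q.1 < t ∧ isExp x q.1 (ue q.2) p}).indicator 1 q := by
    rintro ⟨τ, θ⟩ hq
    have hτ : 0 < τ := by simpa [polarCoord] using hq.1
    have e3 : Complex.polarCoord.symm (τ, θ) = τ * ue θ := by
      rw [Complex.polarCoord_symm_apply]
      unfold ue
      rw [Complex.exp_mul_I]; simp
    have e4 : ‖(τ:ℂ) * ue θ‖ = τ := by simp [ue_norm, abs_of_pos hτ]
    rw [smul_eq_mul, e3]
    congr 1
    have e7 : ((τ:ℂ) * ue θ ∈ (fun w => w + x p) ⁻¹' vcell x t p) ↔ ((τ, θ) ∈ {q : ℝ × ℝ | q.1 < t ∧ isExp x q.1 (ue q.2) p}) := by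
      simp only [mem_preimage, vcell, mem_ofPred_eq, add_sub_cancel_right, e4, isExp, add_comm (x p)]
    by_cases h : (τ, θ) ∈ {q : ℝ × ℝ | q.1 < t ∧ isExp x q.1 (ue q.2) p}
    · rw [indicator_of_mem h, indicator_of_mem (e7.2 h)]; rfl
    · rw [indicator_of_notMem h, indicator_of_notMem (fun h' => h (e7.1 h'))]
  rw [setLIntegral_congr_fun polarCoord.open_target.measurableSet e2]
  have e5 : polarCoord.target = Ioi (0:ℝ) ×ˢ Ioo (-Real.pi) Real.pi := rfl
  rw [e5, Measure.volume_eq_prod, ← Measure.prod_restrict, lintegral_prod]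
  · have e6 : ∀ τ : ℝ, (∫⁻ θ in Ioo (-Real.pi) Real.pi, ENNReal.ofReal τ * ({q : ℝ × ℝ | q.1 < t ∧ isExp x q.1 (ue q.2) p}).indicator 1 (τ, θ)) = (Iio t).indicator (fun τ => ENNReal.ofReal τ * mang {θ | isExp x τ (ue θ) p}) τ := by
      intro τ
      rw [lintegral_const_mul _ (show Measurable fun θ => (({q : ℝ × ℝ | q.1 < t ∧ isExp x q.1 (ue q.2) p}).indicator 1 (τ, θ) : ℝ≥0∞) from (measurable_one.indicator hS).comp measurable_prodMk_left)]
      by_cases hτ : τ < t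
      · rw [indicator_of_mem (by exact hτ)]
        congr 1
        rw [mang, ← Measure.restrict_congr_set (Ioo_ae_eq_Ioc (μ := volume) (a := -Real.pi) (b := Real.pi)), ← lintegral_indicator_one (meas_isExp _ _ _)]
        refine lintegral_congr fun θ => ?_
        by_cases h : isExp x τ (ue θ) p
        · rw [indicator_of_mem (show (τ, θ) ∈ {q : ℝ × ℝ | q.1 < t ∧ isExp x q.1 (ue q.2) p} from ⟨hτ, h⟩),
            indicator_of_mem (show θ ∈ {θ | isExp x τ (ue θ) p} from h)]; rfl
        · rw [indicator_of_notMem (show (τ, θ) ∉ {q : ℝ × ℝ | q.1 < t ∧ isExp x q.1 (ue q.2) p} from fun h' => h h'.2),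
            indicator_of_notMem (show θ ∉ {θ | isExp x τ (ue θ) p} from h)]
      · simp [indicator_apply, hτ]
    simp_rw [e6]
    rw [lintegral_indicator measurableSet_Iio, Measure.restrict_restrict measurableSet_Iio]
    congr 2
    ext; simp [and_comm]
  · exact (Measurable.mul (by fun_prop) (measurable_const.indicator hS)).aemeasurable

lemma vol_union (hx : Function.Injective x) (t : ℝ) :
    volume (⋃ p, ball (x p) t) = ∫⁻ τ in Ioo 0 t, ENNReal.ofReal τ * dA x τ := by
  have hmE : ∀ p, Measurable (fun τ : ℝ => mang {θ | isExp x τ (ue θ) p}) := by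
    intro p
    refine measurable_measure_prodMk_left (s := {q : ℝ × ℝ | isExp x q.1 (ue q.2) p}) ?_
    refine MeasurableSet.congr (MeasurableSet.iInter (fun r : Fin n =>
      measurableSet_le (f := fun q : ℝ × ℝ => q.1) (g := fun q => ‖x p + q.1 * ue q.2 - x r‖)
      (by fun_prop) ?_)) ?_
    · have := ue_cont
      exact Continuous.measurable (by fun_prop)
    · ext q; simp [isExp]
  rw [← vcell_union, measure_iUnion₀]
  · rw [tsum_fintype]
    simp_rw [vcell_vol, dA, Finset.mul_sum]
    rw [lintegral_finsetSum]
    intro p _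
    exact Measurable.mul (by fun_prop) (hmE p)
  · intro p q hpq
    refine measure_mono_null ?_ (bis_null (hx.ne hpq))
    rintro y ⟨⟨_, h1⟩, ⟨_, h2⟩⟩
    exact le_antisymm (h1 q) (h2 p)
  · intro p; exact (vcell_meas x t p).nullMeasurableSet

end


section
variable {n : ℕ} {x : Fin n → ℂ}

lemma dA_meas (x : Fin n → ℂ) : Measurable (fun τ => dA x τ) := by
  unfold dA
  refine Finset.measurable_fun_sum _ fun p _ => ?_
  refine measurable_measure_prodMk_left (s := {q : ℝ × ℝ | isExp x q.1 (ue q.2) p}) ?_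
  refine MeasurableSet.congr (MeasurableSet.iInter (fun r : Fin n =>
      measurableSet_le (f := fun q : ℝ × ℝ => q.1) (g := fun q => ‖x p + q.1 * ue q.2 - x r‖)
      (by fun_prop) ?_)) ?_
  · have := ue_cont
    exact Continuous.measurable (by fun_prop)
  · ext q; simp [isExp]

noncomputable def VR (x : Fin n → ℂ) (t : ℝ) : ℝ := (volume (⋃ p, ball (x p) t)).toReal

lemma L_ii (x : Fin n → ℂ) (c a b : ℝ) : IntervalIntegrable (fun τ => τ * dR x (c * τ)) volume a b := by
  have h1 : IntervalIntegrable (fun τ => dR x (c * τ)) volume a b := by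
    rw [intervalIntegrable_iff]
    refine Measure.integrableOn_of_bounded (M := n * (2 * Real.pi)) (by simp) ?_ ?_
    · exact ((dA_meas x).ennreal_toReal.comp (measurable_const.mul measurable_id)).aestronglyMeasurable
    · refine ae_of_all _ fun τ => ?_
      rw [Real.norm_of_nonneg (dR_nonneg _ _)]
      exact dR_le _ _
  exact h1.continuousOn_mul (by fun_prop)

lemma L_ii' (x : Fin n → ℂ) (a b : ℝ) : IntervalIntegrable (fun τ => τ * dR x τ) volume a b := by
  simpa using L_ii x 1 a b

lemma VR_eq (hx : Function.Injective x) {t : ℝ} (ht : 0 ≤ t) : VR x t = ∫ τ in (0)..t, τ * dR x τ := by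
  unfold VR
  rw [vol_union hx, intervalIntegral.integral_of_le ht]
  rw [integral_Ioc_eq_integral_Ioo, integral_eq_lintegral_of_nonneg_ae]
  · congr 1
    refine setLIntegral_congr_fun measurableSet_Ioo fun τ hτ => ?_
    show _ = ENNReal.ofReal (τ * dR x τ)
    rw [ENNReal.ofReal_mul hτ.1.le, dR, ENNReal.ofReal_toReal (dA_ne_top _ _)]
  · filter_upwards [ae_restrict_mem measurableSet_Ioo] with τ hτ
    exact mul_nonneg hτ.1.le (dR_nonneg _ _)
  · exact (measurable_id.mul (dA_meas x).ennreal_toReal).aestronglyMeasurable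

lemma VR_diff (hx : Function.Injective x) {y w : ℝ} (hy : 0 ≤ y) (hw : 0 ≤ w) :
    VR x w - VR x y = ∫ τ in y..w, τ * dR x τ := by
  rw [VR_eq hx hy, VR_eq hx hw]
  exact intervalIntegral.integral_interval_sub_left (L_ii' _ _ _) (L_ii' _ _ _)

lemma VR_bounds (hx : Function.Injective x) {a b : ℝ} {k : ℕ} (ha : 0 < a) (hc : ∀ τ ∈ Ioo a b, combH x τ k)
    {y w : ℝ} (hy : a < y) (hyw : y ≤ w) (hw : w < b) :
    (VR x w - VR x y) - Real.pi * k * (w^2 - y^2) ≤ (w - y) * (y * (dR x y - 2 * Real.pi * k)) ∧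
    (w - y) * (w * (dR x w - 2 * Real.pi * k)) ≤ (VR x w - VR x y) - Real.pi * k * (w^2 - y^2) := by
  have h0 : 0 ≤ y := (ha.trans hy).le
  have hI : ∀ c : ℝ, ∫ τ in y..w, (2 * Real.pi * k * τ + c) = Real.pi * k * (w^2 - y^2) + (w - y) * c := by
    intro c
    rw [intervalIntegral.integral_add (by apply Continuous.intervalIntegrable; fun_prop) (by simp), intervalIntegral.integral_const_mul, integral_id]
    simp; ring
  rw [VR_diff hx h0 (h0.trans hyw)]
  constructor
  · have := intervalIntegral.integral_mono_on (g := fun τ => 2 * Real.pi * k * τ + y * (dR x y - 2 * Real.pi * k)) hyw (L_ii' x y w) (by apply Continuous.intervalIntegrable; fun_prop) (fun τ hτ => by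
      have := lR_anti hx ha hc y τ hy hτ.1 (hτ.2.trans_lt hw)
      linarith)
    rw [hI] at this; linarith
  · have := intervalIntegral.integral_mono_on (f := fun τ => 2 * Real.pi * k * τ + w * (dR x w - 2 * Real.pi * k)) hyw (by apply Continuous.intervalIntegrable; fun_prop) (L_ii' x y w) (fun τ hτ => by
      have := lR_anti hx ha hc τ w (hy.trans_le hτ.1) hτ.2 hw
      linarith)
    rw [hI] at this; linarith

lemma VR_conc (hx : Function.Injective x) {a b : ℝ} {k : ℕ} (ha : 0 < a) (hc : ∀ τ ∈ Ioo a b, combH x τ k)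
    {u v w : ℝ} (hu : a < u) (huv : u ≤ v) (hvw : v ≤ w) (hw : w < b) :
    ((VR x w - Real.pi * k * w^2) - (VR x v - Real.pi * k * v^2)) * (v - u) ≤
    ((VR x v - Real.pi * k * v^2) - (VR x u - Real.pi * k * u^2)) * (w - v) := by
  have h1 := (VR_bounds hx ha hc (hu.trans_le huv) hvw hw).1
  have h2 := (VR_bounds hx ha hc hu huv (hvw.trans_lt hw)).2
  have h3 : 0 ≤ v - u := by linarith
  have h4 : 0 ≤ w - v := by linarith
  have h5 := mul_le_mul_of_nonneg_right h1 h3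
  have h6 := mul_le_mul_of_nonneg_right h2 h4
  nlinarith

lemma VR_scale (hx : Function.Injective x) {t c : ℝ} (ht : 0 ≤ t) (hc : 1 ≤ c) :
    VR x (c * t) ≤ c ^ 2 * VR x t := by
  have hc0 : 0 < c := by linarith
  rw [VR_eq hx ht, VR_eq hx (by positivity)]
  have h := intervalIntegral.integral_comp_mul_left (a := 0) (b := t) (fun τ => τ * dR x τ) hc0.ne'
  rw [mul_zero, smul_eq_mul, inv_mul_eq_div, _root_.eq_div_iff hc0.ne'] at h
  rw [← h]
  have h2 : ∫ τ in (0)..t, c * τ * dR x (c * τ) ≤ ∫ τ in (0)..t, c * (τ * dR x τ) := by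
    have e : (fun τ => c * τ * dR x (c * τ)) = fun τ => c * (τ * dR x (c * τ)) := by ext; ring
    rw [e]
    refine intervalIntegral.integral_mono_on ht ((L_ii x c 0 t).const_mul c) ((L_ii' x 0 t).const_mul c) fun τ hτ => ?_
    refine mul_le_mul_of_nonneg_left ?_ hc0.le
    rcases hτ.1.eq_or_lt with h | h
    · rw [← h]; simp
    · exact mul_le_mul_of_nonneg_left (dR_anti h (by nlinarith)) h.le
  rw [intervalIntegral.integral_const_mul] at h2
  nlinarith
end


section

lemma exists_net {X : Type*} [MetricSpace X] {K : Set X} (hK : IsCompact K) {δ : ℝ} (hδ : 0 < δ) :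
    ∃ (n : ℕ) (x : Fin n → X), Function.Injective x ∧ (∀ i, x i ∈ K) ∧ K ⊆ ⋃ i, ball (x i) δ := by
  obtain ⟨F, hF, hfin, hcov⟩ := hK.finite_cover_balls hδ
  have : Finite F := hfin
  obtain ⟨n, ⟨e⟩⟩ := Finite.exists_equiv_fin F
  refine ⟨n, fun i => (e.symm i : X), Subtype.val_injective.comp e.symm.injective, fun i => hF (e.symm i).2, ?_⟩
  intro y hy
  obtain ⟨p, hp, hy⟩ := mem_iUnion₂.1 (hcov hy)
  exact mem_iUnion.2 ⟨e ⟨p, hp⟩, by simpa using hy⟩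

noncomputable def VK (K : Set ℂ) (t : ℝ) : ℝ := (volume (thickening t K)).toReal

lemma thick_fin {K : Set ℂ} (hK : IsCompact K) (t : ℝ) : volume (thickening t K) ≠ ⊤ :=
  (hK.isBounded.thickening (δ := t)).measure_lt_top.ne

lemma VK_left {K : Set ℂ} (hK : IsCompact K) (t : ℝ) (δ : ℕ → ℝ) (hδ : Antitone δ) (hδ0 : ∀ m, 0 < δ m)
    (hl : Tendsto δ atTop (𝓝 0)) : Tendsto (fun m => VK K (t - δ m)) atTop (𝓝 (VK K t)) := by
  have hU : thickening t K = ⋃ m, thickening (t - δ m) K := by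
    apply subset_antisymm
    · intro y hy
      rw [mem_thickening_iff] at hy
      obtain ⟨z, hz, hd⟩ := hy
      obtain ⟨m, hm⟩ := (hl.eventually (gt_mem_nhds (sub_pos.2 hd))).exists
      exact mem_iUnion.2 ⟨m, mem_thickening_iff.2 ⟨z, hz, by linarith⟩⟩
    · exact iUnion_subset fun m => thickening_mono (by linarith [hδ0 m]) _
  have hm : Monotone fun m => thickening (t - δ m) K := fun a b hab =>
    thickening_mono (by linarith [hδ hab]) _
  have := tendsto_measure_iUnion_atTop (μ := volume) hm
  rw [← hU] at this
  exact (ENNReal.tendsto_toReal (thick_fin hK t)).comp this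

lemma net_exists {K : Set ℂ} (hK : IsCompact K) : ∃ (δ : ℕ → ℝ) (n : ℕ → ℕ) (x : ∀ m, Fin (n m) → ℂ),
    (∀ m, 0 < δ m) ∧ Tendsto δ atTop (𝓝 0) ∧ (∀ m, Function.Injective (x m)) ∧ (∀ m i, x m i ∈ K) ∧
    (∀ m, K ⊆ ⋃ i, ball (x m i) (δ m)) ∧ ∀ t, Tendsto (fun m => VR (x m) t) atTop (𝓝 (VK K t)) := by
  have h := fun m : ℕ => exists_net hK (Nat.one_div_pos_of_nat (α := ℝ) (n := m))
  choose n x h1 h2 h3 using h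
  have hd : Tendsto (fun m : ℕ => 1 / ((m : ℝ) + 1)) atTop (𝓝 0) := tendsto_one_div_add_atTop_nhds_zero_nat
  refine ⟨fun m => 1 / ((m:ℝ) + 1), n, x, fun m => Nat.one_div_pos_of_nat, hd, h1, h2, h3, fun t => ?_⟩
  refine tendsto_of_tendsto_of_tendsto_of_le_of_le (VK_left hK t (fun m => 1 / ((m:ℝ) + 1)) (fun a b hab => ?_) (fun m => Nat.one_div_pos_of_nat) hd) tendsto_const_nhds (fun m => ?_) (fun m => ?_)
  · exact Nat.one_div_le_one_div hab
  · have hsub : (⋃ p, ball (x m p) t) ⊆ thickening t K := iUnion_subset fun p => ball_subset_thickening (h2 m p) t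
    refine ENNReal.toReal_mono (measure_ne_top_of_subset hsub (thick_fin hK t)) (measure_mono ?_)
    intro y hy
    rw [mem_thickening_iff] at hy
    obtain ⟨z, hz, hd⟩ := hy
    obtain ⟨i, hi⟩ := mem_iUnion.1 (h3 m hz)
    refine mem_iUnion.2 ⟨i, ?_⟩
    rw [mem_ball] at hi ⊢
    linarith [dist_triangle y z (x m i)]
  · exact ENNReal.toReal_mono (thick_fin hK t) (measure_mono (iUnion_subset fun p => ball_subset_thickening (h2 m p) t))

lemma thick_conc {k : ℕ} {K : Set ℂ} (hK : IsCompact K) {K0 : Set ℂ} {Kl : Fin k → Set ℂ}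
    (h0 : IsPreconnected K0) (hl : ∀ l, IsPreconnected (Kl l)) (hKeq : K = K0 ∪ ⋃ l, Kl l)
    {z : ℂ} {R ρ : ℝ} (hz : ∀ y ∈ K, ρ ≤ ‖y - z‖) (hR : 0 < R) (hsph : sphere z R ⊆ K0)
    {u v w : ℝ} (hu : 0 < u) (huv : u ≤ v) (hvw : v ≤ w) (hw : w < ρ) :
    ((VK K w - Real.pi * k * w^2) - (VK K v - Real.pi * k * v^2)) * (v - u) ≤
    ((VK K v - Real.pi * k * v^2) - (VK K u - Real.pi * k * u^2)) * (w - v) := by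
  obtain ⟨δ, n, x, hδ, hδl, hinj, hxK, hcov, hlim⟩ := net_exists hK
  have L1 := (((hlim w).sub_const (Real.pi * k * w^2)).sub ((hlim v).sub_const (Real.pi * k * v^2))).mul_const (v - u)
  have L2 := (((hlim v).sub_const (Real.pi * k * v^2)).sub ((hlim u).sub_const (Real.pi * k * u^2))).mul_const (w - v)
  refine le_of_tendsto_of_tendsto L1 L2 ?_
  filter_upwards [hδl.eventually (gt_mem_nhds hu)] with m hm
  refine VR_conc (hinj m) (hδ m) (b := ρ) (fun τ hτ u' hu' hg => ?_) hm huv hvw hw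
  have hcov' : K ⊆ ⋃ i, ball (x m i) τ := (hcov m).trans (iUnion_mono fun i => ball_subset_ball hτ.1.le)
  refine comb_ineq (hinj m) ((hδ m).trans hτ.1) (fun i => hτ.2.trans_le (hz _ (hxK m i))) hu' hg hR h0 hl hsph ?_ ?_ ?_
  · intro i
    have := hxK m i
    rw [hKeq] at this
    simpa using this
  · refine Subset.trans ?_ hcov'; rw [hKeq]; exact subset_union_left
  · intro l
    refine Subset.trans ?_ hcov'; rw [hKeq]
    exact (subset_iUnion Kl l).trans subset_union_right

lemma thick_scale {K : Set ℂ} (hK : IsCompact K) {t c : ℝ} (ht : 0 ≤ t) (hc : 1 ≤ c) :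
    VK K (c * t) ≤ c ^ 2 * VK K t := by
  obtain ⟨δ, n, x, hδ, hδl, hinj, hxK, hcov, hlim⟩ := net_exists hK
  exact le_of_tendsto_of_tendsto' (hlim (c * t)) ((hlim t).const_mul (c^2)) fun m => VR_scale (hinj m) ht hc
end


section

noncomputable def eC : E2 ≃ₗᵢ[ℝ] ℂ := Complex.orthonormalBasisOneI.repr.symm

noncomputable def VE (K : Set E2) (t : ℝ) : ℝ := (volume (thickening t K)).toReal

lemma VE_eq (K : Set E2) (t : ℝ) : VE K t = VK (eC '' K) t := by
  unfold VE VK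
  congr 1
  have hmp : MeasurePreserving eC volume volume := eC.measurePreserving
  rw [← hmp.measure_preimage isOpen_thickening.measurableSet.nullMeasurableSet]
  congr 1
  ext y
  simp [mem_thickening_iff]

lemma thick_conc_E {k : ℕ} {K : Set E2} (hK : IsCompact K) {K0 : Set E2} {Kl : Fin k → Set E2}
    (h0 : IsPreconnected K0) (hl : ∀ l, IsPreconnected (Kl l)) (hKeq : K = K0 ∪ ⋃ l, Kl l)
    {z : E2} {R ρ : ℝ} (hz : ∀ y ∈ K, ρ ≤ dist y z) (hR : 0 < R) (hsph : sphere z R ⊆ K0)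
    {u v w : ℝ} (hu : 0 < u) (huv : u ≤ v) (hvw : v ≤ w) (hw : w < ρ) :
    ((VE K w - Real.pi * k * w^2) - (VE K v - Real.pi * k * v^2)) * (v - u) ≤
    ((VE K v - Real.pi * k * v^2) - (VE K u - Real.pi * k * u^2)) * (w - v) := by
  simp only [VE_eq]
  refine thick_conc (K0 := eC '' K0) (Kl := fun l => eC '' (Kl l)) (z := eC z) (R := R) (ρ := ρ) (hK.image eC.continuous)
    (h0.image _ eC.continuous.continuousOn) (fun l => (hl l).image _ eC.continuous.continuousOn) ?_ ?_ hR ?_ hu huv hvw hw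
  · rw [hKeq, image_union, image_iUnion]
  · rintro _ ⟨y, hy, rfl⟩
    rw [← dist_eq_norm, eC.dist_map]; exact hz y hy
  · rw [← eC.image_sphere]; exact image_mono hsph

lemma thick_scale_E {K : Set E2} (hK : IsCompact K) {t c : ℝ} (ht : 0 ≤ t) (hc : 1 ≤ c) :
    VE K (c * t) ≤ c ^ 2 * VE K t := by
  simp only [VE_eq]
  exact thick_scale (hK.image eC.continuous) ht hc

lemma vol_ball_E (z : E2) {r : ℝ} (hr : 0 ≤ r) : (volume (ball z r)).toReal = Real.pi * r ^ 2 := by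
  rw [EuclideanSpace.volume_ball_fin_two]
  simp [ENNReal.toReal_ofReal hr, ENNReal.toReal_ofReal Real.pi_pos.le, mul_comm]

/-- exterior of a ball is connected -/
lemma ext_conn (z : E2) (R : ℝ) : IsPreconnected {y : E2 | R ≤ dist y z} := by
  have : {y : E2 | R ≤ dist y z} = (fun q : ℝ × ℝ => z + eC.symm ((q.1 : ℂ) * ue q.2)) '' (Ici R ×ˢ univ) := by
    ext y
    simp only [mem_ofPred_eq, mem_image, mem_prod, mem_Ici, mem_univ, and_true, Prod.exists]
    constructor
    · intro h
      refine ⟨‖eC (y - z)‖, (eC (y - z)).arg, by rwa [eC.norm_map, ← dist_eq_norm], ?_⟩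
      rw [← polar_eq]; simp
    · rintro ⟨r, θ, hr, rfl⟩
      rw [dist_eq_norm, add_sub_cancel_left, LinearIsometryEquiv.norm_map, norm_mul, ue_norm]
      simp only [Complex.norm_real, Real.norm_eq_abs, mul_one]
      exact hr.trans (le_abs_self r)
  rw [this]
  refine ((isPreconnected_Ici).prod isPreconnected_univ).image _ (Continuous.continuousOn ?_)
  have := ue_cont
  have := eC.symm.continuous
  fun_prop

lemma preconn_frontier {X : Type*} [TopologicalSpace X] {S Ω : Set X} (hS : IsPreconnected S) (h1 : (S ∩ Ω).Nonempty)
    (h2 : (S ∩ Ωᶜ).Nonempty) : (S ∩ frontier Ω).Nonempty := by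
  by_contra hne
  rw [not_nonempty_iff_eq_empty] at hne
  have hf : ∀ y ∈ S, y ∈ closure Ω → y ∈ interior Ω := by
    intro y hy hc
    by_contra hi
    have : y ∈ S ∩ frontier Ω := ⟨hy, hc, hi⟩
    rw [hne] at this; exact this
  obtain ⟨a, ha, ha'⟩ := h1
  obtain ⟨b, hb, hb'⟩ := h2
  obtain ⟨q, -, hq1, hq2⟩ := hS (interior Ω) (closure Ω)ᶜ isOpen_interior isClosed_closure.isOpen_compl
    (fun y hy => (em (y ∈ closure Ω)).imp (hf y hy) id) ⟨a, ha, hf a ha (subset_closure ha')⟩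
    ⟨b, hb, fun hc => hb' (interior_subset (hf b hb hc))⟩
  exact hq2 (subset_closure (interior_subset hq1))

lemma frontier_between {Ω : Set E2} {x y : E2} (hx : x ∈ Ω) (hy : y ∉ Ω) : ∃ q ∈ frontier Ω, dist x q ≤ dist x y := by
  have hp : IsPreconnected (segment ℝ x y) := (convex_segment x y).isPreconnected
  obtain ⟨q, hq, hq2⟩ := preconn_frontier (Ω := Ω) hp ⟨x, left_mem_segment ℝ x y, hx⟩ ⟨y, right_mem_segment ℝ x y, hy⟩
  refine ⟨q, hq2, ?_⟩
  have := dist_add_dist_of_mem_segment hq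
  have := dist_nonneg (x := q) (y := y)
  linarith

end


section

lemma enum_sets {X : Type*} {S : Set (Set X)} {k : ℕ} (hS : S.Finite) (hk : S.ncard ≤ k) :
    ∃ f : Fin k → Set X, (∀ l, f l ∈ S ∨ f l = ∅) ∧ ∀ C ∈ S, ∃ l, f l = C := by
  classical
  have := hS.fintype
  have hc : Fintype.card S ≤ Fintype.card (Fin k) := by
    rw [Fintype.card_fin]
    rwa [← Nat.card_eq_fintype_card, Nat.card_coe_set_eq]
  obtain ⟨e⟩ := Function.Embedding.nonempty_of_card_le hc
  refine ⟨fun l => if h : ∃ C, e C = l then (h.choose : Set X) else ∅, fun l => ?_, fun C hC => ⟨e ⟨C, hC⟩, ?_⟩⟩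
  · by_cases h : ∃ C, e C = l
    · left; simp only [h, dif_pos]; exact h.choose.2
    · right; simp only [h, dif_neg, not_false_eq_true]
  · have h : ∃ C', e C' = e ⟨C, hC⟩ := ⟨_, rfl⟩
    simp only [h, dif_pos]
    have := e.injective h.choose_spec
    rw [this]

/-- radial retraction onto a ball -/
noncomputable def rretr (z : E2) (R : ℝ) (y : E2) : E2 := z + (R / max R (dist y z)) • (y - z)

lemma rretr_cont (z : E2) {R : ℝ} (hR : 0 < R) : Continuous (rretr z R) := by
  unfold rretr
  have h : ∀ y : E2, max R (dist y z) ≠ 0 := fun y => (hR.trans_le (le_max_left R (dist y z))).ne'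
  fun_prop (disch := exact h _)

lemma rretr_in {z : E2} {R : ℝ} (hR : 0 < R) {y : E2} (hy : dist y z ≤ R) : rretr z R y = y := by
  unfold rretr
  rw [max_eq_left hy, div_self hR.ne', one_smul]; abel

lemma rretr_out {z : E2} {R : ℝ} (hR : 0 < R) {y : E2} (hy : R ≤ dist y z) :
    dist (rretr z R y) z = R ∧ dist y (rretr z R y) = dist y z - R := by
  have hd : 0 < dist y z := hR.trans_le hy
  unfold rretr
  rw [max_eq_right hy]
  constructor
  · rw [dist_eq_norm, add_sub_cancel_left, norm_smul, ← dist_eq_norm, Real.norm_of_nonneg (by positivity)]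
    field_simp
  · have : y - (z + (R / dist y z) • (y - z)) = (1 - R / dist y z) • (y - z) := by
      rw [sub_smul, one_smul]; abel
    rw [dist_eq_norm y (z + _), this, norm_smul, ← dist_eq_norm y z, Real.norm_of_nonneg]
    · field_simp
    · rw [sub_nonneg]; exact (div_le_one hd).2 hy

lemma exists_pt_dist (z : E2) {R : ℝ} (hR : 0 ≤ R) : ∃ p : E2, dist p z = R := by
  refine ⟨z + EuclideanSpace.single 0 R, ?_⟩
  rw [dist_eq_norm, add_sub_cancel_left]
  simp [hR]

lemma comps_decomp {Ω : Set E2} {z : E2} {R : ℝ} (hR : 0 < R) (hsub : Ω ⊆ ball z R) {k : ℕ} (hk : nBddCompLe Ωᶜ k) :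
    ∃ (K0 : Set E2) (Kl : Fin k → Set E2), IsPreconnected K0 ∧ (∀ l, IsPreconnected (Kl l)) ∧
      Ωᶜ ∩ closedBall z R = K0 ∪ (⋃ l, Kl l) ∧ sphere z R ⊆ K0 := by
  obtain ⟨p, hp⟩ := exists_pt_dist z hR.le
  have hext : {y : E2 | R ≤ dist y z} ⊆ Ωᶜ := fun y hy hyO => absurd (mem_ball.1 (hsub hyO)) (not_lt.2 hy)
  set U := connectedComponentIn Ωᶜ p with hU
  have hextU : {y : E2 | R ≤ dist y z} ⊆ U := (ext_conn z R).subset_connectedComponentIn (x := p) hp.ge hext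
  have hUs : U ⊆ Ωᶜ := connectedComponentIn_subset _ _
  set S : Set (Set E2) := {C | C ∈ boundedComponents Ωᶜ ∧ C ⊆ closedBall z R} with hS
  have hSs : S ⊆ boundedComponents Ωᶜ := fun C hC => hC.1
  obtain ⟨f, hf1, hf2⟩ := enum_sets (hk.1.subset hSs) ((ncard_le_ncard hSs hk.1).trans hk.2)
  refine ⟨U ∩ closedBall z R, f, ?_, ?_, ?_, ?_⟩
  · have : U ∩ closedBall z R = rretr z R '' U := by
      apply subset_antisymm
      · rintro y ⟨hy, hy2⟩
        exact ⟨y, hy, rretr_in hR hy2⟩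
      · rintro _ ⟨y, hy, rfl⟩
        rcases le_total (dist y z) R with h | h
        · rw [rretr_in hR h]; exact ⟨hy, h⟩
        · have := (rretr_out hR h).1
          exact ⟨hextU this.ge, this.le⟩
    rw [this]
    exact isPreconnected_connectedComponentIn.image _ (rretr_cont z hR).continuousOn
  · intro l
    rcases hf1 l with ⟨⟨y, hy, h, -⟩, -⟩ | h
    · rw [h]; exact isPreconnected_connectedComponentIn
    · rw [h]; exact isPreconnected_empty
  · apply subset_antisymm
    · rintro y ⟨hy, hyb⟩
      by_cases h : connectedComponentIn Ωᶜ y ⊆ closedBall z R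
      · obtain ⟨l, hl⟩ := hf2 (connectedComponentIn Ωᶜ y) ⟨⟨y, hy, rfl, isBounded_closedBall.subset h⟩, h⟩
        exact Or.inr (mem_iUnion.2 ⟨l, hl ▸ mem_connectedComponentIn hy⟩)
      · obtain ⟨q, hq, hq2⟩ := not_subset.1 h
        have hqU : q ∈ U := hextU (show R ≤ dist q z from (not_le.1 (fun h => hq2 (mem_closedBall.2 h))).le)
        left
        refine ⟨?_, hyb⟩
        have h1 := connectedComponentIn_eq hq
        have h2 := connectedComponentIn_eq hqU
        rw [hU, h2, ← h1]
        exact mem_connectedComponentIn hy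
    · rintro y (hy | hy)
      · exact ⟨hUs hy.1, hy.2⟩
      · obtain ⟨l, hl⟩ := mem_iUnion.1 hy
        rcases hf1 l with ⟨⟨q, hq, h, -⟩, h'⟩ | h
        · exact ⟨connectedComponentIn_subset _ q (h ▸ hl), h' hl⟩
        · rw [h] at hl; exact hl.elim
  · intro y hy
    exact ⟨hextU (mem_sphere.1 hy).ge, (mem_sphere.1 hy).le⟩

noncomputable def AR (Ω : Set E2) (t : ℝ) : ℝ := (volume {x | x ∈ Ω ∧ infDist x (frontier Ω) < t}).toReal

lemma AR_nonneg (Ω : Set E2) (t : ℝ) : 0 ≤ AR Ω t := ENNReal.toReal_nonneg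

lemma thick_eq {Ω : Set E2} (ho : IsOpen Ω) {z : E2} {R t : ℝ} (hR : 0 < R) (ht : 0 < t) (hsub : Ω ⊆ ball z R) :
    thickening t (Ωᶜ ∩ closedBall z R) = ball z (R + t) \ {x | x ∈ Ω ∧ t ≤ infDist x (frontier Ω)} := by
  have hfK : frontier Ω ⊆ Ωᶜ ∩ closedBall z R := by
    intro y hy
    rw [ho.frontier_eq] at hy
    exact ⟨hy.2, closure_ball_subset_closedBall (closure_mono hsub hy.1)⟩
  obtain ⟨p, hp⟩ := exists_pt_dist z hR.le
  have hpO : p ∉ Ω := fun h => absurd (mem_ball.1 (hsub h)) (by linarith)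
  ext y
  rw [mem_thickening_iff]
  constructor
  · rintro ⟨q, ⟨hq1, hq2⟩, hd⟩
    refine ⟨?_, ?_⟩
    · rw [mem_ball]
      have := dist_triangle y q z
      have := mem_closedBall.1 hq2
      linarith
    · rintro ⟨hy, hy2⟩
      obtain ⟨a, ha, ha2⟩ := frontier_between hy hq1
      have := infDist_le_dist_of_mem (x := y) ha
      linarith
  · rintro ⟨h1, h2⟩
    rw [mem_ball] at h1
    by_cases hy : y ∈ Ω
    · have h3 : infDist y (frontier Ω) < t := by
        by_contra h; exact h2 ⟨hy, not_lt.1 h⟩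
      obtain ⟨a, ha, -⟩ := frontier_between hy hpO
      obtain ⟨q, hq, hq2⟩ := (infDist_lt_iff ⟨a, ha⟩).1 h3
      exact ⟨q, hfK hq, hq2⟩
    · rcases le_total (dist y z) R with h | h
      · exact ⟨y, ⟨hy, h⟩, by simpa using ht⟩
      · have := rretr_out hR h
        refine ⟨rretr z R y, ⟨fun hO => ?_, this.1.le⟩, by linarith⟩
        have := mem_ball.1 (hsub hO)
        linarith

lemma AR_split {Ω : Set E2} (ho : IsOpen Ω) (hb : IsBounded Ω) (t : ℝ) :
    (volume Ω).toReal = AR Ω t + (volume {x | x ∈ Ω ∧ t ≤ infDist x (frontier Ω)}).toReal := by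
  have hm : MeasurableSet {x : E2 | infDist x (frontier Ω) < t} :=
    measurableSet_lt (continuous_infDist_pt _).measurable measurable_const
  have h := measure_inter_add_sdiff (μ := volume) Ω hm
  have e2 : Ω \ {x : E2 | infDist x (frontier Ω) < t} = {x | x ∈ Ω ∧ t ≤ infDist x (frontier Ω)} := by
    ext x; simp
  have f : ∀ s ⊆ Ω, volume s ≠ ⊤ := fun s hs => (hb.subset hs).measure_lt_top.ne
  rw [e2] at h
  rw [← h, ENNReal.toReal_add (f _ inter_subset_left) (f _ fun x hx => hx.1)]
  rfl

lemma VE_AR {Ω : Set E2} (ho : IsOpen Ω) (hb : IsBounded Ω) {z : E2} {R t : ℝ} (hR : 0 < R) (ht : 0 < t) (hsub : Ω ⊆ ball z R) :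
    VE (Ωᶜ ∩ closedBall z R) t = Real.pi * (R + t) ^ 2 - (volume Ω).toReal + AR Ω t := by
  unfold VE
  rw [thick_eq ho hR ht hsub, measure_sdiff, ENNReal.toReal_sub_of_le, vol_ball_E z (by linarith), AR_split ho hb t]
  · ring
  · refine measure_mono fun x hx => ball_subset_ball (by linarith) (hsub hx.1)
  · exact measure_ball_lt_top.ne
  · exact fun x hx => ball_subset_ball (by linarith) (hsub hx.1)
  · exact (ho.measurableSet.inter (measurableSet_le measurable_const (continuous_infDist_pt _).measurable)).nullMeasurableSet
  · exact (hb.subset fun x hx => hx.1).measure_lt_top.ne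

/-- first half: an asymptotic bound near the boundary implies the global bound -/
lemma halfA {Ω : Set E2} (ho : IsOpen Ω) (hb : IsBounded Ω) {k : ℕ} (hk : nBddCompLe Ωᶜ k) {z : E2} {ρ c : ℝ}
    (hzO : z ∈ Ω) (hz : infDist z (frontier Ω) = ρ) (hmax : ∀ y ∈ Ω, infDist y (frontier Ω) ≤ ρ) (hρ : 0 < ρ)
    (hs : ∀ ε > 0, ∀ᶠ s in 𝓝[>] (0:ℝ), AR Ω s ≤ (c + ε) * s) :
    (volume Ω).toReal ≤ (c + Real.pi * ((k:ℝ) - 1) * ρ) * ρ := by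
  obtain ⟨R0, hR0⟩ := hb.subset_ball z
  set R := max R0 1
  have hR : 0 < R := lt_max_of_lt_right one_pos
  have hsub : Ω ⊆ ball z R := hR0.trans (ball_subset_ball (le_max_left _ _))
  obtain ⟨K0, Kl, h0, hl, heq, hsph⟩ := comps_decomp hR hsub hk
  have hKc : IsCompact (Ωᶜ ∩ closedBall z R) := (isCompact_closedBall z R).inter_left ho.isClosed_compl
  have hzK : ∀ y ∈ Ωᶜ ∩ closedBall z R, ρ ≤ dist y z := by
    intro y hy
    obtain ⟨q, hq, hq2⟩ := frontier_between hzO hy.1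
    have := infDist_le_dist_of_mem (x := z) hq
    rw [hz] at this
    rw [dist_comm]; linarith
  set g : ℝ → ℝ := fun t => AR Ω t - Real.pi * ((k:ℝ) - 1) * t ^ 2 with hg
  have hconc : ∀ u v w : ℝ, 0 < u → u ≤ v → v ≤ w → w < ρ → (g w - g v) * (v - u) ≤ (g v - g u) * (w - v) := by
    intro u v w hu huv hvw hw
    have := thick_conc_E hKc h0 hl heq hzK hR hsph hu huv hvw hw
    rw [VE_AR ho hb hR hu hsub, VE_AR ho hb hR (by linarith) hsub, VE_AR ho hb hR (by linarith) hsub] at this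
    simp only [hg]
    linarith
  have hstar : ∀ s t : ℝ, 0 < s → s ≤ t → t < ρ → g t * s ≤ g s * t := by
    intro s t h1 h2 h3
    have hlim1 : Tendsto (fun u : ℝ => (g t - g s) * (s - u)) (𝓝[>] 0) (𝓝 ((g t - g s) * (s - 0))) := by
      refine (Continuous.tendsto ?_ 0).mono_left nhdsWithin_le_nhds
      fun_prop
    have hlim2 : Tendsto (fun u : ℝ => (g s + Real.pi * ((k:ℝ) - 1) * u ^ 2) * (t - s)) (𝓝[>] 0) (𝓝 ((g s + Real.pi * ((k:ℝ) - 1) * 0 ^ 2) * (t - s))) := by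
      refine (Continuous.tendsto (f := fun u : ℝ => (g s + Real.pi * ((k:ℝ) - 1) * u ^ 2) * (t - s)) ?_ 0).mono_left nhdsWithin_le_nhds
      fun_prop
    have := le_of_tendsto_of_tendsto hlim1 hlim2 (by
      filter_upwards [Ioo_mem_nhdsGT h1] with u hu
      refine (hconc u s t hu.1 hu.2.le h2 h3).trans (mul_le_mul_of_nonneg_right ?_ (by linarith))
      have := AR_nonneg Ω u
      simp only [hg]; linarith)
    nlinarith
  have hgt : ∀ t : ℝ, 0 < t → t < ρ → g t ≤ c * t := by
    intro t h1 h2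
    refine le_of_forall_pos_le_add fun η hη => ?_
    have hε : 0 < η / (2 * t) := by positivity
    have hsm : ∀ᶠ s in 𝓝[>] (0:ℝ), |Real.pi * ((k:ℝ) - 1)| * s < η / (2 * t) := by
      have : Tendsto (fun s : ℝ => |Real.pi * ((k:ℝ) - 1)| * s) (𝓝[>] 0) (𝓝 (|Real.pi * ((k:ℝ) - 1)| * 0)) :=
        (Continuous.tendsto (by fun_prop) 0).mono_left nhdsWithin_le_nhds
      rw [mul_zero] at this
      exact this.eventually (gt_mem_nhds hε)
    obtain ⟨s, ⟨hs1, hs2⟩, hs3⟩ := ((hs _ hε).and hsm |>.and (Ioo_mem_nhdsGT h1)).exists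
    have h3 := hstar s t hs3.1 hs3.2.le h2
    have h4 : g s ≤ (c + η / (2*t)) * s + η / (2*t) * s := by
      simp only [hg]
      have := neg_abs_le (Real.pi * ((k:ℝ) - 1))
      have h5 := mul_le_mul_of_nonneg_right hs2.le hs3.1.le
      nlinarith [mul_le_mul_of_nonneg_right this (sq_nonneg s)]
    have h6 : g t * s ≤ (c * t + η) * s := by
      refine h3.trans ((mul_le_mul_of_nonneg_right h4 h1.le).trans (le_of_eq ?_))
      field_simp
      ring
    exact le_of_mul_le_mul_right h6 hs3.1
  have hfin : ∀ t w : ℝ, 0 < t → t < ρ → ρ < w → (volume Ω).toReal ≤ c * t + Real.pi * ((k:ℝ) - 1) * t^2 + Real.pi * (R + t)^2 - (t / w)^2 * (Real.pi * (R + w)^2) := by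
    intro t w h1 h2 h3
    have h4 := thick_scale_E hKc (t := t) (c := w / t) h1.le ((one_le_div h1).2 (by linarith))
    rw [div_mul_cancel₀ _ h1.ne', VE_AR ho hb hR h1 hsub, VE_AR ho hb hR (by linarith) hsub] at h4
    have h5 : AR Ω w = (volume Ω).toReal := by
      unfold AR
      congr 2
      ext x
      exact ⟨fun h => h.1, fun h => ⟨h, (hmax x h).trans_lt h3⟩⟩
    rw [h5] at h4
    have h6 := hgt t h1 h2
    simp only [hg] at h6
    have hw : 0 < w := by linarith
    have h7 := mul_le_mul_of_nonneg_left h4 (sq_nonneg (t / w))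
    have h8 : (t / w)^2 * ((w / t)^2 * (Real.pi * (R + t) ^ 2 - (volume Ω).toReal + AR Ω t)) = (Real.pi * (R + t) ^ 2 - (volume Ω).toReal + AR Ω t) := by
      field_simp
    rw [h8] at h7
    linarith
  have hfin2 : ∀ t : ℝ, 0 < t → t < ρ → (volume Ω).toReal ≤ c * t + Real.pi * ((k:ℝ) - 1) * t^2 + Real.pi * (R + t)^2 - (t / ρ)^2 * (Real.pi * (R + ρ)^2) := by
    intro t h1 h2
    have hlim : Tendsto (fun w : ℝ => c * t + Real.pi * ((k:ℝ) - 1) * t^2 + Real.pi * (R + t)^2 - (t / w)^2 * (Real.pi * (R + w)^2)) (𝓝[>] ρ) (𝓝 (c * t + Real.pi * ((k:ℝ) - 1) * t^2 + Real.pi * (R + t)^2 - (t / ρ)^2 * (Real.pi * (R + ρ)^2))) := by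
      refine (ContinuousAt.tendsto ?_).mono_left nhdsWithin_le_nhds
      have : ρ ≠ 0 := hρ.ne'
      fun_prop (disch := assumption)
    refine ge_of_tendsto hlim ?_
    filter_upwards [self_mem_nhdsWithin] with w hw
    exact hfin t w h1 h2 hw
  have hlim : Tendsto (fun t : ℝ => c * t + Real.pi * ((k:ℝ) - 1) * t^2 + Real.pi * (R + t)^2 - (t / ρ)^2 * (Real.pi * (R + ρ)^2)) (𝓝[<] ρ) (𝓝 (c * ρ + Real.pi * ((k:ℝ) - 1) * ρ^2 + Real.pi * (R + ρ)^2 - (ρ / ρ)^2 * (Real.pi * (R + ρ)^2))) := by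
    refine (ContinuousAt.tendsto (f := fun t : ℝ => c * t + Real.pi * ((k:ℝ) - 1) * t^2 + Real.pi * (R + t)^2 - (t / ρ)^2 * (Real.pi * (R + ρ)^2)) ?_).mono_left nhdsWithin_le_nhds
    fun_prop
  have := ge_of_tendsto hlim (by
    filter_upwards [Ioo_mem_nhdsLT hρ] with t ht
    exact hfin2 t ht.1 ht.2)
  rw [div_self hρ.ne'] at this
  linarith
end


section

lemma int_const {X : Type*} [TopologicalSpace X] {S : Set X} (hS : IsPreconnected S) {g : X → ℝ} (hg : ContinuousOn g S)
    (h : ∀ x ∈ S, ∃ n : ℤ, g x = n) : ∃ n : ℤ, ∀ x ∈ S, g x = n := by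
  rcases S.eq_empty_or_nonempty with rfl | ⟨a, ha⟩
  · exact ⟨0, by simp⟩
  obtain ⟨n, hn⟩ := h a ha
  refine ⟨n, fun x hx => ?_⟩
  have key : ∀ y z, y ∈ S → z ∈ S → ¬ g y < g z := by
    intro y z hy hz hlt
    obtain ⟨p, hp⟩ := h y hy
    obtain ⟨q, hq⟩ := h z hz
    rw [hp, hq] at hlt
    have hpq : p < q := by exact_mod_cast hlt
    have hpq1 : (p : ℝ) + 1 ≤ q := by exact_mod_cast hpq
    obtain ⟨w, hw, hw2⟩ := hS.intermediate_value hy hz hg (show (p : ℝ) + 1/2 ∈ Icc (g y) (g z) by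
      rw [hp, hq]; constructor <;> linarith)
    obtain ⟨m, hm⟩ := h w hw
    rw [hm] at hw2
    have h2 : (2 * m : ℝ) = 2 * p + 1 := by linarith
    have h3 : 2 * m = 2 * p + 1 := by exact_mod_cast h2
    omega
  rw [← hn]
  exact le_antisymm (not_lt.1 (key a x ha hx)) (not_lt.1 (key x a hx ha))

open Classical in
lemma lift_lemma {Ω : Set E2} {a b : ℕ} (O : Fin a → Set E2) (C : Fin b → Set E2) (hO : ∀ α, IsPreconnected (O α)) (hC : ∀ β, IsPreconnected (C β))
    (hOe : Ω = ⋃ α, O α) (hCe : Ωᶜ = ⋃ β, C β) (u : C(E2, ℝ)) (hu : ∀ x ∈ frontier Ω, u x = 0 ∨ u x = 1) :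
    ∃ (n : Fin a → ℤ) (m : Fin b → ℤ), ∀ x ∈ frontier Ω, ∀ α β, x ∈ closure (O α) → x ∈ C β → u x = m β - n α := by
  have hpi : (0:ℝ) < 2 * Real.pi := by positivity
  let f : C(E2, Circle) := ⟨Ω.piecewise (fun x => Circle.exp (Real.pi * u x)) (fun x => Circle.exp (-(Real.pi * u x))), by
    refine Continuous.piecewise ?_ (by fun_prop) (by fun_prop)
    intro x hx
    rcases hu x hx with h | h
    · simp [h]
    · rw [h, Circle.exp_eq_exp]
      exact ⟨1, by push_cast; ring⟩⟩
  obtain ⟨e0, he0⟩ := Circle.exp_surjective (f 0)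
  obtain ⟨Θ, ⟨-, hΘ⟩, -⟩ := Circle.isCoveringMap_exp.existsUnique_continuousMap_lifts f 0 e0 he0
  have hΘ' : ∀ x, Circle.exp (Θ x) = f x := fun x => congrFun hΘ x
  have h1 : ∀ α, ∃ n : ℤ, ∀ x ∈ O α, (Θ x - Real.pi * u x) / (2 * Real.pi) = n := by
    intro α
    refine int_const (hO α) (Continuous.continuousOn (by fun_prop)) fun x hx => ?_
    have hxO : x ∈ Ω := by rw [hOe]; exact mem_iUnion.2 ⟨α, hx⟩
    have := hΘ' x
    simp only [f, ContinuousMap.coe_mk, piecewise_eq_of_mem _ _ _ hxO] at this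
    obtain ⟨m, hm⟩ := Circle.exp_eq_exp.1 this
    refine ⟨m, ?_⟩
    rw [hm, _root_.div_eq_iff hpi.ne']; ring
  have h2 : ∀ β, ∃ n : ℤ, ∀ x ∈ C β, (Θ x + Real.pi * u x) / (2 * Real.pi) = n := by
    intro β
    refine int_const (hC β) (Continuous.continuousOn (by fun_prop)) fun x hx => ?_
    have hxO : x ∉ Ω := by
      have : x ∈ Ωᶜ := by rw [hCe]; exact mem_iUnion.2 ⟨β, hx⟩
      exact this
    have := hΘ' x
    simp only [f, ContinuousMap.coe_mk, piecewise_eq_of_notMem _ _ _ hxO] at this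
    obtain ⟨m, hm⟩ := Circle.exp_eq_exp.1 this
    refine ⟨m, ?_⟩
    rw [hm, _root_.div_eq_iff hpi.ne']; ring
  choose n hn using h1
  choose m hm using h2
  refine ⟨n, m, fun x hx α β hα hβ => ?_⟩
  have h3 : (Θ x - Real.pi * u x) / (2 * Real.pi) = n α := by
    have hcl : IsClosed {y | (Θ y - Real.pi * u y) / (2 * Real.pi) = n α} :=
      isClosed_eq (by fun_prop) continuous_const
    exact closure_minimal (hn α) hcl hα
  have h4 := hm β x hβ
  rw [← h3, ← h4]
  field_simp
  ring

lemma pieces_bound {Ω : Set E2} (ho : IsOpen Ω) {a b : ℕ} (O : Fin a → Set E2) (C : Fin b → Set E2) (hO : ∀ α, IsPreconnected (O α)) (hC : ∀ β, IsPreconnected (C β))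
    (hOe : Ω = ⋃ α, O α) (hCe : Ωᶜ = ⋃ β, C β) {M : ℕ} (S : Fin M → Set E2) (hcl : ∀ j, IsClosed (S j))
    (hne : ∀ j, (S j).Nonempty) (hdisj : ∀ i j, i ≠ j → Disjoint (S i) (S j)) (hS : frontier Ω = ⋃ j, S j) : M ≤ a + b := by
  classical
  have hpt : ∀ j, ∃ (x : E2) (α : Fin a) (β : Fin b), x ∈ S j ∧ x ∈ closure (O α) ∧ x ∈ C β := by
    intro j
    obtain ⟨x, hx⟩ := hne j
    have hxf : x ∈ frontier Ω := by rw [hS]; exact mem_iUnion.2 ⟨j, hx⟩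
    have hxc : x ∈ closure Ω := hxf.1
    have hxn : x ∈ Ωᶜ := by rw [ho.frontier_eq] at hxf; exact hxf.2
    rw [hOe, closure_iUnion_of_finite] at hxc
    rw [hCe] at hxn
    obtain ⟨α, hα⟩ := mem_iUnion.1 hxc
    obtain ⟨β, hβ⟩ := mem_iUnion.1 hxn
    exact ⟨x, α, β, hx, hα, hβ⟩
  choose x α β hx hα hβ using hpt
  have hc : ∀ c : Fin M → Bool, ∃ (p : (Fin a → Bool) × (Fin b → Bool)), ∀ j, c j = xor (p.1 (α j)) (p.2 (β j)) := by
    intro c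
    have hd : Disjoint (⋃ j : {j // c j = false}, S j) (⋃ j : {j // c j = true}, S j) := by
      rw [disjoint_iUnion_left]; intro i
      rw [disjoint_iUnion_right]; intro j
      refine hdisj _ _ fun h => ?_
      have h1 := i.2
      have h2 := j.2
      rw [h, h2] at h1; cases h1
    obtain ⟨u, hu0, hu1, -⟩ := exists_continuous_zero_one_of_isClosed (isClosed_iUnion_of_finite fun j : {j // c j = false} => hcl j) (isClosed_iUnion_of_finite fun j : {j // c j = true} => hcl j) hd
    have hval : ∀ j, ∀ y ∈ S j, u y = if c j then 1 else 0 := by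
      intro j y hy
      cases hcj : c j
      · simpa using hu0 (mem_iUnion.2 ⟨⟨j, hcj⟩, hy⟩)
      · simpa using hu1 (mem_iUnion.2 ⟨⟨j, hcj⟩, hy⟩)
    have hfr : ∀ y ∈ frontier Ω, u y = 0 ∨ u y = 1 := by
      intro y hy
      rw [hS] at hy
      obtain ⟨j, hj⟩ := mem_iUnion.1 hy
      rw [hval j y hj]
      cases c j <;> simp
    obtain ⟨n, m, hnm⟩ := lift_lemma O C hO hC hOe hCe u hfr
    refine ⟨(fun i => decide (Odd (n i)), fun i => decide (Odd (m i))), fun j => ?_⟩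
    have h1 := hnm (x j) (by rw [hS]; exact mem_iUnion.2 ⟨j, hx j⟩) _ _ (hα j) (hβ j)
    rw [hval j _ (hx j)] at h1
    have h2 : (if c j then (1:ℤ) else 0) = m (β j) - n (α j) := by
      have : (((if c j then (1:ℤ) else 0 : ℤ)) : ℝ) = ((m (β j) - n (α j) : ℤ) : ℝ) := by
        push_cast; exact h1
      exact_mod_cast this
    cases hcj : c j
    · rw [hcj] at h2
      have : m (β j) = n (α j) := by simp at h2; omega
      simp [this]
    · rw [hcj] at h2
      have : m (β j) = n (α j) + 1 := by simp at h2; omega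
      have h5 : Odd (n (α j) + 1) ↔ ¬ Odd (n (α j)) := by rw [Int.not_odd_iff_even]; simp [parity_simps]
      simp only [this, h5]
      by_cases h : Odd (n (α j)) <;> simp only [h] <;> rfl
  choose P hP using hc
  have hinj : Function.Injective P := by
    intro c c' h
    funext j
    rw [hP c j, hP c' j, h]
  have hcard := Fintype.card_le_of_injective P hinj
  simp only [Fintype.card_prod, Fintype.card_fun, Fintype.card_bool, Fintype.card_fin, ← pow_add] at hcard
  exact (Nat.pow_le_pow_iff_right (by norm_num)).1 hcard
end


section

lemma lune_prod {r d : ℝ} (hd : 0 ≤ d) :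
    volume {q : ℝ × ℝ | (q.1 - d)^2 + q.2^2 < r^2 ∧ r^2 ≤ q.1^2 + q.2^2} ≤ ENNReal.ofReal (2 * |r| * d) := by
  have hm : MeasurableSet {q : ℝ × ℝ | (q.1 - d)^2 + q.2^2 < r^2 ∧ r^2 ≤ q.1^2 + q.2^2} :=
    (measurableSet_lt (by fun_prop : Measurable fun q : ℝ × ℝ => (q.1 - d)^2 + q.2^2) measurable_const).inter
      (measurableSet_le measurable_const (by fun_prop : Measurable fun q : ℝ × ℝ => q.1^2 + q.2^2))
  rw [Measure.volume_eq_prod, Measure.prod_apply_symm hm]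
  have h1 : ∀ y : ℝ, volume ((fun x => (x, y)) ⁻¹' {q : ℝ × ℝ | (q.1 - d)^2 + q.2^2 < r^2 ∧ r^2 ≤ q.1^2 + q.2^2}) ≤
      (Ioo (-|r|) |r|).indicator (fun _ => ENNReal.ofReal d) y := by
    intro y
    by_cases hy : y ∈ Ioo (-|r|) |r|
    · rw [indicator_of_mem hy]
      have hyr : y ^ 2 < r ^ 2 := by
        rw [← sq_abs r]; exact sq_lt_sq' hy.1 hy.2
      set h := Real.sqrt (r^2 - y^2)
      have hh : h ^ 2 = r^2 - y^2 := Real.sq_sqrt (by linarith)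
      have h0 : 0 ≤ h := Real.sqrt_nonneg _
      calc _ ≤ volume (Icc h (h + d)) := by
            refine measure_mono ?_
            rintro x ⟨hx1, hx2⟩
            simp only at hx1 hx2
            have a1 : (x - d)^2 < h^2 := by linarith
            have a2 : h^2 ≤ x^2 := by linarith
            have a3 := abs_lt_of_sq_lt_sq' a1 h0
            constructor
            · by_contra hx
              push Not at hx
              have := sq_lt_sq' (by linarith : -h < x) hx
              linarith
            · linarith
        _ = ENNReal.ofReal d := by rw [Real.volume_Icc]; congr 1; ring
    · rw [indicator_of_notMem hy]
      refine le_of_eq (measure_mono_null (t := ∅) ?_ measure_empty)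
      rintro x ⟨hx1, hx2⟩
      simp only at hx1
      apply hy
      have a1 : y^2 < |r|^2 := by rw [sq_abs]; nlinarith [sq_nonneg (x - d)]
      exact abs_lt_of_sq_lt_sq' a1 (abs_nonneg r)
  refine (lintegral_mono h1).trans (le_of_eq ?_)
  rw [lintegral_indicator measurableSet_Ioo, lintegral_const, Measure.restrict_apply_univ, Real.volume_Ioo,
    ← ENNReal.ofReal_mul hd]
  congr 1; ring

lemma lune_E (p z : E2) {r : ℝ} (hr : 0 ≤ r) :
    volume (ball z r \ ball p r) ≤ ENNReal.ofReal (2 * r * dist z p) := by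
  by_cases hzp : z = p
  · simp [hzp]
  have hd : 0 < dist z p := dist_pos.2 hzp
  set w := eC (z - p) with hw
  have hwn : ‖w‖ = dist z p := by rw [hw, eC.norm_map, dist_eq_norm]
  let a : Circle := Circle.exp (-w.arg)
  let L : E2 ≃ₗᵢ[ℝ] ℂ := eC.trans (rotation a)
  have hL : L (z - p) = (dist z p : ℂ) := by
    show rotation a (eC (z - p)) = _
    rw [rotation_apply, ← hw, ← hwn]
    conv_lhs => rw [polar_eq w]
    simp only [a, Circle.coe_exp, ue]
    rw [mul_left_comm, ← Complex.exp_add]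
    simp
  let Φ : E2 → ℝ × ℝ := fun y => Complex.measurableEquivRealProd (L (y - p))
  have hΦ : MeasurePreserving Φ volume volume :=
    Complex.volume_preserving_equiv_real_prod.comp ((L.measurePreserving).comp (measurePreserving_sub_right volume p))
  have hm : MeasurableSet {q : ℝ × ℝ | (q.1 - dist z p)^2 + q.2^2 < r^2 ∧ r^2 ≤ q.1^2 + q.2^2} :=
    (measurableSet_lt (by fun_prop : Measurable fun q : ℝ × ℝ => (q.1 - dist z p)^2 + q.2^2) measurable_const).inter
      (measurableSet_le measurable_const (by fun_prop : Measurable fun q : ℝ × ℝ => q.1^2 + q.2^2))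
  have := lune_prod (r := r) hd.le
  rw [abs_of_nonneg hr] at this
  refine le_trans ?_ this
  rw [← hΦ.measure_preimage hm.nullMeasurableSet]
  refine measure_mono ?_
  rintro y ⟨hy1, hy2⟩
  have e1 : ‖L (y - p)‖ = dist y p := by rw [L.norm_map, dist_eq_norm]
  have e2 : ‖L (y - p) - (dist z p : ℂ)‖ = dist y z := by
    rw [← hL, ← map_sub, L.norm_map, dist_eq_norm]; congr 1; abel
  have e1' := Complex.normSq_eq_norm_sq (L (y - p))
  have e2' := Complex.normSq_eq_norm_sq (L (y - p) - (dist z p : ℂ))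
  rw [e1, Complex.normSq_apply] at e1'
  rw [e2, Complex.normSq_apply] at e2'
  simp only [Complex.sub_re, Complex.ofReal_re, Complex.sub_im, Complex.ofReal_im, sub_zero] at e2'
  rw [mem_ball] at hy1
  rw [mem_ball, not_lt] at hy2
  have b1 : dist y z ^ 2 < r ^ 2 := by
    have := dist_nonneg (x := y) (y := z)
    nlinarith
  have b2 : r ^ 2 ≤ dist y p ^ 2 := by nlinarith
  show (((L (y - p)).re - dist z p)^2 + (L (y - p)).im^2 < r^2 ∧ r^2 ≤ (L (y - p)).re^2 + (L (y - p)).im^2)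
  constructor <;> nlinarith

end


section

lemma cover_lemma {Γ : Set E2} (hc : IsCompact Γ) (hH : μH[1] Γ < ⊤) {ε δ : ℝ} (hε : 0 < ε) (hδ : 0 < δ) :
    ∃ (ι : Type) (_ : Fintype ι) (U : ι → Set E2) (d : ι → ℝ),
      (∀ i, IsOpen (U i)) ∧ (∀ i, (U i ∩ Γ).Nonempty) ∧ Γ ⊆ ⋃ i, U i ∧
      (∀ i, 0 ≤ d i) ∧ (∀ i, d i ≤ δ) ∧ (∀ i, ∀ p ∈ U i, ∀ q ∈ U i, dist p q ≤ d i) ∧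
      ∑ i, d i ≤ (μH[1] Γ).toReal + ε := by
  classical
  have h1 : (⨅ (t : ℕ → Set E2) (_ : Γ ⊆ ⋃ n, t n) (_ : ∀ n, ediam (t n) ≤ ENNReal.ofReal (δ/2)),
          ∑' n, ⨆ _ : (t n).Nonempty, ediam (t n) ^ (1:ℝ)) ≤ μH[1] Γ := by
    rw [Measure.hausdorffMeasure_apply]
    exact le_iSup₂_of_le (ENNReal.ofReal (δ/2)) (by simp [hδ]) le_rfl
  have h2 : (⨅ (t : ℕ → Set E2) (_ : Γ ⊆ ⋃ n, t n) (_ : ∀ n, ediam (t n) ≤ ENNReal.ofReal (δ/2)),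
          ∑' n, ⨆ _ : (t n).Nonempty, ediam (t n) ^ (1:ℝ)) < μH[1] Γ + ENNReal.ofReal (ε/2) :=
    lt_of_le_of_lt h1 (ENNReal.lt_add_right hH.ne (by simp [hε]))
  simp only [iInf_lt_iff] at h2
  obtain ⟨t, ht1, ht2, ht3⟩ := h2
  obtain ⟨e, he0, he⟩ := ENNReal.exists_pos_sum_of_countable (ε := ENNReal.ofReal (min ε δ / 4)) (by simp [hε, hδ]) ℕ
  have heb : ∀ n, (2 * e n : ℝ≥0∞) ≤ ENNReal.ofReal (δ/2) := by
    intro n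
    have : (e n : ℝ≥0∞) ≤ ENNReal.ofReal (δ/4) :=
      (ENNReal.le_tsum n).trans (he.le.trans (ENNReal.ofReal_le_ofReal (by have := min_le_right ε δ; linarith)))
    calc (2 * e n : ℝ≥0∞) ≤ 2 * ENNReal.ofReal (δ/4) := by gcongr
      _ = ENNReal.ofReal (2 * (δ/4)) := by rw [ENNReal.ofReal_mul (by norm_num)]; simp
      _ = _ := by congr 1; ring
  set V : ℕ → Set E2 := fun n => thickening (e n) (t n) with hV
  have hVd : ∀ n, ediam (V n) ≤ ediam (t n) + 2 * e n := fun n => ediam_thickening_le (e n)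
  have hVδ : ∀ n, ediam (V n) ≤ ENNReal.ofReal δ := by
    intro n
    refine (hVd n).trans ((add_le_add (ht2 n) (heb n)).trans (le_of_eq ?_))
    rw [← ENNReal.ofReal_add (by linarith) (by linarith)]; congr 1; ring
  have hVt : ∀ n, ediam (V n) ≠ ⊤ := fun n => ne_top_of_le_ne_top ofReal_ne_top (hVδ n)
  have hcov : Γ ⊆ ⋃ n, V n := ht1.trans (iUnion_mono fun n => self_subset_thickening (by exact_mod_cast he0 n) _)
  obtain ⟨I, hI⟩ := hc.elim_finite_subcover V (fun n => isOpen_thickening) hcov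
  let I' := I.filter (fun n => (V n ∩ Γ).Nonempty)
  refine ⟨I', inferInstance, fun i => V i, fun i => (ediam (V i)).toReal, fun i => isOpen_thickening, ?_, ?_, ?_, ?_, ?_, ?_⟩
  · intro i; exact (Finset.mem_filter.1 i.2).2
  · intro x hx
    obtain ⟨n, hn, hxn⟩ := mem_iUnion₂.1 (hI hx)
    exact mem_iUnion.2 ⟨⟨n, Finset.mem_filter.2 ⟨hn, x, hxn, hx⟩⟩, hxn⟩
  · intro i; exact ENNReal.toReal_nonneg
  · intro i; exact ENNReal.toReal_le_of_le_ofReal hδ.le (hVδ i)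
  · intro i p hp q hq
    rw [dist_edist]
    exact ENNReal.toReal_mono (hVt i) (edist_le_ediam_of_mem hp hq)
  · show ∑ i : I', (ediam (V i)).toReal ≤ _
    rw [Finset.sum_coe_sort I' (fun n => (ediam (V n)).toReal), ← ENNReal.toReal_sum (fun i _ => hVt i)]
    have : ∑ n ∈ I', ediam (V n) ≤ μH[1] Γ + ENNReal.ofReal ε := by
      calc ∑ n ∈ I', ediam (V n) ≤ ∑ n ∈ I', ((⨆ _ : (t n).Nonempty, ediam (t n) ^ (1:ℝ)) + 2 * e n) := by
            refine Finset.sum_le_sum fun n hn => ?_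
            have hne : (t n).Nonempty := by
              obtain ⟨x, hx, -⟩ := (Finset.mem_filter.1 hn).2
              obtain ⟨y, hy, -⟩ := mem_thickening_iff.1 hx
              exact ⟨y, hy⟩
            simp only [hne, iSup_pos, ENNReal.rpow_one]
            exact hVd n
        _ = ∑ n ∈ I', (⨆ _ : (t n).Nonempty, ediam (t n) ^ (1:ℝ)) + 2 * ∑ n ∈ I', (e n : ℝ≥0∞) := by
            rw [Finset.sum_add_distrib, Finset.mul_sum]
        _ ≤ (μH[1] Γ + ENNReal.ofReal (ε/2)) + 2 * ENNReal.ofReal (ε/4) := by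
            gcongr
            · exact (ENNReal.sum_le_tsum _).trans ht3.le
            · exact (ENNReal.sum_le_tsum _).trans (he.le.trans (ENNReal.ofReal_le_ofReal (by have := min_le_left ε δ; linarith)))
        _ = _ := by
            have : (2 : ℝ≥0∞) * ENNReal.ofReal (ε/4) = ENNReal.ofReal (ε/2) := by
              rw [show ε/2 = 2 * (ε/4) by ring, ENNReal.ofReal_mul (by norm_num)]; simp
            rw [this, add_assoc, ← ENNReal.ofReal_add (by linarith) (by linarith)]; congr 2; ring
    calc _ ≤ (μH[1] Γ + ENNReal.ofReal ε).toReal := ENNReal.toReal_mono (by simp [hH.ne]) this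
      _ = _ := by rw [ENNReal.toReal_add hH.ne ofReal_ne_top, ENNReal.toReal_ofReal hε.le]

/-- cluster lemma -/
lemma cluster_lemma {Γ : Set E2} (hcl : IsClosed Γ) {M0 : ℕ}
    (hP : ∀ (M : ℕ) (S : Fin M → Set E2), (∀ j, IsClosed (S j)) → (∀ j, (S j).Nonempty) →
      (∀ i j, i ≠ j → Disjoint (S i) (S j)) → Γ = ⋃ j, S j → M ≤ M0)
    {ι : Type} [Fintype ι] {U : ι → Set E2} (hU : ∀ i, IsOpen (U i)) (hne : ∀ i, (U i ∩ Γ).Nonempty)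
    (hcov : Γ ⊆ ⋃ i, U i) (T : Finset ι)
    (hT : ∀ i ∈ T, ∀ j ∈ T, Relation.ReflTransGen (fun i j => (U i ∩ U j ∩ Γ).Nonempty) i j → i = j) :
    T.card ≤ M0 := by
  classical
  set adj : ι → ι → Prop := fun i j => (U i ∩ U j ∩ Γ).Nonempty with hadj
  haveI : Std.Symm adj := ⟨by
    intro i j h; simp only [adj] at h ⊢; rwa [inter_comm (U j)]⟩
  have hsym : ∀ {i j}, Relation.ReflTransGen adj i j → Relation.ReflTransGen adj j i :=
    fun {i j} h => (Relation.ReflTransGen.stdSymm (r := adj)).symm i j h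
  let st : Setoid ι := ⟨Relation.ReflTransGen adj, fun _ => Relation.ReflTransGen.refl, fun h => hsym h, fun h1 h2 => h1.trans h2⟩
  let Q := Quotient st
  let S : Q → Set E2 := fun c => Γ ∩ ⋃ i ∈ {i : ι | (Quotient.mk st i) = c}, U i
  have hS' : ∀ c, S c = Γ ∩ (⋃ i ∈ {i : ι | (Quotient.mk st i) ≠ c}, U i)ᶜ := by
    intro c
    ext x
    constructor
    · rintro ⟨hx, hx2⟩
      refine ⟨hx, fun hx3 => ?_⟩
      obtain ⟨i, hi, hxi⟩ := mem_iUnion₂.1 hx2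
      obtain ⟨j, hj, hxj⟩ := mem_iUnion₂.1 hx3
      apply hj
      rw [← hi]
      exact Quotient.sound (s := st) (Relation.ReflTransGen.single (show adj j i from ⟨x, ⟨hxj, hxi⟩, hx⟩))
    · rintro ⟨hx, hx2⟩
      refine ⟨hx, ?_⟩
      obtain ⟨i, hi⟩ := mem_iUnion.1 (hcov hx)
      refine mem_iUnion₂.2 ⟨i, ?_, hi⟩
      by_contra h
      exact hx2 (mem_iUnion₂.2 ⟨i, h, hi⟩)
  have hQ : Fintype.card Q ≤ M0 := by
    let e := Fintype.equivFin Q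
    refine hP _ (fun j => S (e.symm j)) ?_ ?_ ?_ ?_
    · intro j
      show IsClosed (S (e.symm j))
      rw [hS']
      exact hcl.inter (isOpen_biUnion fun i _ => hU i).isClosed_compl
    · intro j
      obtain ⟨i, hi⟩ := Quotient.exists_rep (e.symm j)
      obtain ⟨x, hx, hxG⟩ := hne i
      exact ⟨x, hxG, mem_iUnion₂.2 ⟨i, hi, hx⟩⟩
    · intro i j hij
      show Disjoint (S (e.symm i)) (S (e.symm j))
      rw [Set.disjoint_left]
      intro x hx hx'
      rw [hS'] at hx'
      obtain ⟨l, hl, hxl⟩ := mem_iUnion₂.1 hx.2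
      refine hx'.2 (mem_iUnion₂.2 ⟨l, ?_, hxl⟩)
      intro h
      exact hij (e.symm.injective (hl.symm.trans h))
    · ext x
      constructor
      · intro hx
        obtain ⟨i, hi⟩ := mem_iUnion.1 (hcov hx)
        refine mem_iUnion.2 ⟨e (Quotient.mk st i), hx, mem_iUnion₂.2 ⟨i, ?_, hi⟩⟩
        simp
      · intro hx
        obtain ⟨j, hj⟩ := mem_iUnion.1 hx
        exact hj.1
  refine le_trans ?_ hQ
  rw [← Finset.card_univ]
  refine Finset.card_le_card_of_injOn (fun i => (Quotient.mk st i : Q)) (fun _ _ => Finset.mem_univ _) ?_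
  intro i hi j hj hij
  exact hT i hi j hj (Quotient.exact (s := st) hij)

end


section

noncomputable def muB (r : ℝ) (S : Finset E2) : ℝ := (volume (⋃ p ∈ S, ball p r)).toReal

lemma muB_fin (r : ℝ) (S : Finset E2) : volume (⋃ p ∈ S, ball p r) ≠ ⊤ := by
  refine ne_top_of_le_ne_top ?_ (measure_biUnion_finset_le S _)
  exact ENNReal.sum_ne_top.2 fun p _ => measure_ball_lt_top.ne

lemma muB_insert [DecidableEq E2] {r : ℝ} (hr : 0 ≤ r) {S : Finset E2} {p z : E2} (hp : p ∈ S) {d : ℝ} (hd : dist z p ≤ d) :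
    muB r (insert z S) ≤ muB r S + 2 * r * d := by
  have hd0 : 0 ≤ d := dist_nonneg.trans hd
  have h1 : (⋃ q ∈ insert z S, ball q r) ⊆ (⋃ q ∈ S, ball q r) ∪ (ball z r \ ball p r) := by
    intro x hx
    by_cases hxp : x ∈ ball p r
    · exact Or.inl (mem_iUnion₂.2 ⟨p, hp, hxp⟩)
    · obtain ⟨q, hq, hxq⟩ := mem_iUnion₂.1 hx
      rcases Finset.mem_insert.1 hq with rfl | hq
      · exact Or.inr ⟨hxq, hxp⟩
      · exact Or.inl (mem_iUnion₂.2 ⟨q, hq, hxq⟩)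
  have h2 : volume (⋃ q ∈ insert z S, ball q r) ≤ volume (⋃ q ∈ S, ball q r) + ENNReal.ofReal (2 * r * d) :=
    (measure_mono h1).trans ((measure_union_le _ _).trans (by
      gcongr
      exact (lune_E p z hr).trans (ENNReal.ofReal_le_ofReal (by gcongr))))
  have h3 := ENNReal.toReal_mono (ENNReal.add_ne_top.2 ⟨muB_fin r S, ofReal_ne_top⟩) h2
  rwa [ENNReal.toReal_add (muB_fin r S) ofReal_ne_top, ENNReal.toReal_ofReal (by positivity)] at h3

lemma muB_insert' [DecidableEq E2] {r : ℝ} (hr : 0 ≤ r) {S : Finset E2} {z : E2} :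
    muB r (insert z S) ≤ muB r S + Real.pi * r ^ 2 := by
  have h2 : volume (⋃ q ∈ insert z S, ball q r) ≤ volume (⋃ q ∈ S, ball q r) + volume (ball z r) := by
    rw [Finset.set_biUnion_insert, union_comm]
    exact measure_union_le _ _
  have h3 := ENNReal.toReal_mono (ENNReal.add_ne_top.2 ⟨muB_fin r S, measure_ball_lt_top.ne⟩) h2
  rwa [ENNReal.toReal_add (muB_fin r S) measure_ball_lt_top.ne, vol_ball_E z hr] at h3

def layer {ι : Type} (adj : ι → ι → Prop) (J : Set ι) : ℕ → Set ι
  | 0 => J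
  | n+1 => layer adj J n ∪ {i | ∃ i' ∈ layer adj J n, adj i' i}

lemma layer_reach {ι : Type} {adj : ι → ι → Prop} {J : Set ι} {j i : ι} (hj : j ∈ J)
    (h : Relation.ReflTransGen adj j i) : ∃ n, i ∈ layer adj J n := by
  induction h with
  | refl => exact ⟨0, hj⟩
  | tail _ h2 ih =>
    obtain ⟨n, hn⟩ := ih
    exact ⟨n + 1, Or.inr ⟨_, hn, h2⟩⟩

lemma layer_claim {ι : Type} [DecidableEq ι] [DecidableEq E2] {Γ : Set E2} {U : ι → Set E2} {d : ι → ℝ} {δ r : ℝ} (hr : 0 ≤ r)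
    (hd : ∀ i, d i ≤ δ) (hdiam : ∀ i, ∀ p ∈ U i, ∀ q ∈ U i, dist p q ≤ d i)
    (S : Finset E2) (J : Finset ι) (hinv : ∀ j ∈ J, ∃ p ∈ S, p ∈ U j) (n : ℕ) :
    ∀ i ∈ layer (fun i j => (U i ∩ U j ∩ Γ).Nonempty) (J : Set ι) n, ∀ z ∈ U i,
      ∃ (S' : Finset E2) (J' : Finset ι), S ⊆ S' ∧ J ⊆ J' ∧ (J' : Set ι) ⊆ layer (fun i j => (U i ∩ U j ∩ Γ).Nonempty) (J : Set ι) n ∧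
        (∀ j ∈ J', ∃ p ∈ S', p ∈ U j) ∧ z ∈ S' ∧
        muB r S' + 2 * r * ∑ j ∈ J, d j ≤ muB r S + 2 * r * ∑ j ∈ J', d j + 2 * r * δ := by
  induction n with
  | zero =>
    intro i hi z hz
    obtain ⟨p, hp, hpU⟩ := hinv i hi
    refine ⟨insert z S, J, Finset.subset_insert _ _, subset_rfl, subset_rfl, ?_, Finset.mem_insert_self _ _, ?_⟩
    · intro j hj
      obtain ⟨p, hp, hpU⟩ := hinv j hj
      exact ⟨p, Finset.mem_insert_of_mem hp, hpU⟩
    · have := muB_insert hr hp ((hdiam i z hz p hpU).trans (hd i))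
      linarith
  | succ n ih =>
    intro i hi z hz
    by_cases hin : i ∈ layer (fun i j => (U i ∩ U j ∩ Γ).Nonempty) (J : Set ι) n
    · obtain ⟨S', J', h1, h2, h3, h4, h5, h6⟩ := ih i hin z hz
      exact ⟨S', J', h1, h2, h3.trans subset_union_left, h4, h5, h6⟩
    · rcases hi with hi | ⟨i', hi', q, ⟨hq1, hq2⟩, hqG⟩
      · exact absurd hi hin
      obtain ⟨S', J', h1, h2, h3, h4, h5, h6⟩ := ih i' hi' q hq1
      have hiJ' : i ∉ J' := fun h => hin (h3 h)
      refine ⟨insert z S', insert i J', h1.trans (Finset.subset_insert _ _), h2.trans (Finset.subset_insert _ _), ?_, ?_, Finset.mem_insert_self _ _, ?_⟩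
      · intro j hj
        rcases Finset.mem_insert.1 hj with rfl | hj
        · exact Or.inr ⟨i', hi', q, ⟨hq1, hq2⟩, hqG⟩
        · exact Or.inl (h3 hj)
      · intro j hj
        rcases Finset.mem_insert.1 hj with rfl | hj
        · exact ⟨z, Finset.mem_insert_self _ _, hz⟩
        · obtain ⟨p, hp, hpU⟩ := h4 j hj
          exact ⟨p, Finset.mem_insert_of_mem hp, hpU⟩
      · have := muB_insert hr h5 (hdiam i z hz q hq2)
        rw [Finset.sum_insert hiJ']
        linarith

lemma net_claim {ι : Type} [DecidableEq ι] [DecidableEq E2] {Γ : Set E2} {U : ι → Set E2} {d : ι → ℝ} {δ r : ℝ} (hr : 0 ≤ r)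
    (hd0 : ∀ i, 0 ≤ d i) (hd : ∀ i, d i ≤ δ) (hdiam : ∀ i, ∀ p ∈ U i, ∀ q ∈ U i, dist p q ≤ d i)
    (hcov : Γ ⊆ ⋃ i, U i) (Z : Finset E2) (hZ : (Z : Set E2) ⊆ Γ) :
    ∃ (S : Finset E2) (J T : Finset ι), Z ⊆ S ∧ (∀ j ∈ J, ∃ p ∈ S, p ∈ U j) ∧ T ⊆ J ∧
      (∀ i ∈ T, ∀ j ∈ T, Relation.ReflTransGen (fun i j => (U i ∩ U j ∩ Γ).Nonempty) i j → i = j) ∧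
      muB r S ≤ 2 * r * (∑ j ∈ J, d j + Z.card * δ) + Real.pi * r ^ 2 * T.card := by
  set adj : ι → ι → Prop := fun i j => (U i ∩ U j ∩ Γ).Nonempty with hadj
  have : Std.Symm adj := ⟨by
    intro i j h; simp only [adj] at h ⊢; rwa [inter_comm (U j)]⟩
  have hsym : ∀ {i j}, Relation.ReflTransGen adj i j → Relation.ReflTransGen adj j i :=
    fun {i j} h => (Relation.ReflTransGen.stdSymm (r := adj)).symm i j h
  induction Z using Finset.induction_on with
  | empty => exact ⟨∅, ∅, ∅, by simp, by simp, by simp, by simp, by simp [muB]⟩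
  | insert z Z hz ih =>
    obtain ⟨S, J, T, h1, h2, h3, h4, h5⟩ := ih (fun x hx => hZ (by simp at hx ⊢; exact Or.inr hx))
    obtain ⟨i, hi⟩ := mem_iUnion.1 (hcov (hZ (by simp : z ∈ ((insert z Z : Finset E2) : Set E2))))
    have hδ : 0 ≤ δ := (hd0 i).trans (hd i)
    rw [Finset.card_insert_of_notMem hz]
    push_cast
    by_cases hreach : ∃ j ∈ J, Relation.ReflTransGen adj j i
    · obtain ⟨j, hj, hji⟩ := hreach
      obtain ⟨n, hn⟩ := layer_reach (J := (J : Set ι)) hj hji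
      obtain ⟨S', J', g1, g2, g3, g4, g5, g6⟩ := layer_claim (Γ := Γ) hr hd hdiam S J h2 n i hn z hi
      refine ⟨S', J', T, ?_, g4, h3.trans g2, h4, by linarith⟩
      exact Finset.insert_subset g5 (h1.trans g1)
    · push Not at hreach
      have hiJ : i ∉ J := fun h => hreach i h Relation.ReflTransGen.refl
      have hiT : i ∉ T := fun h => hiJ (h3 h)
      refine ⟨insert z S, insert i J, insert i T, Finset.insert_subset_insert _ h1, ?_, Finset.insert_subset_insert _ h3, ?_, ?_⟩
      · intro j hj
        rcases Finset.mem_insert.1 hj with rfl | hj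
        · exact ⟨z, Finset.mem_insert_self _ _, hi⟩
        · obtain ⟨p, hp, hpU⟩ := h2 j hj
          exact ⟨p, Finset.mem_insert_of_mem hp, hpU⟩
      · intro a ha b hb hab
        rcases Finset.mem_insert.1 ha with ha | ha <;> rcases Finset.mem_insert.1 hb with hb | hb
        · rw [ha, hb]
        · rw [ha] at hab; exact absurd (hsym hab) (hreach b (h3 hb))
        · rw [hb] at hab; exact absurd hab (hreach a (h3 ha))
        · exact h4 a ha b hb hab
      · have := muB_insert' hr (S := S) (z := z)
        rw [Finset.sum_insert hiJ, Finset.card_insert_of_notMem hiT]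
        push_cast
        have a1 : 0 ≤ 2 * r * d i := by have := hd0 i; positivity
        have a2 : 0 ≤ 2 * r * δ := by positivity
        linarith

lemma thick_bound {Γ : Set E2} (hc : IsCompact Γ) (hH : μH[1] Γ < ⊤) {M0 : ℕ}
    (hP : ∀ (M : ℕ) (S : Fin M → Set E2), (∀ j, IsClosed (S j)) → (∀ j, (S j).Nonempty) →
      (∀ i j, i ≠ j → Disjoint (S i) (S j)) → Γ = ⋃ j, S j → M ≤ M0) {s : ℝ} (hs : 0 ≤ s) :
    (volume (thickening s Γ)).toReal ≤ 2 * s * (μH[1] Γ).toReal + Real.pi * s ^ 2 * M0 := by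
  classical
  set H := (μH[1] Γ).toReal
  have key : ∀ ε > 0, (volume (thickening s Γ)).toReal ≤ 2 * (s + ε) * (H + 2 * ε) + Real.pi * (s + ε) ^ 2 * M0 := by
    intro ε hε
    obtain ⟨n, x, -, hx, hxc⟩ := exists_net hc hε
    let Z : Finset E2 := Finset.univ.image x
    have hZ : (Z : Set E2) ⊆ Γ := by
      intro y hy
      obtain ⟨i, -, rfl⟩ := Finset.mem_image.1 hy
      exact hx i
    obtain ⟨ι, _, U, d, hU, hne, hcov, hd0, hd, hdiam, hsum⟩ :=
      cover_lemma hc hH hε (δ := ε / (Z.card + 1)) (by positivity)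
    have hr : 0 ≤ s + ε := by linarith
    obtain ⟨S, J, T, h1, h2, h3, h4, h5⟩ := net_claim hr hd0 hd hdiam hcov Z hZ
    have hT := cluster_lemma hc.isClosed hP hU hne hcov T h4
    have hsub : thickening s Γ ⊆ ⋃ p ∈ S, ball p (s + ε) := by
      intro y hy
      obtain ⟨q, hq, hyq⟩ := mem_thickening_iff.1 hy
      obtain ⟨i, hi⟩ := mem_iUnion.1 (hxc hq)
      refine mem_iUnion₂.2 ⟨x i, h1 (Finset.mem_image_of_mem _ (Finset.mem_univ _)), ?_⟩
      rw [mem_ball] at hi ⊢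
      exact (dist_triangle _ q _).trans_lt (by linarith)
    have h6 := ENNReal.toReal_mono (muB_fin (s + ε) S) (measure_mono (μ := volume) hsub)
    have h7 : ∑ j ∈ J, d j ≤ H + ε :=
      (Finset.sum_le_sum_of_subset_of_nonneg (Finset.subset_univ J) (fun i _ _ => hd0 i)).trans hsum
    have h8 : (Z.card : ℝ) * (ε / (Z.card + 1)) ≤ ε := by
      rw [mul_div_assoc', _root_.div_le_iff₀ (by positivity)]
      nlinarith
    have h9 : (T.card : ℝ) ≤ M0 := by exact_mod_cast hT
    calc _ ≤ _ := h6
      _ ≤ _ := h5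
      _ ≤ _ := by
        have h10 : ∑ j ∈ J, d j + Z.card * (ε / (Z.card + 1)) ≤ H + 2 * ε := by linarith
        gcongr
  have hlim : Tendsto (fun ε : ℝ => 2 * (s + ε) * (H + 2 * ε) + Real.pi * (s + ε) ^ 2 * M0) (𝓝[>] 0)
      (𝓝 (2 * (s + 0) * (H + 2 * 0) + Real.pi * (s + 0) ^ 2 * M0)) := by
    apply Tendsto.mono_left _ nhdsWithin_le_nhds
    apply Continuous.tendsto
    fun_prop
  simp only [add_zero, mul_zero] at hlim
  exact ge_of_tendsto hlim (by filter_upwards [self_mem_nhdsWithin] with ε hε using key ε hε)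

end


section

lemma divg_cont {φ : E2 → E2} (hφ : ContDiff ℝ 1 φ) : Continuous (divg φ) := by
  have h := hφ.continuous_fderiv (by simp)
  unfold divg
  fun_prop

lemma divg_supp {φ : E2 → E2} (hc : HasCompactSupport φ) : HasCompactSupport (divg φ) := by
  have h := hc.fderiv (𝕜 := ℝ)
  refine h.mono ?_
  intro x hx
  rw [Function.mem_support] at hx ⊢
  intro h0
  apply hx
  simp [divg, h0]

lemma ibp {w : E2 → ℝ} {C : NNReal} (hw : LipschitzWith C w) {φ : E2 → E2} (hφ : ContDiff ℝ 1 φ) (hc : HasCompactSupport φ) :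
    ∫ x, divg φ x * w x = - ∫ x, fderiv ℝ w x (φ x) := by
  have hcomp : ∀ i, ContDiff ℝ 1 (fun x => φ x i) := fun i => by fun_prop
  have hcs : ∀ i, HasCompactSupport (fun x => φ x i) := fun i => by
    refine hc.mono ?_
    intro x hx
    rw [Function.mem_support] at hx ⊢
    intro h0; apply hx; simp [h0]
  have hfd : ∀ i x, fderiv ℝ (fun x => φ x i) x = (EuclideanSpace.proj i : E2 →L[ℝ] ℝ) ∘L fderiv ℝ φ x := by
    intro i x
    have h1 : HasFDerivAt φ (fderiv ℝ φ x) x := (hφ.differentiable (by simp) x).hasFDerivAt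
    exact ((EuclideanSpace.proj i : E2 →L[ℝ] ℝ).hasFDerivAt.comp x h1).fderiv
  have key : ∀ i : Fin 2, ∫ x, lineDeriv ℝ w x (EuclideanSpace.single i 1) * φ x i =
      - ∫ x, fderiv ℝ φ x (EuclideanSpace.single i 1) i * w x := by
    intro i
    obtain ⟨D, hD⟩ := ContDiff.lipschitzWith_of_hasCompactSupport (hcs i) (hcomp i) (by simp)
    rw [hw.integral_lineDeriv_mul_eq hD (hcs i), ← integral_neg]
    congr 1
    ext x
    rw [(((hcomp i).differentiable (by simp)) x).lineDeriv_eq_fderiv, map_neg, hfd]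
    simp
  have hIntg1 : ∀ i : Fin 2, Integrable (fun x => lineDeriv ℝ w x (EuclideanSpace.single i 1) * φ x i) := by
    intro i
    have := ((hcomp i).continuous.integrable_of_hasCompactSupport (μ := volume) (hcs i)).smul_of_top_right
      (hw.memLp_lineDeriv (μ := volume) (EuclideanSpace.single i 1))
    refine this.congr (Eventually.of_forall fun x => ?_)
    simp
  have hIntg2 : ∀ i : Fin 2, Integrable (fun x => fderiv ℝ φ x (EuclideanSpace.single i 1) i * w x) := by
    intro i
    have hf := hφ.continuous_fderiv (by simp)
    apply Continuous.integrable_of_hasCompactSupport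
    · have := hw.continuous
      fun_prop
    · refine (hc.fderiv (𝕜 := ℝ)).mono ?_
      intro x hx
      rw [Function.mem_support] at hx ⊢
      intro h0; apply hx; simp [h0]
  have e1 : ∫ x, divg φ x * w x = ∑ i : Fin 2, ∫ x, fderiv ℝ φ x (EuclideanSpace.single i 1) i * w x := by
    rw [← integral_finsetSum _ (fun i _ => hIntg2 i)]
    simp only [divg, Finset.sum_mul]
  have e2 : ∫ x, fderiv ℝ w x (φ x) = ∑ i : Fin 2, ∫ x, lineDeriv ℝ w x (EuclideanSpace.single i 1) * φ x i := by
    rw [← integral_finsetSum _ (fun i _ => hIntg1 i)]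
    apply integral_congr_ae
    filter_upwards [hw.ae_differentiableAt (μ := volume)] with x hx
    simp only [hx.lineDeriv_eq_fderiv]
    have : φ x = ∑ i : Fin 2, φ x i • (EuclideanSpace.single i 1 : E2) := by
      ext j; fin_cases j <;> simp
    conv_lhs => rw [this]
    simp [mul_comm]
  rw [e1, e2, Finset.sum_congr rfl (fun i _ => key i)]
  simp

/-- the exterior shell estimate -/
lemma shell_bound {Ω : Set E2} (hne : Ω.Nonempty) {φ : E2 → E2} (hφ : ContDiff ℝ 1 φ) (hc : HasCompactSupport φ)
    (hn : ∀ x, ‖φ x‖ ≤ 1) {C : ℝ} (hC : ∀ x, |divg φ x| ≤ C) {s : ℝ} (hs : 0 < s)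
    (hfin : volume {x | 0 < infDist x Ω ∧ infDist x Ω < s} ≠ ⊤) :
    s * ∫ x in closure Ω, divg φ x ≤ (1 + s * C) * (volume {x | 0 < infDist x Ω ∧ infDist x Ω < s}).toReal := by
  set A := {x | 0 < infDist x Ω ∧ infDist x Ω < s} with hA
  have hgc : Continuous (fun x => infDist x Ω) := continuous_infDist_pt _
  have hAm : MeasurableSet A :=
    ((isOpen_lt continuous_const hgc).inter (isOpen_lt hgc continuous_const)).measurableSet
  set w : E2 → ℝ := fun x => max 0 (1 - s⁻¹ * infDist x Ω) with hw
  have hwl : LipschitzWith (Real.toNNReal s⁻¹) w := by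
    have h1 : LipschitzWith (Real.toNNReal s⁻¹) (fun x => 1 - s⁻¹ * infDist x Ω) := by
      refine LipschitzWith.of_dist_le_mul fun x y => ?_
      rw [Real.coe_toNNReal _ (by positivity), Real.dist_eq]
      have := (lipschitz_infDist_pt Ω).dist_le_mul x y
      rw [NNReal.coe_one, one_mul, Real.dist_eq, abs_sub_comm] at this
      rw [show 1 - s⁻¹ * infDist x Ω - (1 - s⁻¹ * infDist y Ω) = s⁻¹ * (infDist y Ω - infDist x Ω) by ring, abs_mul,
        abs_of_pos (inv_pos.2 hs)]
      gcongr
    exact h1.const_max 0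
  have hw0 : ∀ x, 0 ≤ w x := fun x => le_max_left _ _
  have hw1 : ∀ x, w x ≤ 1 := fun x => max_le zero_le_one (by
    have := infDist_nonneg (x := x) (s := Ω)
    have : 0 ≤ s⁻¹ * infDist x Ω := by positivity
    linarith)
  have hfd : ∀ x, x ∉ A → fderiv ℝ w x = 0 := by
    intro x hx
    by_cases h0 : 0 < infDist x Ω
    · have h1 : s ≤ infDist x Ω := by
        by_contra h; exact hx ⟨h0, not_le.1 h⟩
      have : w x = 0 := by
        apply max_eq_left
        have : 1 ≤ s⁻¹ * infDist x Ω := by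
          rw [inv_mul_eq_div, _root_.le_div_iff₀ hs]; linarith
        linarith
      apply IsLocalMin.fderiv_eq_zero
      exact Eventually.of_forall fun y => by rw [this]; exact hw0 y
    · have h1 : infDist x Ω = 0 := le_antisymm (not_lt.1 h0) infDist_nonneg
      have : w x = 1 := by simp [hw, h1]
      apply IsLocalMax.fderiv_eq_zero
      exact Eventually.of_forall fun y => by rw [this]; exact hw1 y
  have b1 : ∫ x, divg φ x * w x ≤ s⁻¹ * (volume A).toReal := by
    rw [ibp hwl hφ hc]
    refine (neg_le_abs _).trans ?_
    rw [← Real.norm_eq_abs]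
    have hi : Integrable (A.indicator (fun _ => s⁻¹)) (volume : Measure E2) :=
      (integrable_indicator_iff hAm).2 (integrableOn_const hfin)
    refine (norm_integral_le_of_norm_le hi (Eventually.of_forall fun x => ?_)).trans (le_of_eq ?_)
    · by_cases hx : x ∈ A
      · rw [indicator_of_mem hx]
        refine (ContinuousLinearMap.le_opNorm _ _).trans ?_
        have := norm_fderiv_le_of_lipschitz ℝ hwl (x₀ := x)
        rw [Real.coe_toNNReal _ (by positivity)] at this
        calc _ ≤ s⁻¹ * 1 := by gcongr; exact hn x
          _ = _ := mul_one _
      · rw [indicator_of_notMem hx, hfd x hx]; simp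
    · rw [integral_indicator hAm, setIntegral_const, smul_eq_mul, mul_comm]; rfl
  have hdi : Integrable (divg φ) (volume : Measure E2) := (divg_cont hφ).integrable_of_hasCompactSupport (divg_supp hc)
  have b2 : (∫ x in closure Ω, divg φ x) - C * (volume A).toReal ≤ ∫ x, divg φ x * w x := by
    have hi : Integrable (A.indicator (fun _ => C)) (volume : Measure E2) :=
      (integrable_indicator_iff hAm).2 (integrableOn_const hfin)
    have e1 : C * (volume A).toReal = ∫ x, A.indicator (fun _ => C) x := by
      rw [integral_indicator hAm, setIntegral_const, smul_eq_mul, mul_comm]; rfl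
    rw [e1, ← integral_indicator isClosed_closure.measurableSet, ← integral_sub (hdi.indicator isClosed_closure.measurableSet) hi]
    refine integral_mono ((hdi.indicator isClosed_closure.measurableSet).sub hi) ?_ ?_
    · apply Continuous.integrable_of_hasCompactSupport
      · exact (divg_cont hφ).mul hwl.continuous
      · exact (divg_supp hc).mul_right
    · intro x
      simp only
      by_cases hx : x ∈ closure Ω
      · have h0 : infDist x Ω = 0 := (mem_closure_iff_infDist_zero hne).1 hx
        have hxA : x ∉ A := fun h => by have := h.1; linarith
        have : w x = 1 := by simp [hw, h0]
        rw [indicator_of_mem hx, indicator_of_notMem hxA, this]; simp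
      · have h0 : 0 < infDist x Ω := lt_of_le_of_ne infDist_nonneg (fun h => hx ((mem_closure_iff_infDist_zero hne).2 h.symm))
        rw [indicator_of_notMem hx]
        by_cases hxA : x ∈ A
        · rw [indicator_of_mem hxA]
          have h1 := abs_le.1 (hC x)
          have h2 := hw0 x
          have h3 := hw1 x
          have hC0 : 0 ≤ C := (abs_nonneg _).trans (hC x)
          nlinarith
        · rw [indicator_of_notMem hxA]
          have h1 : s ≤ infDist x Ω := by
            by_contra h; exact hxA ⟨h0, not_le.1 h⟩
          have : w x = 0 := by
            apply max_eq_left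
            have : 1 ≤ s⁻¹ * infDist x Ω := by
              rw [inv_mul_eq_div, _root_.le_div_iff₀ hs]; linarith
            linarith
          rw [this]; simp
  have b3 : (∫ x in closure Ω, divg φ x) ≤ (s⁻¹ + C) * (volume A).toReal := by linarith
  calc _ ≤ s * ((s⁻¹ + C) * (volume A).toReal) := by gcongr
    _ = _ := by field_simp

lemma AR_small {Ω : Set E2} (hne : Ω.Nonempty) (ho : IsOpen Ω) (hb : IsBounded Ω) (hG : (frontier Ω).Nonempty) {H K : ℝ} (hH : 0 ≤ H) (hK : 0 ≤ K)
    (hth : ∀ s ≥ 0, (volume (thickening s (frontier Ω))).toReal ≤ 2 * s * H + K * s ^ 2)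
    {φ : E2 → E2} (hφ : ContDiff ℝ 1 φ) (hc : HasCompactSupport φ) (hn : ∀ x, ‖φ x‖ ≤ 1) :
    ∀ ε > 0, ∀ᶠ s in 𝓝[>] (0:ℝ), AR Ω s ≤ ((2 * H - ∫ x in Ω, divg φ x) + ε) * s := by
  intro ε hε
  set Γ := frontier Ω
  have hGb : IsBounded Γ := hb.closure.subset frontier_subset_closure
  have htf : ∀ s, volume (thickening s Γ) ≠ ⊤ := fun s => (hGb.thickening (δ := s)).measure_lt_top.ne
  have hG0 : volume Γ = 0 := by
    by_contra h
    have hGf : volume Γ ≠ ⊤ := hGb.measure_lt_top.ne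
    have hpos : 0 < (volume Γ).toReal := ENNReal.toReal_pos h hGf
    have hle : ∀ᶠ s in 𝓝[>] (0:ℝ), (volume Γ).toReal ≤ 2 * s * H + K * s ^ 2 := by
      filter_upwards [self_mem_nhdsWithin] with s hs
      exact (ENNReal.toReal_mono (htf s) (measure_mono (self_subset_thickening hs Γ))).trans (hth s (le_of_lt hs))
    have hlim : Tendsto (fun s : ℝ => 2 * s * H + K * s ^ 2) (𝓝[>] 0) (𝓝 (2 * 0 * H + K * 0 ^ 2)) :=
      Tendsto.mono_left (Continuous.tendsto (by fun_prop) _) nhdsWithin_le_nhds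
    have := ge_of_tendsto hlim hle
    norm_num at this
    linarith
  have hI : ∫ x in closure Ω, divg φ x = ∫ x in Ω, divg φ x := by
    apply setIntegral_congr_set
    rw [closure_eq_self_union_frontier]
    exact union_ae_eq_left_of_ae_eq_empty (ae_eq_empty.2 hG0)
  set I := ∫ x in Ω, divg φ x
  obtain ⟨C, hC⟩ := (divg_cont hφ).bounded_above_of_compact_support (divg_supp hc)
  have hC' : ∀ x, |divg φ x| ≤ C := fun x => hC x
  have hC0 : 0 ≤ C := (abs_nonneg _).trans (hC' 0)
  have main : ∀ s > 0, AR Ω s ≤ (2 * H - I) * s + s * (K * s + C * (2 * s * H + K * s ^ 2)) := by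
    intro s hs
    set A := {x | 0 < infDist x Ω ∧ infDist x Ω < s}
    have hgc : Continuous (fun x => infDist x Ω) := continuous_infDist_pt _
    have hAm : MeasurableSet A :=
      ((isOpen_lt continuous_const hgc).inter (isOpen_lt hgc continuous_const)).measurableSet
    have hAsub : A ⊆ thickening s Γ := by
      rintro x ⟨hx0, hxs⟩
      obtain ⟨y, hy, hxy⟩ := (infDist_lt_iff hne).1 hxs
      have hxO : x ∉ Ω := fun h => by rw [infDist_zero_of_mem h] at hx0; exact lt_irrefl _ hx0
      obtain ⟨q, hq, hq2⟩ := frontier_between (Ω := Ωᶜ) (x := x) (y := y) hxO (by simpa using hy)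
      rw [frontier_compl] at hq
      exact mem_thickening_iff.2 ⟨q, hq, hq2.trans_lt hxy⟩
    have hBsub : {x | x ∈ Ω ∧ infDist x Γ < s} ⊆ thickening s Γ := by
      rintro x ⟨-, hx⟩
      exact (mem_thickening_iff_infDist_lt hG).2 hx
    have hdisj : Disjoint {x | x ∈ Ω ∧ infDist x Γ < s} A := by
      rw [Set.disjoint_left]
      rintro x ⟨hx, -⟩ ⟨hx0, -⟩
      rw [infDist_zero_of_mem hx] at hx0; exact lt_irrefl _ hx0
    have hAf : volume A ≠ ⊤ := ne_top_of_le_ne_top (htf s) (measure_mono hAsub)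
    have hBf : volume {x | x ∈ Ω ∧ infDist x Γ < s} ≠ ⊤ := ne_top_of_le_ne_top (htf s) (measure_mono hBsub)
    have h1 : AR Ω s + (volume A).toReal ≤ 2 * s * H + K * s ^ 2 := by
      refine le_trans ?_ (hth s hs.le)
      show (volume {x | x ∈ Ω ∧ infDist x Γ < s}).toReal + _ ≤ _
      rw [← ENNReal.toReal_add hBf hAf, ← measure_union hdisj hAm]
      exact ENNReal.toReal_mono (htf s) (measure_mono (union_subset hBsub hAsub))
    have h2 := shell_bound hne hφ hc hn hC' hs hAf
    rw [hI] at h2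
    have h3 : (volume A).toReal ≤ 2 * s * H + K * s ^ 2 := by have := AR_nonneg Ω s; linarith
    have h4 : s * C * (volume A).toReal ≤ s * C * (2 * s * H + K * s ^ 2) := by gcongr
    change s * I ≤ (1 + s * C) * (volume A).toReal at h2
    linarith
  have hlim : Tendsto (fun s : ℝ => K * s + C * (2 * s * H + K * s ^ 2)) (𝓝[>] 0) (𝓝 (K * 0 + C * (2 * 0 * H + K * 0 ^ 2))) :=
    Tendsto.mono_left (Continuous.tendsto (by fun_prop) _) nhdsWithin_le_nhds
  have hev : ∀ᶠ s in 𝓝[>] (0:ℝ), K * s + C * (2 * s * H + K * s ^ 2) < ε :=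
    hlim.eventually_lt_const (by norm_num; exact hε)
  filter_upwards [hev, self_mem_nhdsWithin] with s h1 h2
  have h2' : 0 < s := h2
  refine (main s h2').trans ?_
  nlinarith

end


section

lemma frontier_ne {Ω : Set E2} (hne : Ω.Nonempty) (hb : IsBounded Ω) : (frontier Ω).Nonempty := by
  obtain ⟨z, hz⟩ := hne
  obtain ⟨R, hR⟩ := hb.subset_ball z
  obtain ⟨p, hp⟩ := exists_pt_dist z (R := max R 0) (le_max_right _ _)
  have hpO : p ∉ Ω := fun h => by
    have := mem_ball.1 (hR h)
    have := le_max_left R 0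
    linarith
  obtain ⟨q, hq, -⟩ := frontier_between hz hpO
  exact ⟨q, hq⟩

lemma finite_case {Ω : Set E2} (ho : IsOpen Ω) (hb : IsBounded Ω) {k : ℕ} (hk : nBddCompLe Ωᶜ k) {a : ℕ}
    (O : Fin a → Set E2) (hO : ∀ α, IsPreconnected (O α)) (hOe : Ω = ⋃ α, O α) {z : E2} {ρ : ℝ}
    (hzO : z ∈ Ω) (hz : infDist z (frontier Ω) = ρ) (hmax : ∀ y ∈ Ω, infDist y (frontier Ω) ≤ ρ) (hρ : 0 < ρ)
    (hH : μH[1] (frontier Ω) < ⊤) {φ : E2 → E2} (hφ : ContDiff ℝ 1 φ) (hc : HasCompactSupport φ) (hn : ∀ x, ‖φ x‖ ≤ 1) :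
    (volume Ω).toReal ≤ ((2 * (μH[1] (frontier Ω)).toReal - ∫ x in Ω, divg φ x) + Real.pi * ((k:ℝ) - 1) * ρ) * ρ := by
  have hG := frontier_ne ⟨z, hzO⟩ hb
  have hGc : IsCompact (frontier Ω) :=
    Metric.isCompact_of_isClosed_isBounded isClosed_frontier (hb.closure.subset frontier_subset_closure)
  obtain ⟨R0, hR0⟩ := hb.subset_ball z
  set R := max R0 1
  have hR : 0 < R := lt_max_of_lt_right one_pos
  have hsub : Ω ⊆ ball z R := hR0.trans (ball_subset_ball (le_max_left _ _))
  obtain ⟨K0, Kl, h0, hl, heq, -⟩ := comps_decomp hR hsub hk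
  let C : Fin (k + 1 + 1) → Set E2 := Fin.cons {y : E2 | R ≤ dist y z} (Fin.cons K0 Kl)
  have hC : ∀ β, IsPreconnected (C β) := by
    intro β
    refine Fin.cases ?_ (fun β => ?_) β
    · exact ext_conn z R
    · refine Fin.cases ?_ (fun β => ?_) β
      · exact h0
      · exact hl β
  have hCe : Ωᶜ = ⋃ β, C β := by
    ext y
    rw [mem_iUnion, Fin.exists_fin_succ, Fin.exists_fin_succ]
    show y ∈ Ωᶜ ↔ R ≤ dist y z ∨ y ∈ K0 ∨ ∃ i, y ∈ Kl i
    have e : (y ∈ K0 ∨ ∃ i, y ∈ Kl i) ↔ y ∈ Ωᶜ ∩ closedBall z R := by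
      rw [heq, mem_union, mem_iUnion]
    rw [e]
    constructor
    · intro hy
      rcases le_total R (dist y z) with h | h
      · exact Or.inl h
      · exact Or.inr ⟨hy, h⟩
    · rintro (h | h)
      · intro hyO
        exact absurd (mem_ball.1 (hsub hyO)) (not_lt.2 h)
      · exact h.1
  have hP : ∀ (M : ℕ) (S : Fin M → Set E2), (∀ j, IsClosed (S j)) → (∀ j, (S j).Nonempty) →
      (∀ i j, i ≠ j → Disjoint (S i) (S j)) → frontier Ω = ⋃ j, S j → M ≤ a + (k + 1 + 1) :=
    fun M S h1 h2 h3 h4 => pieces_bound ho O C hO hC hOe hCe S h1 h2 h3 h4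
  refine halfA ho hb hk hzO hz hmax hρ (AR_small ⟨z, hzO⟩ ho hb hG ENNReal.toReal_nonneg
    (K := Real.pi * ((a + (k + 1 + 1) : ℕ) : ℝ)) (by positivity) (fun s hs => ?_) hφ hc hn)
  have := thick_bound hGc hH hP hs
  linarith

lemma sat_frontier {Ω W : Set E2} (ho : IsOpen Ω) (hW : W ⊆ Ω) (hWo : IsOpen W)
    (hsat : ∀ x ∈ W, connectedComponentIn Ω x ⊆ W) : frontier W ⊆ frontier Ω := by
  intro x hx
  rw [hWo.frontier_eq] at hx
  rw [ho.frontier_eq]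
  refine ⟨closure_mono hW hx.1, fun hxO => hx.2 ?_⟩
  obtain ⟨y, hy1, hy2⟩ := mem_closure_iff.1 hx.1 (connectedComponentIn Ω x) ho.connectedComponentIn (mem_connectedComponentIn hxO)
  have h := connectedComponentIn_eq hy1
  apply hsat y hy2
  rw [← h]; exact mem_connectedComponentIn hxO

lemma sat_infDist {Ω W : Set E2} (ho : IsOpen Ω) (hb : IsBounded Ω) (hW : W ⊆ Ω) (hWo : IsOpen W)
    (hsat : ∀ x ∈ W, connectedComponentIn Ω x ⊆ W) {y : E2} (hy : y ∈ W) :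
    infDist y (frontier W) = infDist y (frontier Ω) := by
  have hG := frontier_ne ⟨y, hy⟩ (hb.subset hW)
  have hs := sat_frontier ho hW hWo hsat
  apply le_antisymm
  · rw [le_infDist (hG.mono hs)]
    intro q hq
    have hqW : q ∉ W := fun h => by
      rw [ho.frontier_eq] at hq; exact hq.2 (hW h)
    obtain ⟨q', hq', hd⟩ := frontier_between hy hqW
    exact (infDist_le_dist_of_mem hq').trans hd
  · exact infDist_le_infDist_of_subset hs hG

lemma sat_comps {Ω W : Set E2} (ho : IsOpen Ω) (hb : IsBounded Ω) (hW : W ⊆ Ω)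
    (hsat : ∀ x ∈ W, connectedComponentIn Ω x ⊆ W) {k : ℕ} (hk : nBddCompLe Ωᶜ k) : nBddCompLe Wᶜ k := by
  have key : ∀ C ∈ boundedComponents Wᶜ, ∃ D ∈ boundedComponents Ωᶜ, D ⊆ C ∧ D.Nonempty := by
    rintro C ⟨x, hx, rfl, hCb⟩
    have hpt : ∃ q ∈ Ωᶜ, q ∈ connectedComponentIn Wᶜ x := by
      by_cases hxO : x ∈ Ω
      · set D := connectedComponentIn Ω x with hD
        have hDO : D ⊆ Ω := connectedComponentIn_subset _ _
        have hxD : x ∈ D := mem_connectedComponentIn hxO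
        obtain ⟨q, hq⟩ := frontier_ne ⟨x, hxD⟩ (hb.subset hDO)
        have hqO : q ∈ frontier Ω := sat_frontier ho hDO ho.connectedComponentIn
          (fun y hy => by rw [hD, connectedComponentIn_eq hy]) hq
        rw [ho.frontier_eq] at hqO
        refine ⟨q, hqO.2, ?_⟩
        have hDW : D ⊆ Wᶜ := by
          intro y hy hyW
          apply hx
          apply hsat y hyW
          rw [← connectedComponentIn_eq hy]; exact hxD
        have hpc : IsPreconnected (insert q D) :=
          (isPreconnected_connectedComponentIn (F := Ω) (x := x)).subset_closure (subset_insert _ _)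
            (insert_subset (frontier_subset_closure hq) subset_closure)
        exact hpc.subset_connectedComponentIn (mem_insert_of_mem _ hxD)
          (insert_subset (show q ∈ Wᶜ from fun h => hqO.2 (hW h)) hDW) (mem_insert _ _)
      · exact ⟨x, hxO, mem_connectedComponentIn hx⟩
    obtain ⟨q, hqO, hqC⟩ := hpt
    have hsub : connectedComponentIn Ωᶜ q ⊆ connectedComponentIn Wᶜ x := by
      rw [connectedComponentIn_eq hqC]
      exact connectedComponentIn_mono q (compl_subset_compl.2 hW)
    exact ⟨connectedComponentIn Ωᶜ q, ⟨q, hqO, rfl, hCb.subset hsub⟩, hsub, q, mem_connectedComponentIn hqO⟩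
  choose! f hf1 hf2 hf3 using key
  have hinj : InjOn f (boundedComponents Wᶜ) := by
    intro C hC C' hC' hEq
    obtain ⟨q, hq⟩ := hf3 C hC
    have h1 := hf2 C hC hq
    have h2 := hf2 C' hC' (hEq ▸ hq)
    obtain ⟨x, -, rfl, -⟩ := hC
    obtain ⟨x', -, rfl, -⟩ := hC'
    rw [connectedComponentIn_eq h1, connectedComponentIn_eq h2]
  exact ⟨Set.Finite.of_injOn hf1 hinj hk.1, (ncard_le_ncard_of_injOn f hf1 hinj hk.1).trans hk.2⟩

lemma exists_exhaust {Ω : Set E2} (ho : IsOpen Ω) {z : E2} (hz : z ∈ Ω) :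
    ∃ O : ℕ → Set E2, z ∈ O 0 ∧ (∀ n, IsPreconnected (O n)) ∧ (∀ n, IsOpen (O n)) ∧ Ω = ⋃ n, O n ∧
      ∀ n, ∀ x ∈ O n, connectedComponentIn Ω x = O n := by
  refine ⟨fun n => connectedComponentIn Ω (Nat.casesOn n z (fun m => TopologicalSpace.denseSeq E2 m)), mem_connectedComponentIn hz,
    fun n => isPreconnected_connectedComponentIn, fun n => ho.connectedComponentIn, ?_, fun n x hx => (connectedComponentIn_eq hx).symm⟩
  apply subset_antisymm
  · intro x hx
    obtain ⟨y, hy, n, rfl⟩ := (TopologicalSpace.denseRange_denseSeq E2).inter_open_nonempty (connectedComponentIn Ω x) ho.connectedComponentIn ⟨x, mem_connectedComponentIn hx⟩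
    refine mem_iUnion.2 ⟨n + 1, ?_⟩
    show x ∈ connectedComponentIn Ω (TopologicalSpace.denseSeq E2 n)
    rw [← connectedComponentIn_eq hy]
    exact mem_connectedComponentIn hx
  · exact iUnion_subset fun n => connectedComponentIn_subset _ _

lemma general_case {Ω : Set E2} (ho : IsOpen Ω) (hb : IsBounded Ω) {k : ℕ} (hk : nBddCompLe Ωᶜ k) {z : E2} {ρ : ℝ}
    (hzO : z ∈ Ω) (hz : infDist z (frontier Ω) = ρ) (hmax : ∀ y ∈ Ω, infDist y (frontier Ω) ≤ ρ) (hρ : 0 < ρ)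
    (hH : μH[1] (frontier Ω) < ⊤) {φ : E2 → E2} (hφ : ContDiff ℝ 1 φ) (hc : HasCompactSupport φ) (hn : ∀ x, ‖φ x‖ ≤ 1) :
    (volume Ω).toReal ≤ ((2 * (μH[1] (frontier Ω)).toReal - ∫ x in Ω, divg φ x) + Real.pi * ((k:ℝ) - 1) * ρ) * ρ := by
  obtain ⟨O, hz0, hOc, hOo, hOe, hOs⟩ := exists_exhaust ho hzO
  set W : ℕ → Set E2 := fun N => ⋃ i : Fin (N + 1), O i with hWdef
  have hWO : ∀ N, W N ⊆ Ω := fun N => by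
    rw [hOe]; exact iUnion_subset fun i => subset_iUnion O i
  have hWo : ∀ N, IsOpen (W N) := fun N => isOpen_iUnion fun i => hOo i
  have hzW : ∀ N, z ∈ W N := fun N => mem_iUnion.2 ⟨0, hz0⟩
  have hsat : ∀ N, ∀ x ∈ W N, connectedComponentIn Ω x ⊆ W N := by
    intro N x hx
    obtain ⟨i, hi⟩ := mem_iUnion.1 hx
    rw [hOs i x hi]
    exact subset_iUnion (fun i : Fin (N + 1) => O i) i
  have hmono : Monotone W := by
    intro N M hNM
    refine iUnion_subset fun i => ?_
    exact subset_iUnion (fun j : Fin (M + 1) => O j) ⟨i, by omega⟩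
  have hWU : ⋃ N, W N = Ω := by
    apply subset_antisymm (iUnion_subset hWO)
    rw [hOe]
    refine iUnion_subset fun n => ?_
    refine Subset.trans ?_ (subset_iUnion W n)
    exact subset_iUnion (fun j : Fin (n + 1) => O j) ⟨n, by omega⟩
  have hfin : volume Ω ≠ ⊤ := hb.measure_lt_top.ne
  have hstep : ∀ N, (volume (W N)).toReal ≤
      ((2 * (μH[1] (frontier Ω)).toReal - ∫ x in W N, divg φ x) + Real.pi * ((k:ℝ) - 1) * ρ) * ρ := by
    intro N
    have hs := sat_frontier ho (hWO N) (hWo N) (hsat N)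
    have hHle : μH[1] (frontier (W N)) ≤ μH[1] (frontier Ω) := measure_mono hs
    have h := finite_case (hWo N) (hb.subset (hWO N)) (sat_comps ho hb (hWO N) (hsat N) hk)
      (fun i : Fin (N + 1) => O i) (fun i => hOc i) rfl (hzW N)
      ((sat_infDist ho hb (hWO N) (hWo N) (hsat N) (hzW N)).trans hz)
      (fun y hy => by rw [sat_infDist ho hb (hWO N) (hWo N) (hsat N) hy]; exact hmax y (hWO N hy)) hρ
      (hHle.trans_lt hH) hφ hc hn
    refine h.trans ?_
    have := ENNReal.toReal_mono hH.ne hHle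
    gcongr
  have hl1 : Tendsto (fun N => (volume (W N)).toReal) atTop (𝓝 (volume Ω).toReal) := by
    have := tendsto_measure_iUnion_atTop (μ := volume) hmono
    rw [hWU] at this
    exact (ENNReal.tendsto_toReal hfin).comp this
  have hdi : Integrable (divg φ) (volume : Measure E2) := (divg_cont hφ).integrable_of_hasCompactSupport (divg_supp hc)
  have hl2 : Tendsto (fun N => ∫ x in W N, divg φ x) atTop (𝓝 (∫ x in Ω, divg φ x)) := by
    have := tendsto_setIntegral_of_monotone (μ := volume) (f := divg φ) (fun N => (hWo N).measurableSet) hmono hdi.integrableOn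
    rwa [hWU] at this
  exact le_of_tendsto_of_tendsto' hl1 (((hl2.const_sub _).add_const _).mul_const _) hstep

lemma bonnesen_aux (k : ℕ) (Ω : Set E2) (h : memA k Ω)
    (hH : μH[1] (frontier Ω) < ⊤) :
    (volume Ω).toReal ≤
      (2 * (μH[1] (frontier Ω)).toReal - perimeter Ω
        + Real.pi * ((k : ℝ) - 1) * inradius Ω) * inradius Ω := by
  obtain ⟨hne, ho, hb, hk⟩ := h
  have hG := frontier_ne hne hb
  obtain ⟨z, hzc, hzm⟩ := (Metric.isCompact_of_isClosed_isBounded isClosed_closure hb.closure).exists_isMaxOn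
    hne.closure (continuous_infDist_pt (frontier Ω)).continuousOn
  have hpos : ∀ y ∈ Ω, 0 < infDist y (frontier Ω) := by
    intro y hy
    refine (isClosed_frontier.notMem_iff_infDist_pos hG).1 ?_
    rw [ho.frontier_eq]
    exact fun h => h.2 hy
  have hle : ∀ y ∈ Ω, infDist y (frontier Ω) ≤ infDist z (frontier Ω) := fun y hy => hzm (subset_closure hy)
  have hρ : 0 < infDist z (frontier Ω) := by
    obtain ⟨y, hy⟩ := hne
    exact (hpos y hy).trans_le (hle y hy)
  have hzO : z ∈ Ω := by
    by_contra hz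
    have : z ∈ frontier Ω := by rw [ho.frontier_eq]; exact ⟨hzc, hz⟩
    rw [infDist_zero_of_mem this] at hρ
    exact lt_irrefl _ hρ
  have hin : inradius Ω = infDist z (frontier Ω) := by
    apply IsGreatest.csSup_eq
    refine ⟨⟨z, hzO, rfl⟩, ?_⟩
    rintro _ ⟨y, hy, rfl⟩
    exact hle y hy
  rw [hin]
  set ρ := infDist z (frontier Ω) with hρdef
  have hP : perimeter Ω ≤ 2 * (μH[1] (frontier Ω)).toReal + Real.pi * ((k : ℝ) - 1) * ρ - (volume Ω).toReal / ρ := by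
    apply csSup_le
    · exact ⟨_, fun _ => 0, contDiff_const, HasCompactSupport.zero, by simp, rfl⟩
    · rintro r ⟨φ, hφ, hc, hn, rfl⟩
      have := general_case ho hb hk hzO rfl hle hρ hH hφ hc hn
      rw [← _root_.div_le_iff₀ hρ] at this
      linarith
  rw [← _root_.div_le_iff₀ hρ]
  linarith

end


/-- A Bonnesen-type inequality for sets in `𝒜ₖ`. -/
theorem bonnesen_type (k : ℕ) (Ω : Set E2) (h : memA k Ω)
    (hH : μH[1] (frontier Ω) < ⊤) :
    (volume Ω).toReal ≤
      (2 * (μH[1] (frontier Ω)).toReal - perimeter Ω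
        + Real.pi * ((k : ℝ) - 1) * inradius Ω) * inradius Ω :=
  bonnesen_aux k Ω h hH
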